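/- Solid Poincaré–Bendixson Theorem (Theorem C): Let Φ be a semiflow on X strongly focusing monotone with respect to the k-cone C with rank k = 2, satisfying the standing assumptions. If O⁺(x) is a precompact pseudo-ordered semiorbit, then either ω(x) is a nontrivial periodic orbit, or ω(x) is a set consisting of equilibria together with their potential connecting orbits; i.e., in the second case, for every z ∈ ω(x) one has ω(z) ⊆ E and α(z) ⊆ E, where α(z) is the α-limit set of z along the flow extension of Φ on ω(x). -/

import Mathlib

open Set Metric Filter

/-- A semiflow on `X`: continuous on `[0,∞) × X`, `Φ₀ = id`, `Φ_{s+t} = Φ_s ∘ Φ_t`. -/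
structure Semiflow (X : Type*) [NormedAddCommGroup X] [NormedSpace ℝ X] where
  toFun : ℝ → X → X
  cont : ContinuousOn (fun p : ℝ × X => toFun p.1 p.2) (Set.Ici (0:ℝ) ×ˢ Set.univ)
  map_zero : ∀ x, toFun 0 x = x
  map_add : ∀ s t : ℝ, 0 ≤ s → 0 ≤ t → ∀ x, toFun (s + t) x = toFun s (toFun t x)

section Defs

variable {X : Type*} [NormedAddCommGroup X] [NormedSpace ℝ X]

/-- A cone of rank `k`: a closed set, stable under all real scalings, containing a
`k`-dimensional subspace and no subspace of higher dimension. -/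
def IsKCone (C : Set X) (k : ℕ) : Prop :=
  IsClosed C ∧ (∀ (t : ℝ) (v : X), v ∈ C → t • v ∈ C) ∧
  (∃ W : Submodule ℝ X, (W : Set X) ⊆ C ∧ Module.rank ℝ W = k) ∧
  (∀ W : Submodule ℝ X, (W : Set X) ⊆ C → Module.rank ℝ W ≤ k)

/-- `C` is `k`-solid: some `k`-dimensional subspace `W` has `W \ {0} ⊆ int C`. -/
def IsKSolid (C : Set X) (k : ℕ) : Prop :=
  ∃ W : Submodule ℝ X, Module.rank ℝ W = k ∧ ((W : Set X) \ {0}) ⊆ interior C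

/-- `C` is complemented: some closed subspace of codimension `k` meets `C` only at `0`. -/
def IsComplementedCone (C : Set X) (k : ℕ) : Prop :=
  ∃ H : Submodule ℝ X, IsClosed (H : Set X) ∧ Module.rank ℝ (X ⧸ H) = k ∧
    (H : Set X) ∩ C = {0}

/-- The positive semiorbit `O⁺(x)`. -/
def posOrbit (Φ : Semiflow X) (x : X) : Set X := {y | ∃ t, 0 ≤ t ∧ y = Φ.toFun t x}

/-- The ω-limit set `ω(x) = ⋂_{s ≥ 0} cl {Φ_t(x) : t ≥ s}`. -/
def omegaSet (Φ : Semiflow X) (x : X) : Set X :=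
  ⋂ s ∈ Set.Ici (0:ℝ), closure {y | ∃ t, s ≤ t ∧ y = Φ.toFun t x}

/-- The set of equilibria of `Φ`. -/
def equilibria (Φ : Semiflow X) : Set X := {p | ∀ t, 0 ≤ t → Φ.toFun t p = p}

/-- `S` is invariant: `Φ_t(S) = S` for all `t ≥ 0`. -/
def Invariant (Φ : Semiflow X) (S : Set X) : Prop := ∀ t, 0 ≤ t → Φ.toFun t '' S = S

/-- A set is ordered w.r.t. `C` if any two of its points are ordered. -/
def OrderedSet (C S : Set X) : Prop := ∀ x ∈ S, ∀ y ∈ S, x - y ∈ C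

/-- A set is unordered w.r.t. `C` if it is not a singleton and any two distinct points are
unordered. -/
def UnorderedSet (C S : Set X) : Prop :=
  (¬ ∃ a, S = {a}) ∧ ∀ x ∈ S, ∀ y ∈ S, x ≠ y → x - y ∉ C

/-- Two sets `A ∼ B`: every point of `A` is ordered with every point of `B`. -/
def SetsOrdered (C A B : Set X) : Prop := ∀ a ∈ A, ∀ b ∈ B, a - b ∈ C

/-- `Φ` is strongly monotone with respect to the cone `C`. -/
def StronglyMonotone (Φ : Semiflow X) (C : Set X) : Prop :=
  (∀ t, 0 ≤ t → ∀ x y : X, x - y ∈ C → Φ.toFun t x - Φ.toFun t y ∈ C) ∧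
  (∀ t, 0 < t → ∀ x y : X, x - y ∈ C → x ≠ y → Φ.toFun t x - Φ.toFun t y ∈ interior C)

/-- `O⁺(x)` is pseudo-ordered. -/
def PseudoOrdered (Φ : Semiflow X) (C : Set X) (x : X) : Prop :=
  ∃ t₁ t₂ : ℝ, 0 ≤ t₁ ∧ 0 ≤ t₂ ∧ Φ.toFun t₁ x ≠ Φ.toFun t₂ x ∧
    Φ.toFun t₁ x - Φ.toFun t₂ x ∈ C

/-- A bounded operator `R` is strongly focusing w.r.t. `C` with separation index `κ`:
`0 ∉ R(C \ {0})` and every unit vector of `RC` is at distance at least `κ` from `X \ C`. -/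
def StronglyFocusing (R : X →L[ℝ] X) (C : Set X) (κ : ℝ) : Prop :=
  (∀ v ∈ C, v ≠ 0 → R v ≠ 0) ∧
  (∀ v ∈ R '' C, ‖v‖ = 1 → ∀ u ∉ C, κ ≤ ‖v - u‖)

/-- `Φ` is strongly focusing monotone with respect to `C`, with `x`-derivative `DΦ`. -/
def StronglyFocusingMonotone (Φ : Semiflow X) (DΦ : ℝ → X → X →L[ℝ] X) (C : Set X) : Prop :=
  (∀ t, 0 ≤ t → ∀ x : X, HasFDerivAt (Φ.toFun t) (DΦ t x) x) ∧
  (∀ t, 0 ≤ t → Continuous fun x : X => DΦ t x) ∧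
  StronglyMonotone Φ C ∧
  (∀ t, 0 < t → ∀ x : X, ∀ v ∈ C, v ≠ 0 → DΦ t x v ∈ interior C) ∧
  (∀ S : Set X, IsCompact S → Invariant Φ S →
    ∃ δ > (0:ℝ), ∃ T > (0:ℝ), ∃ κ > (0:ℝ), ∀ z ∈ S, ∀ x ∈ Metric.closedBall z δ,
      ∀ y ∈ Metric.closedBall z δ, ∃ R : X →L[ℝ] X,
        StronglyFocusing R C κ ∧ R (x - y) = Φ.toFun T x - Φ.toFun T y)

/-- `ψ` is a flow extension of `Φ` on the invariant set `S`. -/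
def IsFlowExtensionOn (Φ : Semiflow X) (ψ : ℝ → X → X) (S : Set X) : Prop :=
  (∀ t, 0 ≤ t → ∀ z ∈ S, ψ t z = Φ.toFun t z) ∧
  (∀ t : ℝ, ∀ z ∈ S, ψ t z ∈ S) ∧
  (∀ s t : ℝ, ∀ z ∈ S, ψ s (ψ t z) = ψ (s + t) z) ∧
  ContinuousOn (fun p : ℝ × X => ψ p.1 p.2) (Set.univ ×ˢ S)

/-- `Φ` admits a flow extension on each ω-limit set. -/
def AdmitsFlowExtensions (Φ : Semiflow X) : Prop :=
  ∀ x : X, ∃ ψ : ℝ → X → X, IsFlowExtensionOn Φ ψ (omegaSet Φ x)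

/-- The α-limit set of `z` along the (extended) flow `ψ`. -/
def alphaSet (ψ : ℝ → X → X) (z : X) : Set X :=
  ⋂ s ∈ Set.Ici (0:ℝ), closure {y | ∃ t, s ≤ t ∧ y = ψ (-t) z}

/-- Standing assumptions: `C` is a complemented `k`-solid `k`-cone, the derivative
`D_xΦ_t` is a compact operator for all `x` and `t > 0`, and `Φ` admits a flow extension on
each ω-limit set. -/
def StandingAssumptions (Φ : Semiflow X) (DΦ : ℝ → X → X →L[ℝ] X)
    (C : Set X) (k : ℕ) : Prop :=
  IsKCone C k ∧ IsKSolid C k ∧ IsComplementedCone C k ∧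
  (∀ t, 0 < t → ∀ x : X, IsCompactOperator ⇑(DΦ t x)) ∧
  AdmitsFlowExtensions Φ

end Defs

namespace SolidPB

section Plane

open Complex Topology

/-- `L` is a continuous logarithm of `p` on the interval between `a` and `b`. -/
def IsLogOn (p : ℝ → ℂ) (a b : ℝ) (L : ℝ → ℂ) : Prop :=
  ContinuousOn L (uIcc a b) ∧ ∀ t ∈ uIcc a b, exp (L t) = p t

open Classical in
/-- The total change of the argument of `p` from `a` to `b`. -/
noncomputable def rot (p : ℝ → ℂ) (a b : ℝ) : ℝ :=
  if h : ∃ L, IsLogOn p a b L then (h.choose b - h.choose a).im else 0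

theorem IsLogOn.sub_eq {p : ℝ → ℂ} {a b : ℝ} {L M : ℝ → ℂ} (hL : IsLogOn p a b L)
    (hM : IsLogOn p a b M) : L b - L a = M b - M a := by
  have hc : ContinuousOn (fun t => (L t - M t) / (2 * Real.pi * I)) (uIcc a b) :=
    (hL.1.sub hM.1).div_const _
  have hZ : ∀ t ∈ uIcc a b, ∃ n : ℤ, (L t - M t) / (2 * Real.pi * I) = n := by
    intro t ht
    have h := (hL.2 t ht).trans (hM.2 t ht).symm
    obtain ⟨n, hn⟩ := exp_eq_exp_iff_exists_int.1 h
    refine ⟨n, ?_⟩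
    rw [hn, add_sub_cancel_left, mul_div_assoc, div_self Complex.two_pi_I_ne_zero, mul_one]
  have hre : ContinuousOn (fun t => ((L t - M t) / (2 * Real.pi * I)).re) (uIcc a b) :=
    Complex.continuous_re.comp_continuousOn hc
  have hpre : IsPreconnected (uIcc a b) := isPreconnected_uIcc
  have key : ((L a - M a) / (2 * Real.pi * I)).re = ((L b - M b) / (2 * Real.pi * I)).re := by
    obtain ⟨n, hn⟩ := hZ a left_mem_uIcc
    obtain ⟨m, hm⟩ := hZ b right_mem_uIcc
    rw [hn, hm]
    simp only [Complex.intCast_re]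
    by_contra hne
    have himg := hpre.image _ hre
    have hoc := himg.ordConnected
    have han : (n : ℝ) ∈ (fun t => ((L t - M t) / (2 * Real.pi * I)).re) '' uIcc a b :=
      ⟨a, left_mem_uIcc, by simp only [hn, Complex.intCast_re]⟩
    have hbm : (m : ℝ) ∈ (fun t => ((L t - M t) / (2 * Real.pi * I)).re) '' uIcc a b :=
      ⟨b, right_mem_uIcc, by simp only [hm, Complex.intCast_re]⟩
    have hsub : ∀ r ∈ uIcc (n : ℝ) m, ∃ k : ℤ, r = k := by
      intro r hr
      obtain ⟨t, ht, rfl⟩ := hoc.uIcc_subset han hbm hr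
      obtain ⟨k, hk⟩ := hZ t ht
      exact ⟨k, by simp only [hk, Complex.intCast_re]⟩
    have hnm : n ≠ m := fun h => hne (by rw [h])
    rcases lt_or_gt_of_ne hnm with hlt | hlt
    · have h1 : (n : ℝ) + 1 ≤ m := by exact_mod_cast hlt
      obtain ⟨k, hk⟩ := hsub (n + 1 / 2) (by rw [mem_uIcc]; left; constructor <;> linarith)
      have h2 : (2 * n + 1 : ℝ) = 2 * k := by linarith
      have : (2 * n + 1 : ℤ) = 2 * k := by exact_mod_cast h2
      omega
    · have h1 : (m : ℝ) + 1 ≤ n := by exact_mod_cast hlt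
      obtain ⟨k, hk⟩ := hsub (m + 1 / 2) (by rw [mem_uIcc]; right; constructor <;> linarith)
      have h2 : (2 * m + 1 : ℝ) = 2 * k := by linarith
      have : (2 * m + 1 : ℤ) = 2 * k := by exact_mod_cast h2
      omega
  obtain ⟨n, hn⟩ := hZ a left_mem_uIcc
  obtain ⟨m, hm⟩ := hZ b right_mem_uIcc
  have h3 : (L a - M a) / (2 * Real.pi * I) = (L b - M b) / (2 * Real.pi * I) := by
    rw [hn, hm] at key ⊢
    simpa using key
  have h4 := (div_left_inj' Complex.two_pi_I_ne_zero).1 h3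
  linear_combination -h4

theorem IsLogOn.rot_eq {p : ℝ → ℂ} {a b : ℝ} {L : ℝ → ℂ} (hL : IsLogOn p a b L) :
    rot p a b = (L b - L a).im := by
  have h : ∃ L, IsLogOn p a b L := ⟨L, hL⟩
  rw [rot, dif_pos h, h.choose_spec.sub_eq hL]

theorem clamp_mem (a b t : ℝ) : max (min a b) (min t (max a b)) ∈ uIcc a b := by
  rw [uIcc, mem_Icc]
  exact ⟨le_max_left _ _, max_le (min_le_of_left_le (le_max_left _ _)) (min_le_right _ _)⟩

theorem clamp_eq {a b t : ℝ} (ht : t ∈ uIcc a b) : max (min a b) (min t (max a b)) = t := by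
  rw [uIcc, mem_Icc] at ht
  rw [min_eq_left ht.2, max_eq_right ht.1]

theorem exists_log_rect {f : ℝ × ℝ → ℂ} (hf : Continuous f) {a b c d : ℝ}
    (h0 : ∀ t ∈ uIcc a b, ∀ s ∈ uIcc c d, f (t, s) ≠ 0) :
    ∃ L : ℝ × ℝ → ℂ, Continuous L ∧
      ∀ t ∈ uIcc a b, ∀ s ∈ uIcc c d, exp (L (t, s)) = f (t, s) := by
  let g : ℝ × ℝ → ℂ := fun x =>
    f (max (min a b) (min x.1 (max a b)), max (min c d) (min x.2 (max c d)))
  have hg : Continuous g := by fun_prop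
  have hsc : IsSimplyConnected (univ : Set (ℝ × ℝ)) := by
    have := (convex_univ (𝕜 := ℝ) (E := ℝ × ℝ)).contractibleSpace univ_nonempty
    exact SimplyConnectedSpace.ofContractible _
  obtain ⟨L, hL, hLe⟩ := exists_continuousOn_eqOn_exp_comp hsc isOpen_univ hg.continuousOn (by
    rintro ⟨x, -, hx⟩
    exact h0 _ (clamp_mem a b x.1) _ (clamp_mem c d x.2) hx)
  refine ⟨L, by rwa [continuousOn_univ] at hL, fun t ht s hs => ?_⟩
  have := hLe (mem_univ (t, s))
  simp only [Function.comp_apply, g, clamp_eq ht, clamp_eq hs] at this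
  exact this

theorem exists_isLogOn {p : ℝ → ℂ} (hp : Continuous p) {a b : ℝ}
    (h0 : ∀ t ∈ uIcc a b, p t ≠ 0) : ∃ L, IsLogOn p a b L := by
  obtain ⟨L, hL, hLe⟩ := exists_log_rect (f := fun x => p x.1) (by fun_prop) (a := a) (b := b)
    (c := 0) (d := 0) (fun t ht s _ => h0 t ht)
  exact ⟨fun t => L (t, 0), by fun_prop, fun t ht => hLe t ht 0 left_mem_uIcc⟩

theorem rot_congr {p q : ℝ → ℂ} {a b : ℝ} (h : ∀ t ∈ uIcc a b, p t = q t) :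
    rot p a b = rot q a b := by
  have hiff : ∀ L, IsLogOn p a b L ↔ IsLogOn q a b L := fun L =>
    and_congr_right fun _ => forall₂_congr fun t ht => by rw [h t ht]
  have : IsLogOn p a b = IsLogOn q a b := funext fun L => propext (hiff L)
  unfold rot
  rw [this]

theorem IsLogOn.mono {p : ℝ → ℂ} {a b c d : ℝ} {L : ℝ → ℂ} (hL : IsLogOn p a b L)
    (hc : c ∈ uIcc a b) (hd : d ∈ uIcc a b) : IsLogOn p c d L :=
  ⟨hL.1.mono (uIcc_subset_uIcc hc hd), fun t ht => hL.2 t (uIcc_subset_uIcc hc hd ht)⟩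

theorem rot_add {p : ℝ → ℂ} (hp : Continuous p) {a b c : ℝ}
    (h0 : ∀ t ∈ uIcc a c, p t ≠ 0) (hb : b ∈ uIcc a c) :
    rot p a b + rot p b c = rot p a c := by
  obtain ⟨L, hL⟩ := exists_isLogOn hp h0
  rw [hL.rot_eq, (hL.mono left_mem_uIcc hb).rot_eq, (hL.mono hb right_mem_uIcc).rot_eq,
    ← Complex.add_im]
  congr 1; ring

theorem rot_neg {p : ℝ → ℂ} (hp : Continuous p) {a b : ℝ} (h0 : ∀ t ∈ uIcc a b, p t ≠ 0) :
    rot (fun t => - p t) a b = rot p a b := by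
  obtain ⟨L, hL⟩ := exists_isLogOn hp h0
  have : IsLogOn (fun t => - p t) a b (fun t => L t + Real.pi * I) := by
    refine ⟨hL.1.add continuousOn_const, fun t ht => ?_⟩
    rw [exp_add, hL.2 t ht, exp_pi_mul_I]; ring
  rw [hL.rot_eq, this.rot_eq]
  congr 1; ring

theorem rot_sub_comm {p q : ℝ → ℂ} (hp : Continuous p) (hq : Continuous q) {a b : ℝ}
    (h0 : ∀ t ∈ uIcc a b, p t ≠ q t) :
    rot (fun t => p t - q t) a b = rot (fun t => q t - p t) a b := by
  rw [← rot_neg (p := fun t => q t - p t) (by fun_prop)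
    (fun t ht => sub_ne_zero.2 (h0 t ht).symm)]
  exact rot_congr fun t _ => by ring

theorem rot_comp_add {p : ℝ → ℂ} (hp : Continuous p) {a b : ℝ} (c : ℝ)
    (h0 : ∀ t ∈ uIcc (c + a) (c + b), p t ≠ 0) :
    rot (fun t => p (c + t)) a b = rot p (c + a) (c + b) := by
  obtain ⟨L, hL⟩ := exists_isLogOn hp h0
  have hmem : ∀ t ∈ uIcc a b, c + t ∈ uIcc (c + a) (c + b) := by
    intro t ht
    rw [mem_uIcc] at ht ⊢
    rcases ht with h | h
    · left; constructor <;> linarith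
    · right; constructor <;> linarith
  have : IsLogOn (fun t => p (c + t)) a b (fun t => L (c + t)) :=
    ⟨hL.1.comp (by fun_prop) hmem, fun t ht => hL.2 _ (hmem t ht)⟩
  rw [hL.rot_eq, this.rot_eq]

theorem rot_rect {f : ℝ → ℝ → ℂ} (hf : Continuous fun x : ℝ × ℝ => f x.1 x.2) {a b c d : ℝ}
    (h0 : ∀ t ∈ uIcc a b, ∀ s ∈ uIcc c d, f t s ≠ 0) :
    rot (fun t => f t c) a b + rot (fun s => f b s) c d =
      rot (fun s => f a s) c d + rot (fun t => f t d) a b := by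
  obtain ⟨L, hL, hLe⟩ := exists_log_rect hf h0
  have h1 : ∀ s ∈ uIcc c d, IsLogOn (fun t => f t s) a b (fun t => L (t, s)) := fun s hs =>
    ⟨by fun_prop, fun t ht => hLe t ht s hs⟩
  have h2 : ∀ t ∈ uIcc a b, IsLogOn (fun s => f t s) c d (fun s => L (t, s)) := fun t ht =>
    ⟨by fun_prop, fun s hs => hLe t ht s hs⟩
  rw [(h1 c left_mem_uIcc).rot_eq, (h1 d right_mem_uIcc).rot_eq, (h2 a left_mem_uIcc).rot_eq,
    (h2 b right_mem_uIcc).rot_eq, ← Complex.add_im, ← Complex.add_im]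
  congr 1; ring

theorem exp_rot {p : ℝ → ℂ} (hp : Continuous p) {a b : ℝ} (h0 : ∀ t ∈ uIcc a b, p t ≠ 0) :
    exp (rot p a b * I) * (‖p b‖ * p a) = ‖p a‖ * p b := by
  obtain ⟨L, hL⟩ := exists_isLogOn hp h0
  rw [hL.rot_eq, ← hL.2 a left_mem_uIcc, ← hL.2 b right_mem_uIcc, Complex.norm_exp,
    Complex.norm_exp, Complex.ofReal_exp, Complex.ofReal_exp, ← exp_add, ← exp_add, ← exp_add]
  congr 1
  apply Complex.ext <;> simp [add_comm]

theorem abs_im_log_one_add_le {z : ℂ} (hz : ‖z‖ ≤ 1 / 2) : |(log (1 + z)).im| ≤ 3 / 2 * ‖z‖ :=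
  (Complex.abs_im_le_norm _).trans (Complex.norm_log_one_add_half_le_self hz)

theorem rot_near_int {p : ℝ → ℂ} (hp : Continuous p) {a b : ℝ} (h0 : ∀ t ∈ uIcc a b, p t ≠ 0)
    {η : ℝ} (hη : η ≤ 1 / 2) (h : ‖p b - p a‖ ≤ η * ‖p a‖) :
    ∃ n : ℤ, |rot p a b - 2 * Real.pi * n| ≤ 3 / 2 * η := by
  obtain ⟨L, hL⟩ := exists_isLogOn hp h0
  have ha := h0 a left_mem_uIcc
  have hna : 0 < ‖p a‖ := norm_pos_iff.2 ha
  have hz : ‖(p b - p a) / p a‖ ≤ η := by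
    rw [norm_div, div_le_iff₀ hna]; exact h
  have h1 : (1 + (p b - p a) / p a) = p b / p a := by field_simp; ring
  have hb := h0 b right_mem_uIcc
  have h2 : exp (L b - L a) = exp (log (1 + (p b - p a) / p a)) := by
    rw [h1, exp_log (div_ne_zero hb ha), exp_sub, hL.2 a left_mem_uIcc, hL.2 b right_mem_uIcc]
  obtain ⟨n, hn⟩ := exp_eq_exp_iff_exists_int.1 h2
  refine ⟨n, ?_⟩
  have h3 := abs_im_log_one_add_le (hz.trans hη)
  have h4 : rot p a b - 2 * Real.pi * n = (log (1 + (p b - p a) / p a)).im := by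
    rw [hL.rot_eq, hn]
    simp
    ring
  rw [h4]
  linarith

theorem rot_of_slit {p : ℝ → ℂ} (hp : Continuous p) {a b : ℝ} {u : ℂ} (hu : u ≠ 0)
    (h : ∀ t ∈ uIcc a b, p t / u ∈ slitPlane) :
    rot p a b = (p b / u).arg - (p a / u).arg := by
  have : IsLogOn p a b (fun t => log (p t / u) + log u) := by
    refine ⟨?_, fun t ht => ?_⟩
    · exact (ContinuousOn.clog (by fun_prop) h).add continuousOn_const
    · rw [exp_add, exp_log (slitPlane_ne_zero (h t ht)), exp_log hu, div_mul_cancel₀ _ hu]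
  rw [this.rot_eq]
  simp [Complex.log_im]

theorem rot_near {p q : ℝ → ℂ} (hp : Continuous p) (hq : Continuous q) {a b η : ℝ}
    (hη : η ≤ 1 / 2) (h0 : ∀ t ∈ uIcc a b, q t ≠ 0)
    (h : ∀ t ∈ uIcc a b, ‖p t - q t‖ ≤ η * ‖q t‖) :
    |rot p a b - rot q a b| ≤ 3 * η := by
  obtain ⟨L, hL⟩ := exists_isLogOn hq h0
  have hz : ∀ t ∈ uIcc a b, ‖(p t - q t) / q t‖ ≤ η := fun t ht => by
    rw [norm_div, div_le_iff₀ (norm_pos_iff.2 (h0 t ht))]; exact h t ht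
  have hs : ∀ t ∈ uIcc a b, 1 + (p t - q t) / q t ∈ slitPlane := fun t ht =>
    mem_slitPlane_of_norm_lt_one ((hz t ht).trans_lt (by linarith))
  have : IsLogOn p a b (fun t => L t + log (1 + (p t - q t) / q t)) := by
    refine ⟨hL.1.add (ContinuousOn.clog ?_ hs), fun t ht => ?_⟩
    · exact continuousOn_const.add
        ((hp.sub hq).continuousOn.div hq.continuousOn h0)
    · rw [exp_add, hL.2 t ht, exp_log (slitPlane_ne_zero (hs t ht))]
      have := h0 t ht
      field_simp; ring
  rw [this.rot_eq, hL.rot_eq]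
  have ha := abs_im_log_one_add_le ((hz a left_mem_uIcc).trans hη)
  have hb := abs_im_log_one_add_le ((hz b right_mem_uIcc).trans hη)
  have ha' := hz a left_mem_uIcc
  have hb' := hz b right_mem_uIcc
  simp only [Complex.sub_im, Complex.add_im]
  rw [abs_le] at ha hb ⊢
  constructor <;> linarith [ha.1, ha.2, hb.1, hb.2]

theorem rot_const {v : ℂ} (hv : v ≠ 0) (a b : ℝ) : rot (fun _ => v) a b = 0 := by
  have : IsLogOn (fun _ => v) a b (fun _ => log v) :=
    ⟨continuousOn_const, fun t _ => exp_log hv⟩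
  rw [this.rot_eq]; simp

theorem rot_near_const {p : ℝ → ℂ} (hp : Continuous p) {a b η : ℝ} {v : ℂ} (hv : v ≠ 0)
    (hη : η ≤ 1 / 2) (h : ∀ t ∈ uIcc a b, ‖p t - v‖ ≤ η * ‖v‖) : |rot p a b| ≤ 3 * η := by
  have := rot_near hp (continuous_const (y := v)) hη (fun _ _ => hv) h
  rwa [rot_const hv, sub_zero] at this

/-- The height of the arc `α` over `[a, b]`: its distance to the centre `c`. -/
noncomputable def height (a b : ℝ) (c : ℂ) (α : ℝ → ℂ) : ℝ := infDist c (α '' Icc a b)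

/-- An arc parametrised by `[a, b]` has a tangent circle around `c` at parameter `0`. -/
structure IsGate (ω : ℝ → ℂ) (a b : ℝ) (c : ℂ) : Prop where
  cont : Continuous ω
  neg : a < 0
  pos : 0 < b
  inj : InjOn ω (Icc a b)
  lt : ∀ τ ∈ Icc a b, τ ≠ 0 → ‖ω 0 - c‖ < ‖ω τ - c‖
  diam : ∀ τ ∈ Icc a b, ‖ω τ - ω 0‖ < ‖ω 0 - c‖

/-- Two arcs are within `ε` of each other over `[a, b]`. -/
def CloseOn (a b ε : ℝ) (α ω : ℝ → ℂ) : Prop := ∀ τ ∈ Icc a b, ‖α τ - ω τ‖ ≤ ε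

theorem CloseOn.mono {a b ε ε' : ℝ} {α ω : ℝ → ℂ} (h : CloseOn a b ε α ω) (hε : ε ≤ ε') :
    CloseOn a b ε' α ω := fun τ hτ => (h τ hτ).trans hε

/-- Two arcs over `[a, b]` have disjoint images. -/
def ArcsDisjoint (a b : ℝ) (α β : ℝ → ℂ) : Prop :=
  ∀ τ ∈ Icc a b, ∀ τ' ∈ Icc a b, α τ ≠ β τ'

theorem ArcsDisjoint.symm {a b : ℝ} {α β : ℝ → ℂ} (h : ArcsDisjoint a b α β) :
    ArcsDisjoint a b β α := fun τ hτ τ' hτ' => (h τ' hτ' τ hτ).symm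

theorem not_slit {c y w : ℂ} (hne : w ≠ y) (h1 : ‖y - c‖ ≤ ‖w - c‖)
    (h2 : ‖w - y‖ < 2 * ‖y - c‖) : (y - w) / (c - y) ∈ slitPlane := by
  have hu : c - y ≠ 0 := by
    intro h
    have : y - c = 0 := by rw [← neg_sub, h, neg_zero]
    rw [this, norm_zero, mul_zero] at h2
    exact absurd h2 (not_lt.2 (norm_nonneg _))
  by_contra hs
  rw [mem_slitPlane_iff_not_le_zero, not_not] at hs
  obtain ⟨lam, hlam⟩ : ∃ r : ℝ, (y - w) / (c - y) = -(r : ℂ) := by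
    refine ⟨-((y - w) / (c - y)).re, ?_⟩
    have := (Complex.le_def.1 hs).2
    apply Complex.ext <;> simp_all
  have hl0 : 0 ≤ lam := by
    rw [hlam] at hs
    have := (Complex.le_def.1 hs).1
    simpa using this
  have hw : w - y = lam * (c - y) := by
    rw [div_eq_iff hu] at hlam
    linear_combination -hlam
  have hw2 : w - c = ((lam - 1 : ℝ) : ℂ) * (c - y) := by
    push_cast
    linear_combination hw
  have hpos : 0 < ‖c - y‖ := norm_pos_iff.2 hu
  rw [hw2, norm_mul, Complex.norm_real, norm_sub_rev y c, Real.norm_eq_abs] at h1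
  rw [hw, norm_mul, Complex.norm_real, norm_sub_rev y c, Real.norm_eq_abs, abs_of_nonneg hl0] at h2
  have h3 : 1 ≤ |lam - 1| := by
    by_contra h
    push Not at h
    nlinarith
  have h4 : lam < 2 := lt_of_mul_lt_mul_right h2 hpos.le
  have hl : lam = 0 := by
    rcases le_abs.1 h3 with h | h
    · linarith
    · linarith
  apply hne
  rw [hl] at hw
  simpa [sub_eq_zero] using hw

namespace IsGate

variable {ω : ℝ → ℂ} {a b : ℝ} {c : ℂ}

theorem zero_mem (g : IsGate ω a b c) : (0 : ℝ) ∈ Icc a b := ⟨g.neg.le, g.pos.le⟩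
theorem left_mem (g : IsGate ω a b c) : a ∈ Icc a b := ⟨le_rfl, g.neg.le.trans g.pos.le⟩
theorem right_mem (g : IsGate ω a b c) : b ∈ Icc a b := ⟨g.neg.le.trans g.pos.le, le_rfl⟩

theorem radius_pos (g : IsGate ω a b c) : 0 < ‖ω 0 - c‖ := by
  have := g.diam 0 g.zero_mem
  simpa using this

theorem slit (g : IsGate ω a b c) {τ : ℝ} (hτ : τ ∈ Icc a b) (h0 : τ ≠ 0) :
    (ω 0 - ω τ) / (c - ω 0) ∈ slitPlane := by
  apply not_slit
  · exact fun h => h0 (g.inj hτ g.zero_mem h)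
  · exact (g.lt τ hτ h0).le
  · linarith [g.diam τ hτ, g.radius_pos]

/-- The bottom rotation constant of a gate. -/
noncomputable def kap (ω : ℝ → ℂ) (a b : ℝ) (c : ℂ) : ℝ :=
  ((ω 0 - ω b) / (c - ω 0)).arg - ((ω 0 - ω a) / (c - ω 0)).arg

/-- The turning of a gate. -/
noncomputable def turn (ω : ℝ → ℂ) (a b : ℝ) : ℝ :=
  rot (fun τ => ω b - ω τ) a 0 + rot (fun σ => ω σ - ω a) 0 b

theorem exp_arg_mul (z : ℂ) : exp (z.arg * I) * ‖z‖ = z := by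
  rw [mul_comm, Complex.norm_mul_exp_arg_mul_I]

theorem exp_kap (g : IsGate ω a b c) :
    exp ((kap ω a b c - turn ω a b : ℝ) * I) = -1 := by
  have hu : c - ω 0 ≠ 0 := by
    have := g.radius_pos
    rw [norm_sub_rev] at this
    exact norm_pos_iff.1 this
  have h1 := exp_arg_mul ((ω 0 - ω b) / (c - ω 0))
  have h2 := exp_arg_mul ((ω 0 - ω a) / (c - ω 0))
  have hb0 : ω b - ω 0 ≠ 0 := sub_ne_zero.2 fun h => g.pos.ne' (g.inj g.right_mem g.zero_mem h)
  have ha0 : ω 0 - ω a ≠ 0 := sub_ne_zero.2 fun h => g.neg.ne' (g.inj g.zero_mem g.left_mem h)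
  have hba : ω b - ω a ≠ 0 := sub_ne_zero.2 fun h =>
    (g.neg.trans g.pos).ne' (g.inj g.right_mem g.left_mem h)
  have h3 := exp_rot (p := fun τ => ω b - ω τ) (a := a) (b := 0)
    (by have := g.cont; fun_prop) (by
      intro t ht
      rw [uIcc_of_le g.neg.le] at ht
      exact sub_ne_zero.2 fun h => (ht.2.trans_lt g.pos).ne'
        (g.inj g.right_mem ⟨ht.1, ht.2.trans g.pos.le⟩ h))
  have h4 := exp_rot (p := fun τ => ω τ - ω a) (a := 0) (b := b)
    (by have := g.cont; fun_prop) (by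
      intro t ht
      rw [uIcc_of_le g.pos.le] at ht
      exact sub_ne_zero.2 fun h => (g.neg.trans_le ht.1).ne'
        (g.inj ⟨g.neg.le.trans ht.1, ht.2⟩ g.left_mem h))
  have hrev : ω 0 - ω b = -(ω b - ω 0) := by ring
  simp only [norm_div] at h1 h2
  rw [hrev, norm_neg] at h1
  simp only [kap, turn]
  rw [hrev]
  push_cast
  rw [sub_mul, sub_mul, add_mul, exp_sub, exp_sub, exp_add]
  set e1 := exp ((-(ω b - ω 0) / (c - ω 0)).arg * I)
  set e2 := exp (((ω 0 - ω a) / (c - ω 0)).arg * I) with he2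
  set e3 := exp ((rot (fun τ => ω b - ω τ) a 0 : ℝ) * I) with he3
  set e4 := exp ((rot (fun τ => ω τ - ω a) 0 b : ℝ) * I) with he4
  have n2 : e2 ≠ 0 := exp_ne_zero _
  have n3 : e3 ≠ 0 := exp_ne_zero _
  have n4 : e4 ≠ 0 := exp_ne_zero _
  have N1 : (‖ω b - ω 0‖ : ℂ) ≠ 0 := by exact_mod_cast norm_ne_zero_iff.2 hb0
  have N2 : (‖ω 0 - ω a‖ : ℂ) ≠ 0 := by exact_mod_cast norm_ne_zero_iff.2 ha0
  have N3 : (‖ω b - ω a‖ : ℂ) ≠ 0 := by exact_mod_cast norm_ne_zero_iff.2 hba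
  have Nu : (‖c - ω 0‖ : ℂ) ≠ 0 := by exact_mod_cast norm_ne_zero_iff.2 hu
  push_cast at h1 h2
  have E1 : e1 = -(ω b - ω 0) / (c - ω 0) * (‖c - ω 0‖ / ‖ω b - ω 0‖) := by
    rw [← h1]; field_simp
  have E2 : e2 = (ω 0 - ω a) / (c - ω 0) * (‖c - ω 0‖ / ‖ω 0 - ω a‖) := by
    rw [← h2]; field_simp
  have E3 : e3 = ‖ω b - ω a‖ * (ω b - ω 0) / (‖ω b - ω 0‖ * (ω b - ω a)) := by
    rw [eq_div_iff (mul_ne_zero N1 hba)]; exact h3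
  have E4 : e4 = ‖ω 0 - ω a‖ * (ω b - ω a) / (‖ω b - ω a‖ * (ω 0 - ω a)) := by
    rw [eq_div_iff (mul_ne_zero N3 ha0)]; exact h4
  rw [E1, E2, E3, E4]
  field_simp

theorem abs_kap_sub (g : IsGate ω a b c) : 3 ≤ |kap ω a b c - turn ω a b| := by
  have h := g.exp_kap
  rw [← exp_pi_mul_I, exp_eq_exp_iff_exists_int] at h
  obtain ⟨n, hn⟩ := h
  have h1 : kap ω a b c - turn ω a b = Real.pi + n * (2 * Real.pi) := by
    have := congrArg Complex.im hn
    simpa using this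
  rw [h1]
  have hpi := Real.pi_gt_three
  rcases le_or_gt 0 n with h | h
  · have : (0 : ℝ) ≤ n := by exact_mod_cast h
    exact le_abs.2 (Or.inl (by nlinarith))
  · have : (n : ℝ) ≤ -1 := by exact_mod_cast (by omega : n ≤ -1)
    exact le_abs.2 (Or.inr (by nlinarith))

theorem exists_pos_le {f : ℝ → ℝ} (hf : Continuous f) {a b : ℝ} (h : ∀ t ∈ Icc a b, 0 < f t) :
    ∃ m > 0, ∀ t ∈ Icc a b, m ≤ f t := by
  rcases (Icc a b).eq_empty_or_nonempty with he | hne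
  · exact ⟨1, one_pos, by simp [he]⟩
  · obtain ⟨t, ht, hm⟩ := isCompact_Icc.exists_isMinOn hne hf.continuousOn
    exact ⟨f t, h t ht, fun s hs => hm hs⟩

theorem turn_near (g : IsGate ω a b c) {η : ℝ} (hη : 0 < η) :
    ∃ ε > 0, ∀ α β : ℝ → ℂ, Continuous α → Continuous β → CloseOn a b ε α ω →
      CloseOn a b ε β ω →
      |rot (fun τ => β b - α τ) a 0 - rot (fun τ => ω b - ω τ) a 0| ≤ η ∧
      |rot (fun σ => β σ - α a) 0 b - rot (fun σ => ω σ - ω a) 0 b| ≤ η := by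
  have hω := g.cont
  obtain ⟨m1, hm1, h1⟩ := exists_pos_le (f := fun τ => ‖ω b - ω τ‖) (a := a) (b := 0)
    (by fun_prop) (fun t ht => norm_pos_iff.2 (sub_ne_zero.2 fun h => (ht.2.trans_lt g.pos).ne'
        (g.inj g.right_mem ⟨ht.1, ht.2.trans g.pos.le⟩ h)))
  obtain ⟨m2, hm2, h2⟩ := exists_pos_le (f := fun τ => ‖ω τ - ω a‖) (a := 0) (b := b)
    (by fun_prop) (fun t ht => norm_pos_iff.2 (sub_ne_zero.2 fun h => (g.neg.trans_le ht.1).ne'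
        (g.inj ⟨g.neg.le.trans ht.1, ht.2⟩ g.left_mem h)))
  obtain ⟨δ, hδ, hδ1, hδ2⟩ : ∃ δ : ℝ, 0 < δ ∧ δ ≤ 1 / 2 ∧ 3 * δ ≤ η :=
    ⟨min (1 / 2) (η / 3), by positivity, min_le_left _ _, by
      linarith [min_le_right (1 / 2 : ℝ) (η / 3)]⟩
  refine ⟨min m1 m2 * δ / 2, by positivity, fun α β hα hβ hca hcb => ⟨?_, ?_⟩⟩
  · refine (rot_near (by fun_prop) (by fun_prop) hδ1 ?_ ?_).trans hδ2
    · intro t ht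
      rw [uIcc_of_le g.neg.le] at ht
      exact norm_pos_iff.1 (hm1.trans_le (h1 t ht))
    · intro t ht
      rw [uIcc_of_le g.neg.le] at ht
      have e : β b - α t - (ω b - ω t) = (β b - ω b) - (α t - ω t) := by ring
      rw [e]
      have i1 := hcb b g.right_mem
      have i2 := hca t ⟨ht.1, ht.2.trans g.pos.le⟩
      have i3 := norm_sub_le (β b - ω b) (α t - ω t)
      have i4 := h1 t ht
      have i5 := min_le_left m1 m2
      nlinarith
  · refine (rot_near (by fun_prop) (by fun_prop) hδ1 ?_ ?_).trans hδ2
    · intro t ht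
      rw [uIcc_of_le g.pos.le] at ht
      exact norm_pos_iff.1 (hm2.trans_le (h2 t ht))
    · intro t ht
      rw [uIcc_of_le g.pos.le] at ht
      have e : β t - α a - (ω t - ω a) = (β t - ω t) - (α a - ω a) := by ring
      rw [e]
      have i1 := hca a g.left_mem
      have i2 := hcb t ⟨g.neg.le.trans ht.1, ht.2⟩
      have i3 := norm_sub_le (β t - ω t) (α a - ω a)
      have i4 := h2 t ht
      have i5 := min_le_right m1 m2
      nlinarith

theorem half_rect (g : IsGate ω a b c) {α β : ℝ → ℂ} (hα : Continuous α)
    (hβ : Continuous β) (hd : ArcsDisjoint a b α β) :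
    rot (fun τ => β 0 - α τ) a 0 + rot (fun σ => α 0 - β σ) 0 b =
      rot (fun σ => β σ - α a) 0 b + rot (fun τ => β b - α τ) a 0 := by
  have h := rot_rect (f := fun τ σ => β σ - α τ) (a := a) (b := 0) (c := 0) (d := b)
    (by fun_prop) (by
      intro t ht s hs
      rw [uIcc_of_le g.neg.le] at ht
      rw [uIcc_of_le g.pos.le] at hs
      exact sub_ne_zero.2 (hd t ⟨ht.1, ht.2.trans g.pos.le⟩ s ⟨g.neg.le.trans hs.1, hs.2⟩).symm)
  rw [← h]
  congr 1
  apply rot_sub_comm continuous_const hβ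
  intro s hs
  rw [uIcc_of_le g.pos.le] at hs
  exact hd 0 g.zero_mem s ⟨g.neg.le.trans hs.1, hs.2⟩

theorem sum_near (g : IsGate ω a b c) {η : ℝ} (hη : 0 < η) :
    ∃ ε > 0, ∀ α β : ℝ → ℂ, Continuous α → Continuous β → CloseOn a b ε α ω →
      CloseOn a b ε β ω → ArcsDisjoint a b α β →
      |rot (fun τ => β 0 - α τ) a b + rot (fun τ => α 0 - β τ) a b - 2 * turn ω a b| ≤ η := by
  obtain ⟨ε, hε, h⟩ := g.turn_near (η := η / 4) (by positivity)
  refine ⟨ε, hε, fun α β hα hβ hca hcb hd => ?_⟩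
  have h0 : (0 : ℝ) ∈ uIcc a b := by
    rw [uIcc_of_le (g.neg.le.trans g.pos.le)]; exact g.zero_mem
  have r1 := rot_add (p := fun τ => β 0 - α τ) (by fun_prop) (a := a) (c := b) (b := 0)
    (by
      intro t ht
      rw [uIcc_of_le (g.neg.le.trans g.pos.le)] at ht
      exact sub_ne_zero.2 (hd t ht 0 g.zero_mem).symm) h0
  have r2 := rot_add (p := fun τ => α 0 - β τ) (by fun_prop) (a := a) (c := b) (b := 0)
    (by
      intro t ht
      rw [uIcc_of_le (g.neg.le.trans g.pos.le)] at ht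
      exact sub_ne_zero.2 (hd 0 g.zero_mem t ht)) h0
  have q1 := g.half_rect hα hβ hd
  have q2 := g.half_rect hβ hα hd.symm
  obtain ⟨k1, k2⟩ := h α β hα hβ hca hcb
  obtain ⟨k3, k4⟩ := h β α hβ hα hcb hca
  rw [abs_le] at *
  simp only [turn]
  constructor <;> linarith [k1.1, k1.2, k2.1, k2.2, k3.1, k3.2, k4.1, k4.2]

theorem height_attained (g : IsGate ω a b c) {α : ℝ → ℂ} (hα : Continuous α) :
    ∃ τ ∈ Icc a b, height a b c α = ‖α τ - c‖ := by
  have hne : (Icc a b).Nonempty := ⟨0, g.zero_mem⟩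
  obtain ⟨y, ⟨τ, hτ, rfl⟩, hy⟩ := (isCompact_Icc.image hα).exists_infDist_eq_dist
    (hne.image α) c
  exact ⟨τ, hτ, by rw [height, hy, dist_comm, dist_eq_norm]⟩

theorem height_le {α : ℝ → ℂ} {τ : ℝ} (hτ : τ ∈ Icc a b) : height a b c α ≤ ‖α τ - c‖ := by
  rw [height, ← dist_eq_norm, dist_comm]
  exact infDist_le_dist_of_mem (mem_image_of_mem _ hτ)

/-- Near the gate, the nearest point of an arc to the centre has a parameter close to `0`. -/
theorem min_near (g : IsGate ω a b c) {ρ : ℝ} (hρ : 0 < ρ) :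
    ∃ ε > 0, ∀ β : ℝ → ℂ, CloseOn a b ε β ω → ∀ τ ∈ Icc a b, ‖β τ - c‖ ≤ ‖β 0 - c‖ →
      |τ| < ρ := by
  have hω := g.cont
  have key : ∃ m > 0, ∀ t ∈ Icc a b, ρ ≤ |t| → m ≤ ‖ω t - c‖ - ‖ω 0 - c‖ := by
    have hcpt : IsCompact (Icc a b ∩ {t | ρ ≤ |t|}) :=
      isCompact_Icc.inter_right (isClosed_le continuous_const continuous_abs)
    rcases (Icc a b ∩ {t | ρ ≤ |t|}).eq_empty_or_nonempty with he | hne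
    · refine ⟨1, one_pos, fun t ht hr => ?_⟩
      have : t ∈ Icc a b ∩ {t | ρ ≤ |t|} := ⟨ht, hr⟩
      rw [he] at this
      exact this.elim
    · obtain ⟨t, ht, hm⟩ := hcpt.exists_isMinOn hne
        (f := fun t => ‖ω t - c‖ - ‖ω 0 - c‖) (by fun_prop)
      refine ⟨‖ω t - c‖ - ‖ω 0 - c‖, ?_, fun s hs hr => hm ⟨hs, hr⟩⟩
      have : t ≠ 0 := by
        rintro rfl
        have := ht.2
        simp at this
        linarith
      linarith [g.lt t ht.1 this]
  obtain ⟨m, hm, hk⟩ := key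
  refine ⟨m / 4, by positivity, fun β hβ τ hτ hle => ?_⟩
  by_contra hcon
  push Not at hcon
  have h1 := hk τ hτ hcon
  have h2 := hβ τ hτ
  have h3 := hβ 0 g.zero_mem
  have h4 : ‖ω τ - c‖ ≤ ‖β τ - c‖ + ‖β τ - ω τ‖ := by
    have := norm_sub_le (β τ - c) (β τ - ω τ)
    simpa using this
  have h5 : ‖β 0 - c‖ ≤ ‖ω 0 - c‖ + ‖β 0 - ω 0‖ := by
    have := norm_add_le (ω 0 - c) (β 0 - ω 0)
    simpa using this
  linarith

theorem bottom_near (g : IsGate ω a b c) {η : ℝ} (hη : 0 < η) :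
    ∃ ε > 0, ∀ α β : ℝ → ℂ, Continuous α → Continuous β → CloseOn a b ε α ω →
      CloseOn a b ε β ω → ArcsDisjoint a b α β → height a b c β ≤ height a b c α →
      |rot (fun τ => β 0 - α τ) a b - kap ω a b c| ≤ η := by
  have hω := g.cont
  have hR := g.radius_pos
  -- continuity of the bottom constant
  have hu : c - ω 0 ≠ 0 := by
    rw [norm_sub_rev] at hR
    exact norm_pos_iff.1 hR
  have hcb : ContinuousAt (fun x : ℂ × ℂ => (x.1 / x.2).arg) (ω 0 - ω b, c - ω 0) := by
    apply ContinuousAt.comp (g := Complex.arg) (f := fun x : ℂ × ℂ => x.1 / x.2)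
    · exact Complex.continuousAt_arg (g.slit g.right_mem g.pos.ne')
    · exact ContinuousAt.div continuousAt_fst continuousAt_snd hu
  have hca : ContinuousAt (fun x : ℂ × ℂ => (x.1 / x.2).arg) (ω 0 - ω a, c - ω 0) := by
    apply ContinuousAt.comp (g := Complex.arg) (f := fun x : ℂ × ℂ => x.1 / x.2)
    · exact Complex.continuousAt_arg (g.slit g.left_mem g.neg.ne)
    · exact ContinuousAt.div continuousAt_fst continuousAt_snd hu
  obtain ⟨ν1, hν1, hb⟩ := Metric.continuousAt_iff.1 hcb (η / 4) (by positivity)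
  obtain ⟨ν2, hν2, ha⟩ := Metric.continuousAt_iff.1 hca (η / 4) (by positivity)
  have hb0 : 0 < ‖ω 0 - ω b‖ := norm_pos_iff.2
    (sub_ne_zero.2 fun h => g.pos.ne (g.inj g.zero_mem g.right_mem h))
  have ha0 : 0 < ‖ω 0 - ω a‖ := norm_pos_iff.2
    (sub_ne_zero.2 fun h => g.neg.ne' (g.inj g.zero_mem g.left_mem h))
  obtain ⟨δ, hδ, hδ1, hδ2⟩ : ∃ δ : ℝ, 0 < δ ∧ δ ≤ 1 / 2 ∧ 12 * δ ≤ η :=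
    ⟨min (1 / 2) (η / 12), by positivity, min_le_left _ _, by
      linarith [min_le_right (1 / 2 : ℝ) (η / 12)]⟩
  -- the tolerance
  obtain ⟨m, hm, m1, m2, m3, m4, m5⟩ : ∃ m > 0, m < ν1 ∧ m < ν2 ∧ m ≤ δ * ‖ω 0 - ω b‖ ∧
      m ≤ δ * ‖ω 0 - ω a‖ ∧ 4 * m < ‖ω 0 - c‖ := by
    have h1 : ∀ᶠ m : ℝ in 𝓝[>] 0, 0 < m := self_mem_nhdsWithin
    have hev : ∀ r : ℝ, 0 < r → ∀ᶠ m : ℝ in 𝓝[>] 0, m < r := fun r hr =>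
      nhdsWithin_le_nhds (eventually_lt_nhds hr)
    obtain ⟨m, p0, p1, p2, p3, p4, p5⟩ := (h1.and ((hev ν1 hν1).and ((hev ν2 hν2).and
      ((hev (δ * ‖ω 0 - ω b‖) (by positivity)).and ((hev (δ * ‖ω 0 - ω a‖) (by positivity)).and
      (hev (‖ω 0 - c‖ / 4) (by positivity))))))).exists
    exact ⟨m, p0, p1, p2, p3.le, p4.le, by linarith⟩
  obtain ⟨ρ, hρ, hρω⟩ := Metric.continuousAt_iff.1 (hω.continuousAt (x := 0)) (m / 2)
    (by positivity)
  obtain ⟨ε0, hε0, hmin⟩ := g.min_near hρ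
  refine ⟨min ε0 (m / 4), by positivity, fun α β hα hβ hcα hcβ hd hh => ?_⟩
  have hcα' := hcα.mono (min_le_right _ _)
  have hcβ' := hcβ.mono (min_le_right _ _)
  obtain ⟨σ, hσ, hσe⟩ := g.height_attained hβ
  have hσα : ∀ τ ∈ Icc a b, ‖β σ - c‖ ≤ ‖α τ - c‖ := fun τ hτ =>
    hσe ▸ hh.trans (height_le hτ)
  have hσρ : |σ| < ρ := hmin β (hcβ.mono (min_le_left _ _)) σ hσ (hσe ▸ height_le g.zero_mem)
  have hab : a ≤ b := g.neg.le.trans g.pos.le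
  have hsmall : ∀ s ∈ uIcc 0 σ, s ∈ Icc a b ∧ ‖β s - ω 0‖ ≤ 3 / 4 * m := by
    intro s hs
    have hsI : s ∈ Icc a b := by
      have : uIcc 0 σ ⊆ Icc a b := by
        rw [← uIcc_of_le hab]
        exact uIcc_subset_uIcc (by rw [uIcc_of_le hab]; exact g.zero_mem)
          (by rw [uIcc_of_le hab]; exact hσ)
      exact this hs
    refine ⟨hsI, ?_⟩
    have hsρ : |s| < ρ := by
      refine lt_of_le_of_lt ?_ hσρ
      have := abs_sub_left_of_mem_uIcc hs
      simpa using this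
    have h1 := hρω (x := s) (by simpa using hsρ)
    rw [dist_eq_norm] at h1
    have h2 := hcβ' s hsI
    have h3 := norm_add_le (β s - ω s) (ω s - ω 0)
    rw [sub_add_sub_cancel] at h3
    linarith
  have hσm := (hsmall σ right_mem_uIcc).2
  have hrect := rot_rect (f := fun τ σ => β σ - α τ) (a := a) (b := b) (c := 0) (d := σ)
    (by fun_prop) (by
      intro t ht s hs
      rw [uIcc_of_le hab] at ht
      exact sub_ne_zero.2 (hd t ht s (hsmall s hs).1).symm)
  have hdiff : ∀ τ ∈ Icc a b, ∀ s ∈ uIcc 0 σ, ‖β s - α τ - (ω 0 - ω τ)‖ ≤ m := by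
    intro τ hτ s hs
    have h1 := (hsmall s hs).2
    have h2 := hcα' τ hτ
    have e : β s - α τ - (ω 0 - ω τ) = (β s - ω 0) - (α τ - ω τ) := by ring
    rw [e]
    linarith [norm_sub_le (β s - ω 0) (α τ - ω τ)]
  have v1 : |rot (fun s => β s - α b) 0 σ| ≤ 3 * δ :=
    rot_near_const (by fun_prop) (norm_pos_iff.1 hb0) hδ1
      (fun s hs => (hdiff b g.right_mem s hs).trans m3)
  have v2 : |rot (fun s => β s - α a) 0 σ| ≤ 3 * δ :=
    rot_near_const (by fun_prop) (norm_pos_iff.1 ha0) hδ1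
      (fun s hs => (hdiff a g.left_mem s hs).trans m4)
  have hun : ‖ω 0 - c‖ - 3 / 4 * m ≤ ‖β σ - c‖ := by
    have := norm_sub_le (β σ - c) (β σ - ω 0)
    rw [sub_sub_sub_cancel_left] at this
    linarith
  have hu' : c - β σ ≠ 0 := by
    rw [← norm_pos_iff, norm_sub_rev]; linarith
  have v3 := rot_of_slit (p := fun τ => β σ - α τ) (a := a) (b := b) (by fun_prop) hu' (by
    intro t ht
    rw [uIcc_of_le hab] at ht
    apply not_slit (hd t ht σ hσ) (hσα t ht)
    have h1 := hdiff t ht σ right_mem_uIcc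
    have h2 := norm_add_le (β σ - α t - (ω 0 - ω t)) (ω 0 - ω t)
    rw [sub_add_cancel, norm_sub_rev (ω 0), norm_sub_rev (β σ)] at h2
    linarith [g.diam t ht])
  have hu2 : ‖(c - β σ) - (c - ω 0)‖ ≤ 3 / 4 * m := by
    rw [sub_sub_sub_cancel_left, norm_sub_rev]; exact hσm
  have w1 := hb (x := (β σ - α b, c - β σ)) (by
    rw [Prod.dist_eq, max_lt_iff]
    simp only [dist_eq_norm]
    exact ⟨(hdiff b g.right_mem σ right_mem_uIcc).trans_lt m1, by linarith⟩)
  have w2 := ha (x := (β σ - α a, c - β σ)) (by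
    rw [Prod.dist_eq, max_lt_iff]
    simp only [dist_eq_norm]
    exact ⟨(hdiff a g.left_mem σ right_mem_uIcc).trans_lt m2, by linarith⟩)
  rw [Real.dist_eq] at w1 w2
  simp only [kap]
  rw [v3] at hrect
  rw [abs_lt] at w1 w2
  rw [abs_le] at v1 v2 ⊢
  constructor <;> linarith [v1.1, v1.2, v2.1, v2.2, w1.1, w1.2, w2.1, w2.2]

/-- The local gate lemma. -/
theorem exists_consts (g : IsGate ω a b c) :
    ∃ κ₀ κ₁ : ℝ, 6 ≤ |κ₀ - κ₁| ∧ ∀ η > 0, ∃ ε > 0, ∀ α β : ℝ → ℂ, Continuous α → Continuous β →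
      CloseOn a b ε α ω → CloseOn a b ε β ω → ArcsDisjoint a b α β →
      (height a b c β ≤ height a b c α → |rot (fun τ => β 0 - α τ) a b - κ₀| ≤ η) ∧
      (height a b c α ≤ height a b c β → |rot (fun τ => β 0 - α τ) a b - κ₁| ≤ η) := by
  refine ⟨kap ω a b c, 2 * turn ω a b - kap ω a b c, ?_, fun η hη => ?_⟩
  · have e : kap ω a b c - (2 * turn ω a b - kap ω a b c) = 2 * (kap ω a b c - turn ω a b) := by
      ring
    rw [e, abs_mul, abs_two]
    linarith [g.abs_kap_sub]
  · obtain ⟨ε1, hε1, h1⟩ := g.bottom_near (η := η / 2) (by positivity)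
    obtain ⟨ε2, hε2, h2⟩ := g.sum_near (η := η / 2) (by positivity)
    refine ⟨min ε1 ε2, by positivity, fun α β hα hβ hca hcb hd => ⟨fun hh => ?_, fun hh => ?_⟩⟩
    · exact (h1 α β hα hβ (hca.mono (min_le_left _ _)) (hcb.mono (min_le_left _ _)) hd hh).trans
        (by linarith)
    · have k1 := h1 β α hβ hα (hcb.mono (min_le_left _ _)) (hca.mono (min_le_left _ _)) hd.symm hh
      have k2 := h2 α β hα hβ (hca.mono (min_le_right _ _)) (hcb.mono (min_le_right _ _)) hd
      rw [abs_le] at *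
      constructor <;> linarith [k1.1, k1.2, k2.1, k2.2]

end IsGate

theorem normSq_dist_aux {v p e : ℂ} {lam R : ℝ} (hR : lam ≤ R) (hl : 0 ≤ lam)
    (hv : v ≠ 0) (he : ‖e‖ = 1) (hp : p = lam * e) (hperp : (e * star v).re = 0) (s : ℝ)
    (hs : s ^ 2 = 1 / 4) :
    ‖p - R * e‖ < ‖(s : ℂ) * v - R * e‖ := by
  have h1 : ‖p - R * e‖ ^ 2 = (lam - R) ^ 2 := by
    rw [hp, ← sub_mul, norm_mul, he, mul_one, ← Complex.ofReal_sub, Complex.norm_real,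
      Real.norm_eq_abs, sq_abs]
  have he2 : e.re ^ 2 + e.im ^ 2 = 1 := by
    have := Complex.sq_norm e
    rw [he, Complex.normSq_apply] at this
    linarith
  have h2 : ‖(s : ℂ) * v - R * e‖ ^ 2 = s ^ 2 * ‖v‖ ^ 2 + R ^ 2 := by
    have hp : e.re * v.re + e.im * v.im = 0 := by simpa using hperp
    rw [Complex.sq_norm, Complex.sq_norm, Complex.normSq_apply, Complex.normSq_apply]
    simp
    linear_combination R ^ 2 * he2 - 2 * s * R * hp
  have hv' : 0 < ‖v‖ := norm_pos_iff.2 hv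
  apply lt_of_pow_lt_pow_left₀ 2 (norm_nonneg _)
  rw [h1, h2, hs]
  nlinarith [mul_nonneg hl (sub_nonneg.2 hR), sq_nonneg lam]

theorem exists_far_center {ω : ℝ → ℂ} (hω : Continuous ω) {l : ℝ} (hl : 0 < l)
    (hinj : ω (-l) ≠ ω l) (M : ℝ) (hM : ∀ t ∈ Icc (-l) l, ‖ω t - (ω (-l) + ω l) / 2‖ ≤ M) :
    ∃ c₀ : ℂ, (∀ t ∈ Icc (-l) l, 5 * M + 1 ≤ ‖ω t - c₀‖) ∧
      ∃ t₀ ∈ Icc (-l) l, ‖ω t₀ - c₀‖ < ‖ω (-l) - c₀‖ ∧ ‖ω t₀ - c₀‖ < ‖ω l - c₀‖ := by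
  set q := (ω (-l) + ω l) / 2 with hq
  set v := ω l - ω (-l) with hv
  have hv0 : v ≠ 0 := sub_ne_zero.2 hinj.symm
  have hM0 : 0 ≤ M := (norm_nonneg _).trans (hM 0 ⟨by linarith, hl.le⟩)
  have hlend : ω l - q = ((1 / 2 : ℝ) : ℂ) * v := by rw [hq, hv]; push_cast; ring
  have hrend : ω (-l) - q = ((-1 / 2 : ℝ) : ℂ) * v := by rw [hq, hv]; push_cast; ring
  have hnv : 0 < ‖v‖ := norm_pos_iff.2 hv0
  have hvv : (v * star v).re = ‖v‖ ^ 2 := by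
    rw [Complex.sq_norm, Complex.normSq_apply]; simp
  obtain ⟨t₀, ht₀, hft⟩ : (0 : ℝ) ∈ (fun t => ((ω t - q) * star v).re) '' Icc (-l) l := by
    apply intermediate_value_Icc (by linarith) (by fun_prop)
    rw [hlend, hrend, mul_assoc, mul_assoc, Complex.re_ofReal_mul, Complex.re_ofReal_mul, hvv]
    constructor <;> nlinarith
  simp only at hft
  have hstar : star v ≠ 0 := by simpa using hv0
  obtain ⟨e, lam, he, hperp, hlam, hpe⟩ : ∃ (e : ℂ) (lam : ℝ), ‖e‖ = 1 ∧ (e * star v).re = 0 ∧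
      0 ≤ lam ∧ ω t₀ - q = lam * e := by
    have hN : (‖v‖ : ℂ) ≠ 0 := by exact_mod_cast hnv.ne'
    have key : ∃ r : ℝ, ω t₀ - q = r * (I * v / ‖v‖) := by
      refine ⟨((ω t₀ - q) * star v).im / ‖v‖, ?_⟩
      have h1 : (ω t₀ - q) * star v = ((ω t₀ - q) * star v).im * I := by
        apply Complex.ext
        · rw [hft]; simp
        · simp
      have hvs : v * star v = ‖v‖ ^ 2 := Complex.mul_conj' v
      apply mul_right_cancel₀ hstar
      generalize ((ω t₀ - q) * star v).im = y at h1 ⊢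
      rw [h1]
      push_cast
      field_simp
      linear_combination (-(y : ℂ)) * hvs
    have hne : ‖I * v / ‖v‖‖ = 1 := by
      rw [norm_div, norm_mul, Complex.norm_I, one_mul, Complex.norm_real, norm_norm,
        div_self hnv.ne']
    have hpe : (I * v / ‖v‖ * star v).re = 0 := by
      have hvs : v * star v = ‖v‖ ^ 2 := Complex.mul_conj' v
      have : I * v / ‖v‖ * star v = (‖v‖ : ℝ) * I := by
        rw [div_mul_eq_mul_div, mul_assoc, hvs]; field_simp
      rw [this]; simp
    obtain ⟨r, hr⟩ := key
    rcases le_total 0 r with h | h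
    · exact ⟨_, r, hne, hpe, h, hr⟩
    · refine ⟨-(I * v / ‖v‖), -r, by rwa [norm_neg], ?_, by linarith, ?_⟩
      · rw [neg_mul, Complex.neg_re, hpe, neg_zero]
      · rw [hr]; push_cast; ring
  have hlM : lam ≤ M := by
    have := hM t₀ ht₀
    rw [hpe, norm_mul, he, mul_one, Complex.norm_real, Real.norm_eq_abs] at this
    exact (le_abs_self _).trans this
  have hshift : ∀ z : ℂ,
      z - (q + ((6 * M + 1 : ℝ) : ℂ) * e) = (z - q) - ((6 * M + 1 : ℝ) : ℂ) * e :=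
    fun z => by ring
  refine ⟨q + ((6 * M + 1 : ℝ) : ℂ) * e, fun t ht => ?_, t₀, ht₀, ?_, ?_⟩
  · rw [hshift]
    have h1 := norm_sub_norm_le (((6 * M + 1 : ℝ) : ℂ) * e) (ω t - q)
    rw [norm_mul, he, mul_one, Complex.norm_real, Real.norm_eq_abs,
      abs_of_nonneg (by positivity), norm_sub_rev _ (ω t - q)] at h1
    linarith [hM t ht]
  · rw [hshift, hshift, hrend]
    exact normSq_dist_aux (by linarith) hlam hv0 he hpe hperp _ (by norm_num)
  · rw [hshift, hshift, hlend]
    exact normSq_dist_aux (by linarith) hlam hv0 he hpe hperp _ (by norm_num)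

theorem exists_gate {ω : ℝ → ℂ} (hω : Continuous ω) {l : ℝ} (hl : 0 < l)
    (hinj : InjOn ω (Icc (-l) l)) :
    ∃ (s : ℝ) (c : ℂ), |s| < l ∧ IsGate (fun t => ω (s + t)) (-l - s) (l - s) c := by
  have hne : (Icc (-l) l).Nonempty := ⟨0, by linarith, hl.le⟩
  obtain ⟨M, hM⟩ := (isCompact_Icc (a := -l) (b := l)).exists_bound_of_continuousOn
    (f := fun t => ω t - (ω (-l) + ω l) / 2) (by fun_prop)
  have hll : ω (-l) ≠ ω l := fun h => by
    have := hinj ⟨le_rfl, by linarith⟩ ⟨by linarith, le_rfl⟩ h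
    linarith
  obtain ⟨c₀, hfar, t₀, ht₀, hle, hri⟩ := exists_far_center hω hl hll M hM
  obtain ⟨s, hs, hmin⟩ := isCompact_Icc.exists_isMinOn hne (f := fun t => ‖ω t - c₀‖)
    (by fun_prop)
  have hmin' : ∀ t ∈ Icc (-l) l, ‖ω s - c₀‖ ≤ ‖ω t - c₀‖ := fun t ht => hmin ht
  have hs1 : s ≠ -l := by
    rintro rfl
    exact absurd (hmin' t₀ ht₀) (not_le.2 hle)
  have hs2 : s ≠ l := by
    rintro rfl
    exact absurd (hmin' t₀ ht₀) (not_le.2 hri)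
  have hs1' : -l < s := lt_of_le_of_ne hs.1 hs1.symm
  have hs2' : s < l := lt_of_le_of_ne hs.2 hs2
  have hmem : ∀ τ ∈ Icc (-l - s) (l - s), s + τ ∈ Icc (-l) l := fun τ hτ =>
    ⟨by linarith [hτ.1], by linarith [hτ.2]⟩
  have hhalf : ω s - (ω s + c₀) / 2 = (ω s - c₀) / 2 := by ring
  have hnh : ‖(ω s - c₀) / 2‖ = ‖ω s - c₀‖ / 2 := by rw [norm_div]; norm_num
  refine ⟨s, (ω s + c₀) / 2, abs_lt.2 ⟨hs1', hs2'⟩, by fun_prop, by linarith, by linarith,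
    ?_, ?_, ?_⟩
  · intro τ hτ τ' hτ' h
    have := hinj (hmem τ hτ) (hmem τ' hτ') h
    linarith
  · intro τ hτ h0
    simp only [add_zero]
    by_contra hcon
    push Not at hcon
    have hm := hmin' _ (hmem τ hτ)
    have hpar := parallelogram_law_with_norm ℝ (ω (s + τ) - (ω s + c₀) / 2)
      (ω s - (ω s + c₀) / 2)
    have e1 : ω (s + τ) - (ω s + c₀) / 2 + (ω s - (ω s + c₀) / 2) = ω (s + τ) - c₀ := by ring
    rw [e1] at hpar
    have h2 : ‖ω s - (ω s + c₀) / 2‖ = ‖ω s - c₀‖ / 2 := by rw [hhalf, hnh]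
    have h3 : ‖ω (s + τ) - (ω s + c₀) / 2 - (ω s - (ω s + c₀) / 2)‖ = 0 := by
      rw [h2] at hpar hcon
      have := norm_nonneg (ω (s + τ) - (ω s + c₀) / 2 - (ω s - (ω s + c₀) / 2))
      have n1 := norm_nonneg (ω (s + τ) - (ω s + c₀) / 2)
      have n2 := norm_nonneg (ω s - c₀)
      nlinarith
    rw [norm_eq_zero] at h3
    have h4 : ω (s + τ) = ω s := by linear_combination h3
    have := hinj (hmem τ hτ) hs h4
    exact h0 (by linarith)
  · intro τ hτ
    simp only [add_zero]
    rw [hhalf, hnh]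
    have h1 := hfar s hs
    have h2 := hM _ (hmem τ hτ)
    have h3 := hM _ hs
    have h4 := norm_sub_le (ω (s + τ) - (ω (-l) + ω l) / 2) (ω s - (ω (-l) + ω l) / 2)
    rw [sub_sub_sub_cancel_right] at h4
    have h5 := (norm_nonneg _).trans h3
    linarith

/-- Rotations are stable under small perturbations. -/
theorem rot_stable {f : ℝ → ℂ} (hf : Continuous f) {u v : ℝ}
    (h0 : ∀ t ∈ uIcc u v, f t ≠ 0) :
    ∃ η > 0, ∀ p : ℝ → ℂ, Continuous p → (∀ t ∈ uIcc u v, ‖p t - f t‖ ≤ η) →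
      |rot p u v - rot f u v| ≤ 1 / 100 := by
  obtain ⟨m, hm, hmin⟩ := IsGate.exists_pos_le (f := fun t => ‖f t‖) (by fun_prop)
    (a := min u v) (b := max u v) (fun t ht => norm_pos_iff.2 (h0 t ht))
  refine ⟨m / 300, by positivity, fun p hp hc => ?_⟩
  refine (rot_near hp hf (η := 1 / 300) (by norm_num) h0 fun t ht => ?_).trans (by norm_num)
  linarith [hc t ht, hmin t ht]

/-- A planar path `x` meets a simple arc `ζ`, which passes the gate `ω` at the parameters
`s₁` and `s₂`; the visits of `x` to the gate take place during `N`. -/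
structure Crossing (ω : ℝ → ℂ) (a b ε : ℝ) (ζ x : ℝ → ℂ) (s₁ s₂ : ℝ) (N : Set ℝ) (T ρ : ℝ) :
    Prop where
  neg : a < 0
  pos : 0 < b
  contζ : Continuous ζ
  contx : Continuous x
  lt : s₁ + b < s₂ + a
  closed : IsClosed N
  ρpos : 0 < ρ
  ρb : 2 * ρ ≤ b
  ρa : 2 * ρ ≤ -a
  inj : InjOn ζ (Icc (s₁ + a) (s₂ + b))
  close₁ : CloseOn a b ε (fun h => ζ (s₁ + h)) ω
  close₂ : CloseOn a b ε (fun h => ζ (s₂ + h)) ω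
  disj : ∀ t, T ≤ t → ∀ s ∈ Icc (s₁ + a) (s₂ + b), x t ≠ ζ s
  closeN : ∀ t ∈ N, T ≤ t → CloseOn a b ε (fun h => x (t + h)) ω
  sep : ∀ t ∈ N, ∀ t' ∈ N, T ≤ t → T ≤ t' → t + a ≤ t' → t' ≤ t + b → |t' - t| < ρ
  off : ∀ t, T ≤ t → t ∉ N → ‖ζ s₂ - ζ s₁‖ ≤ 1 / 100 * ‖ζ s₁ - x t‖

namespace Crossing

variable {ω : ℝ → ℂ} {a b ε : ℝ} {ζ x : ℝ → ℂ} {s₁ s₂ : ℝ} {N : Set ℝ} {T ρ : ℝ}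

/-- The angle swept by `ζ` as seen from `x t`. -/
noncomputable def ang (ζ x : ℝ → ℂ) (s₁ s₂ t : ℝ) : ℝ := rot (fun s => ζ s - x t) s₁ s₂

/-- The number of full turns of `ζ` as seen from `x t`. -/
noncomputable def num (ζ x : ℝ → ℂ) (s₁ s₂ t : ℝ) : ℤ :=
  round (ang ζ x s₁ s₂ t / (2 * Real.pi))

theorem int_near_le {u v : ℝ} {m n : ℤ} (hu : |u - 2 * Real.pi * m| ≤ 3 / 200)
    (hv : |v - 2 * Real.pi * n| ≤ 3 / 200) {r : ℝ} (h : r ≤ v - u) (k : ℤ)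
    (hr : 2 * Real.pi * (k - 1) + 3 / 100 < r) : m + k ≤ n := by
  rw [abs_le] at hu hv
  have hpi := Real.pi_pos
  have h1 : 2 * Real.pi * (k - 1 : ℝ) < 2 * Real.pi * (n - m : ℝ) := by linarith [hu.1, hv.2]
  have h2 := lt_of_mul_lt_mul_left h1 (by positivity)
  have h3 : (k - 1 : ℤ) < n - m := by exact_mod_cast h2
  omega

theorem s_lt (h : Crossing ω a b ε ζ x s₁ s₂ N T ρ) : s₁ < s₂ := by linarith [h.lt, h.neg, h.pos]

theorem mem_of_mid (h : Crossing ω a b ε ζ x s₁ s₂ N T ρ) {s : ℝ} (hs : s ∈ uIcc s₁ s₂) :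
    s ∈ Icc (s₁ + a) (s₂ + b) := by
  rw [uIcc_of_le h.s_lt.le] at hs
  exact ⟨by linarith [hs.1, h.neg], by linarith [hs.2, h.pos]⟩

theorem ne_zero (h : Crossing ω a b ε ζ x s₁ s₂ N T ρ) {t : ℝ} (ht : T ≤ t) :
    ∀ s ∈ uIcc s₁ s₂, ζ s - x t ≠ 0 := fun s hs =>
  sub_ne_zero.2 (h.disj t ht s (h.mem_of_mid hs)).symm

theorem mem₁ (h : Crossing ω a b ε ζ x s₁ s₂ N T ρ) :
    s₁ ∈ Icc (s₁ + a) (s₂ + b) := h.mem_of_mid left_mem_uIcc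

theorem mem₂ (h : Crossing ω a b ε ζ x s₁ s₂ N T ρ) :
    s₂ ∈ Icc (s₁ + a) (s₂ + b) := h.mem_of_mid right_mem_uIcc

theorem ang_sub (h : Crossing ω a b ε ζ x s₁ s₂ N T ρ) {t t' : ℝ} (ht : T ≤ t) (ht' : T ≤ t') :
    ang ζ x s₁ s₂ t' - ang ζ x s₁ s₂ t =
      rot (fun τ => ζ s₂ - x τ) t t' - rot (fun τ => ζ s₁ - x τ) t t' := by
  have hζ := h.contζ
  have hx := h.contx
  have := rot_rect (f := fun τ s => ζ s - x τ) (a := t) (b := t') (c := s₁) (d := s₂)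
    (by fun_prop) (fun τ hτ s hs => h.ne_zero (by
      rw [mem_uIcc] at hτ
      rcases hτ with h | h <;> linarith [h.1]) s hs)
  simp only [ang]
  linarith

theorem near_num (h : Crossing ω a b ε ζ x s₁ s₂ N T ρ) {t : ℝ} (ht : T ≤ t) (htN : t ∉ N) :
    |ang ζ x s₁ s₂ t - 2 * Real.pi * num ζ x s₁ s₂ t| ≤ 3 / 200 := by
  have hζ := h.contζ
  obtain ⟨n, hn⟩ := rot_near_int (p := fun s => ζ s - x t) (η := 1 / 100) (by fun_prop)
    (h.ne_zero ht) (by norm_num) (by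
      rw [sub_sub_sub_cancel_right]
      exact h.off t ht htN)
  have hpi := Real.pi_gt_three
  have : num ζ x s₁ s₂ t = n := by
    rw [num, round_eq_iff]
    have h1 : ang ζ x s₁ s₂ t / (2 * Real.pi) - n =
        (ang ζ x s₁ s₂ t - 2 * Real.pi * n) / (2 * Real.pi) := by field_simp
    have h2 : |ang ζ x s₁ s₂ t / (2 * Real.pi) - n| < 1 / 2 := by
      rw [h1, abs_div, abs_of_pos (by positivity : 0 < 2 * Real.pi), div_lt_iff₀ (by positivity)]
      exact hn.trans_lt (by linarith)
    rw [abs_lt] at h2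
    constructor <;> linarith [h2.1, h2.2]
  rw [this]
  exact hn.trans (by norm_num)

theorem num_eq_of_near (h : Crossing ω a b ε ζ x s₁ s₂ N T ρ) {t t' : ℝ} (ht : T ≤ t) (htN : t ∉ N)
    (ht' : T ≤ t') (htN' : t' ∉ N)
    (hd : |ang ζ x s₁ s₂ t' - ang ζ x s₁ s₂ t| ≤ 1) : num ζ x s₁ s₂ t = num ζ x s₁ s₂ t' := by
  have h1 := h.near_num ht htN
  have h2 := h.near_num ht' htN'
  have hpi := Real.pi_gt_three
  rw [abs_le] at hd
  have e1 := int_near_le h1 h2 (r := -1) hd.1 0 (by push_cast; linarith)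
  have e2 := int_near_le h2 h1 (r := -1) (by linarith [hd.2]) 0 (by push_cast; linarith)
  omega

theorem num_eq (h : Crossing ω a b ε ζ x s₁ s₂ N T ρ) {t t' : ℝ} (ht : T ≤ t) (htt : t ≤ t')
    (hN : ∀ τ ∈ Icc t t', τ ∉ N) :
    num ζ x s₁ s₂ t = num ζ x s₁ s₂ t' := by
  have hx := h.contx
  apply h.num_eq_of_near ht (hN t ⟨le_rfl, htt⟩) (ht.trans htt) (hN t' ⟨htt, le_rfl⟩)
  rw [h.ang_sub ht (ht.trans htt)]
  refine (rot_near (η := 1 / 100) (by fun_prop) (by fun_prop) (by norm_num) ?_ ?_).trans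
    (by norm_num)
  · intro τ hτ
    rw [uIcc_of_le htt] at hτ
    exact sub_ne_zero.2 (h.disj τ (ht.trans hτ.1) s₁ h.mem₁).symm
  · intro τ hτ
    rw [uIcc_of_le htt] at hτ
    rw [sub_sub_sub_cancel_right]
    exact h.off τ (ht.trans hτ.1) (hN τ hτ)

theorem add_b_notMem (h : Crossing ω a b ε ζ x s₁ s₂ N T ρ) {t : ℝ} (ht : t ∈ N) (hT : T ≤ t) :
    t + b ∉ N := fun hb => by
  have := h.sep t ht _ hb hT (by linarith [h.pos]) (by linarith [h.neg, h.pos]) le_rfl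
  rw [add_sub_cancel_left, abs_of_pos h.pos] at this
  linarith [h.ρb, h.ρpos]

theorem add_a_notMem (h : Crossing ω a b ε ζ x s₁ s₂ N T ρ) {t : ℝ} (ht : t ∈ N) (hT : T ≤ t + a) :
    t + a ∉ N := fun ha => by
  have := h.sep t ht _ ha (by linarith [h.neg]) hT le_rfl (by linarith [h.neg, h.pos])
  rw [add_sub_cancel_left, abs_of_neg h.neg] at this
  linarith [h.ρa, h.ρpos]

/-- If all jumps are nonnegative then so is the accumulated change. -/
theorem mono_num (h : Crossing ω a b ε ζ x s₁ s₂ N T ρ) {σ : ℤ}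
    (hjump : ∀ t ∈ N, T ≤ t + a → σ * num ζ x s₁ s₂ (t + a) ≤ σ * num ζ x s₁ s₂ (t + b)) (n : ℕ) :
    ∀ t ∈ N, T ≤ t + a → ∀ t' ∈ N, t + ρ ≤ t' → t' ≤ t + n * b →
      σ * num ζ x s₁ s₂ (t + b) ≤ σ * num ζ x s₁ s₂ (t' + a) := by
  have hb := h.pos
  have ha := h.neg
  have hρ := h.ρpos
  have hρb := h.ρb
  have hρa := h.ρa
  induction n with
  | zero =>
    intro t _ _ t' _ h1 h2
    simp at h2
    linarith
  | succ n ih =>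
    intro t ht hT t' ht' h1 h2
    push_cast at h2
    have htb : t + b < t' := by
      by_contra hcon
      push Not at hcon
      have := h.sep t ht t' ht' (by linarith) (by linarith) (by linarith) hcon
      rw [abs_of_nonneg (by linarith)] at this
      linarith
    -- the next visit
    have hcl : IsCompact (N ∩ Icc (t + b) t') := isCompact_Icc.inter_left h.closed
    obtain ⟨u, ⟨huN, hu1, hu2⟩, hmin⟩ := hcl.exists_isLeast ⟨t', ht', htb.le, le_rfl⟩
    have hu1' : t + b < u := lt_of_le_of_ne hu1 (by
      rintro rfl
      exact h.add_b_notMem ht (by linarith) huN)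
    have hoff : ∀ v ∈ N, t + b ≤ v → u ≤ v := fun v hv hv1 => by
      rcases le_total v t' with h3 | h3
      · exact hmin ⟨hv, hv1, h3⟩
      · exact hu2.trans h3
    have step : num ζ x s₁ s₂ (t + b) = num ζ x s₁ s₂ (u + a) := by
      rcases le_total (t + b) (u + a) with h3 | h3
      · exact h.num_eq (by linarith) h3 fun v hv hvN => by
          linarith [hoff v hvN hv.1, hv.2]
      · refine (h.num_eq (by linarith) h3 fun v hv hvN => ?_).symm
        have e1 := h.sep u huN v hvN (by linarith) (by linarith [hv.1]) hv.1 (by linarith [hv.2])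
        have e2 := h.sep t ht v hvN (by linarith) (by linarith [hv.1]) (by linarith [hv.1]) hv.2
        rw [abs_lt] at e1 e2
        linarith [e1.1, e2.2]
    rcases lt_or_ge t' (u + ρ) with h3 | h3
    · have : num ζ x s₁ s₂ (u + a) = num ζ x s₁ s₂ (t' + a) :=
        h.num_eq (by linarith) (by linarith) fun v hv hvN => by
          have e1 := h.sep u huN v hvN (by linarith) (by linarith [hv.1]) hv.1
            (by linarith [hv.2])
          rw [abs_lt] at e1
          linarith [e1.1, hv.2]
      rw [step, this]
    · rw [step]
      exact (hjump u huN (by linarith)).trans (ih u huN (by linarith) t' ht' h3 (by linarith))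

theorem jump_eq (h : Crossing ω a b ε ζ x s₁ s₂ N T ρ) {t : ℝ} (hT : T ≤ t + a) :
    ang ζ x s₁ s₂ (t + b) - ang ζ x s₁ s₂ (t + a) =
      rot (fun τ => ζ s₂ - x (t + τ)) a b - rot (fun τ => ζ s₁ - x (t + τ)) a b := by
  have hx := h.contx
  have hab : a ≤ b := h.neg.le.trans h.pos.le
  rw [h.ang_sub hT (by linarith),
    rot_comp_add (p := fun τ => ζ s₂ - x τ) (by fun_prop) t ?_,
    rot_comp_add (p := fun τ => ζ s₁ - x τ) (by fun_prop) t ?_]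
  all_goals
    intro τ hτ
    rw [uIcc_of_le (by linarith)] at hτ
  · exact sub_ne_zero.2 (h.disj τ (hT.trans hτ.1) s₁ h.mem₁).symm
  · exact sub_ne_zero.2 (h.disj τ (hT.trans hτ.1) s₂ h.mem₂).symm

theorem disj₁ (h : Crossing ω a b ε ζ x s₁ s₂ N T ρ) {t : ℝ} (hT : T ≤ t + a) :
    ArcsDisjoint a b (fun τ => x (t + τ)) (fun τ => ζ (s₁ + τ)) := fun τ hτ τ' hτ' =>
  h.disj _ (by linarith [hτ.1]) _ ⟨by linarith [hτ'.1], by linarith [hτ'.2, h.s_lt]⟩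

theorem disj₂ (h : Crossing ω a b ε ζ x s₁ s₂ N T ρ) {t : ℝ} (hT : T ≤ t + a) :
    ArcsDisjoint a b (fun τ => x (t + τ)) (fun τ => ζ (s₂ + τ)) := fun τ hτ τ' hτ' =>
  h.disj _ (by linarith [hτ.1]) _ ⟨by linarith [hτ'.1, h.s_lt], by linarith [hτ'.2]⟩

theorem disj₁₂ (h : Crossing ω a b ε ζ x s₁ s₂ N T ρ) :
    ArcsDisjoint a b (fun τ => ζ (s₁ + τ)) (fun τ => ζ (s₂ + τ)) :=
  fun τ hτ τ' hτ' he => by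
    have := h.inj ⟨by linarith [hτ.1], by linarith [hτ.2, h.s_lt]⟩
      ⟨by linarith [hτ'.1, h.s_lt], by linarith [hτ'.2]⟩ he
    linarith [h.lt, hτ.2, hτ'.1]

theorem parallel_shift (h : Crossing ω a b ε ζ x s₁ s₂ N T ρ) {B₁ B₂ : ℝ}
    (ht : ∀ s ∈ ({s₁, s₂} : Set ℝ),
      |rot (fun τ => ζ (s + b) - ζ (s + τ)) a 0 - B₁| ≤ 1 / 100 ∧
      |rot (fun σ => ζ (s + σ) - ζ (s + a)) 0 b - B₂| ≤ 1 / 100) :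
    |rot (fun s => ζ s - ζ (s + b)) s₁ s₂ - rot (fun s => ζ s - ζ (s + a)) s₁ s₂| ≤ 4 / 100 := by
  have hζ := h.contζ
  have ha := h.neg
  have hb := h.pos
  have hne : ∀ s ∈ uIcc s₁ s₂, ∀ u ∈ Icc a b, ∀ v ∈ Icc a b, u ≠ v → ζ (s + u) - ζ (s + v) ≠ 0 := by
    intro s hs u hu v hv huv
    rw [uIcc_of_le h.s_lt.le] at hs
    refine sub_ne_zero.2 fun he => huv ?_
    have := h.inj ⟨by linarith [hs.1, hu.1], by linarith [hs.2, hu.2]⟩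
      ⟨by linarith [hs.1, hv.1], by linarith [hs.2, hv.2]⟩ he
    linarith
  have am : a ∈ Icc a b := ⟨le_rfl, by linarith⟩
  have bm : b ∈ Icc a b := ⟨by linarith, le_rfl⟩
  have r1 := rot_rect (f := fun s σ => ζ (s + σ) - ζ (s + a)) (a := s₁) (b := s₂) (c := 0)
    (d := b) (by fun_prop) (by
      intro s hs σ hσ
      rw [uIcc_of_le hb.le] at hσ
      exact hne s hs σ ⟨by linarith [hσ.1], hσ.2⟩ a am (by linarith [hσ.1]))
  have r2 := rot_rect (f := fun s σ => ζ (s + b) - ζ (s + σ)) (a := s₁) (b := s₂) (c := a)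
    (d := 0) (by fun_prop) (by
      intro s hs σ hσ
      rw [uIcc_of_le ha.le] at hσ
      exact hne s hs b bm σ ⟨hσ.1, by linarith [hσ.2]⟩ (by linarith [hσ.2]))
  simp only [add_zero] at r1 r2
  have r3 := rot_sub_comm (p := fun s => ζ s) (q := fun s => ζ (s + b)) (a := s₁) (b := s₂)
    (by fun_prop) (by fun_prop) (by
      intro s hs
      have := hne s hs 0 ⟨ha.le, hb.le⟩ b bm hb.ne
      rw [add_zero] at this
      exact sub_ne_zero.1 this)
  obtain ⟨k1, k2⟩ := ht s₁ (by simp)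
  obtain ⟨k3, k4⟩ := ht s₂ (by simp)
  rw [r3]
  rw [abs_le] at *
  constructor <;> linarith [k1.1, k1.2, k2.1, k2.2, k3.1, k3.2, k4.1, k4.2]

theorem total_jump (h : Crossing ω a b ε ζ x s₁ s₂ N T ρ) {B₁ B₂ : ℝ}
    (ht : ∀ s ∈ ({s₁, s₂} : Set ℝ),
      |rot (fun τ => ζ (s + b) - ζ (s + τ)) a 0 - B₁| ≤ 1 / 100 ∧
      |rot (fun σ => ζ (s + σ) - ζ (s + a)) 0 b - B₂| ≤ 1 / 100) :
    ∃ η > 0, ∀ d, T ≤ d + s₁ + a → (∀ s ∈ Icc (s₁ + a) (s₂ + b), ‖x (d + s) - ζ s‖ ≤ η) →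
      |(ang ζ x s₁ s₂ (d + s₁ + b) - ang ζ x s₁ s₂ (d + s₁ + a)) +
        (ang ζ x s₁ s₂ (d + s₂ + b) - ang ζ x s₁ s₂ (d + s₂ + a)) -
        (rot (fun τ => ζ s₂ - ζ (s₁ + τ)) a b - rot (fun τ => ζ s₁ - ζ (s₂ + τ)) a b)| ≤
        1 / 10 := by
  have hζ := h.contζ
  have hx := h.contx
  have ha := h.neg
  have hb := h.pos
  have hlt := h.lt
  have hab : a ≤ b := by linarith
  have hs12 := h.s_lt
  have hne : ∀ u ∈ Icc (s₁ + a) (s₂ + b), ∀ v ∈ Icc (s₁ + a) (s₂ + b), u ≠ v → ζ u - ζ v ≠ 0 :=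
    fun u hu v hv huv => sub_ne_zero.2 fun he => huv (h.inj hu hv he)
  obtain ⟨η1, hη1, e1⟩ := rot_stable (f := fun τ => ζ s₂ - ζ (s₁ + τ)) (u := a) (v := b)
    (by fun_prop) (by
      intro τ hτ
      rw [uIcc_of_le hab] at hτ
      exact hne _ h.mem₂ _ ⟨by linarith [hτ.1], by linarith [hτ.2]⟩ (by linarith [hτ.2]))
  obtain ⟨η2, hη2, e2⟩ := rot_stable (f := fun τ => ζ s₁ - ζ (s₂ + τ)) (u := a) (v := b)
    (by fun_prop) (by
      intro τ hτ
      rw [uIcc_of_le hab] at hτ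
      exact hne _ h.mem₁ _ ⟨by linarith [hτ.1], by linarith [hτ.2]⟩ (by linarith [hτ.1]))
  obtain ⟨η3, hη3, e3⟩ := rot_stable (f := fun s => ζ s - ζ (s + b)) (u := s₁) (v := s₂)
    (by fun_prop) (by
      intro s hs
      refine hne _ (h.mem_of_mid hs) _ ?_ (by linarith)
      rw [uIcc_of_le hs12.le] at hs
      exact ⟨by linarith [hs.1], by linarith [hs.2]⟩)
  obtain ⟨η4, hη4, e4⟩ := rot_stable (f := fun s => ζ s - ζ (s + a)) (u := s₁) (v := s₂)
    (by fun_prop) (by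
      intro s hs
      refine hne _ (h.mem_of_mid hs) _ ?_ (by linarith)
      rw [uIcc_of_le hs12.le] at hs
      exact ⟨by linarith [hs.1], by linarith [hs.2]⟩)
  refine ⟨min (min η1 η2) (min η3 η4), by positivity, fun d hd htr => ?_⟩
  have htr1 : ∀ s ∈ Icc (s₁ + a) (s₂ + b), ‖x (d + s) - ζ s‖ ≤ η1 := fun s hs =>
    (htr s hs).trans ((min_le_left _ _).trans (min_le_left _ _))
  have htr2 : ∀ s ∈ Icc (s₁ + a) (s₂ + b), ‖x (d + s) - ζ s‖ ≤ η2 := fun s hs =>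
    (htr s hs).trans ((min_le_left _ _).trans (min_le_right _ _))
  have htr3 : ∀ s ∈ Icc (s₁ + a) (s₂ + b), ‖x (d + s) - ζ s‖ ≤ η3 := fun s hs =>
    (htr s hs).trans ((min_le_right _ _).trans (min_le_left _ _))
  have htr4 : ∀ s ∈ Icc (s₁ + a) (s₂ + b), ‖x (d + s) - ζ s‖ ≤ η4 := fun s hs =>
    (htr s hs).trans ((min_le_right _ _).trans (min_le_right _ _))
  have q1 := e1 (fun τ => ζ s₂ - x (d + s₁ + τ)) (by fun_prop) (by
    intro τ hτ
    rw [uIcc_of_le hab] at hτ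
    rw [sub_sub_sub_cancel_left, norm_sub_rev, add_assoc]
    exact htr1 _ ⟨by linarith [hτ.1], by linarith [hτ.2]⟩)
  have q2 := e2 (fun τ => ζ s₁ - x (d + s₂ + τ)) (by fun_prop) (by
    intro τ hτ
    rw [uIcc_of_le hab] at hτ
    rw [sub_sub_sub_cancel_left, norm_sub_rev, add_assoc]
    exact htr2 _ ⟨by linarith [hτ.1], by linarith [hτ.2]⟩)
  have q3 := e3 (fun s => ζ s - x (d + s + b)) (by fun_prop) (by
    intro s hs
    rw [uIcc_of_le hs12.le] at hs
    rw [sub_sub_sub_cancel_left, norm_sub_rev, add_assoc]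
    exact htr3 _ ⟨by linarith [hs.1], by linarith [hs.2]⟩)
  have q4 := e4 (fun s => ζ s - x (d + s + a)) (by fun_prop) (by
    intro s hs
    rw [uIcc_of_le hs12.le] at hs
    rw [sub_sub_sub_cancel_left, norm_sub_rev, add_assoc]
    exact htr4 _ ⟨by linarith [hs.1], by linarith [hs.2]⟩)
  have q5 := h.parallel_shift ht
  have r := rot_rect (f := fun s τ => ζ s - x (d + s + τ)) (a := s₁) (b := s₂) (c := a) (d := b)
    (by fun_prop) (by
      intro s hs τ hτ
      have hs' := h.mem_of_mid hs
      rw [uIcc_of_le hs12.le] at hs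
      rw [uIcc_of_le hab] at hτ
      exact sub_ne_zero.2 (h.disj _ (by linarith [hs.1, hτ.1]) s hs').symm)
  rw [h.jump_eq (by linarith), h.jump_eq (by linarith)]
  rw [abs_le] at *
  constructor <;> linarith [q1.1, q1.2, q2.1, q2.2, q3.1, q3.2, q4.1, q4.2, q5.1, q5.2]

theorem ang_start (h : Crossing ω a b ε ζ x s₁ s₂ N T ρ) :
    ∃ A, ∃ η > 0, ∀ d, (∀ s ∈ Icc (s₁ + a) (s₂ + b), ‖x (d + s) - ζ s‖ ≤ η) →
      |ang ζ x s₁ s₂ (d + s₁ + a) - A| ≤ 1 / 100 := by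
  have hζ := h.contζ
  have ha := h.neg
  have hmem : s₁ + a ∈ Icc (s₁ + a) (s₂ + b) := ⟨le_rfl, by linarith [h.pos, h.s_lt]⟩
  obtain ⟨η, hη, e⟩ := rot_stable (f := fun s => ζ s - ζ (s₁ + a)) (u := s₁) (v := s₂)
    (by fun_prop) (by
      intro s hs
      refine sub_ne_zero.2 fun he => ?_
      have := h.inj (h.mem_of_mid hs) hmem he
      rw [uIcc_of_le h.s_lt.le] at hs
      linarith [hs.1])
  refine ⟨_, η, hη, fun d htr => e _ (by fun_prop) fun s hs => ?_⟩
  rw [sub_sub_sub_cancel_left, norm_sub_rev, add_assoc]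
  exact htr _ hmem

end Crossing

open Crossing in
/-- A path cannot shadow, at arbitrarily late times, an arc which it never meets and which passes
the gate twice. -/
theorem IsGate.no_crossing {ω : ℝ → ℂ} {a b : ℝ} {c : ℂ} (g : IsGate ω a b c) :
    ∃ ε > 0, ∀ (ζ x : ℝ → ℂ) (s₁ s₂ : ℝ) (N : Set ℝ) (T ρ : ℝ),
      Crossing ω a b ε ζ x s₁ s₂ N T ρ →
      (∀ η > 0, ∀ D, ∃ d ≥ D, d + s₁ ∈ N ∧ d + s₂ ∈ N ∧
        ∀ s ∈ Icc (s₁ + a) (s₂ + b), ‖x (d + s) - ζ s‖ ≤ η) → False := by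
  obtain ⟨κ₀, κ₁, hκ, hgate⟩ := g.exists_consts
  obtain ⟨ε1, hε1, hg1⟩ := hgate (1 / 100) (by norm_num)
  obtain ⟨ε2, hε2, hg2⟩ := g.turn_near (η := 1 / 100) (by norm_num)
  refine ⟨min ε1 ε2, by positivity, fun ζ x s₁ s₂ N T ρ h htrack => ?_⟩
  have hζ := h.contζ
  have hx := h.contx
  have ha := g.neg
  have hb := g.pos
  have c1 := h.close₁.mono (min_le_left ε1 ε2)
  have c2 := h.close₂.mono (min_le_left ε1 ε2)
  have ht : ∀ s ∈ ({s₁, s₂} : Set ℝ),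
      |rot (fun τ => ζ (s + b) - ζ (s + τ)) a 0 - rot (fun τ => ω b - ω τ) a 0| ≤ 1 / 100 ∧
      |rot (fun σ => ζ (s + σ) - ζ (s + a)) 0 b - rot (fun σ => ω σ - ω a) 0 b| ≤ 1 / 100 := by
    intro s hs
    rcases hs with rfl | rfl
    · exact hg2 _ _ (by fun_prop) (by fun_prop) (h.close₁.mono (min_le_right ε1 ε2))
        (h.close₁.mono (min_le_right ε1 ε2))
    · exact hg2 _ _ (by fun_prop) (by fun_prop) (h.close₂.mono (min_le_right ε1 ε2))
        (h.close₂.mono (min_le_right ε1 ε2))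
  obtain ⟨η1, hη1, htot⟩ := h.total_jump ht
  obtain ⟨A, η2, hη2, hang⟩ := h.ang_start
  set α₁ : ℝ → ℂ := fun τ => ζ (s₁ + τ) with hα₁
  set α₂ : ℝ → ℂ := fun τ => ζ (s₂ + τ) with hα₂
  -- the sign of the jumps
  obtain ⟨σ, hσ, hjump, hfull⟩ : ∃ σ : ℤ, (σ = 1 ∨ σ = -1) ∧
      (∀ t ∈ N, T ≤ t + a → -(1 / 25) ≤
        σ * (ang ζ x s₁ s₂ (t + b) - ang ζ x s₁ s₂ (t + a))) ∧
      5 ≤ σ * (rot (fun τ => ζ s₂ - ζ (s₁ + τ)) a b - rot (fun τ => ζ s₁ - ζ (s₂ + τ)) a b) := by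
    have k12 := hg1 α₁ α₂ (by fun_prop) (by fun_prop) c1 c2 h.disj₁₂
    have k21 := hg1 α₂ α₁ (by fun_prop) (by fun_prop) c2 c1 h.disj₁₂.symm
    simp only [hα₁, hα₂, add_zero] at k12 k21
    have kt : ∀ t ∈ N, T ≤ t + a →
        ((height a b c α₁ ≤ height a b c (fun τ => x (t + τ)) →
          |rot (fun τ => ζ s₁ - x (t + τ)) a b - κ₀| ≤ 1 / 100) ∧
        (height a b c (fun τ => x (t + τ)) ≤ height a b c α₁ →
          |rot (fun τ => ζ s₁ - x (t + τ)) a b - κ₁| ≤ 1 / 100)) ∧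
        ((height a b c α₂ ≤ height a b c (fun τ => x (t + τ)) →
          |rot (fun τ => ζ s₂ - x (t + τ)) a b - κ₀| ≤ 1 / 100) ∧
        (height a b c (fun τ => x (t + τ)) ≤ height a b c α₂ →
          |rot (fun τ => ζ s₂ - x (t + τ)) a b - κ₁| ≤ 1 / 100)) := by
      intro t htN htT
      have cx := (h.closeN t htN (by linarith)).mono (min_le_left ε1 ε2)
      have k1 := hg1 (fun τ => x (t + τ)) α₁ (by fun_prop) (by fun_prop) cx c1 (h.disj₁ htT)
      have k2 := hg1 (fun τ => x (t + τ)) α₂ (by fun_prop) (by fun_prop) cx c2 (h.disj₂ htT)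
      simp only [hα₁, hα₂, add_zero] at k1 k2
      exact ⟨k1, k2⟩
    have main : ∀ q : ℝ, (∃ κ κ' : ℝ, q = κ - κ' ∧
        |rot (fun τ => ζ s₂ - ζ (s₁ + τ)) a b - κ| ≤ 1 / 100 ∧
        |rot (fun τ => ζ s₁ - ζ (s₂ + τ)) a b - κ'| ≤ 1 / 100) →
        (∀ t ∈ N, T ≤ t + a → ∃ κ κ' : ℝ, (κ - κ' = q ∨ κ - κ' = 0) ∧
          |rot (fun τ => ζ s₂ - x (t + τ)) a b - κ| ≤ 1 / 100 ∧
          |rot (fun τ => ζ s₁ - x (t + τ)) a b - κ'| ≤ 1 / 100) → 6 ≤ |q| →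
        ∃ σ : ℤ, (σ = 1 ∨ σ = -1) ∧
        (∀ t ∈ N, T ≤ t + a → -(1 / 25) ≤
          σ * (ang ζ x s₁ s₂ (t + b) - ang ζ x s₁ s₂ (t + a))) ∧
        5 ≤ σ * (rot (fun τ => ζ s₂ - ζ (s₁ + τ)) a b -
          rot (fun τ => ζ s₁ - ζ (s₂ + τ)) a b) := by
      rintro q ⟨κ, κ', hq, h1, h2⟩ hall h6
      rw [abs_le] at h1 h2
      rcases le_abs.1 h6 with h6 | h6
      · refine ⟨1, Or.inl rfl, fun t htN htT => ?_, ?_⟩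
        · obtain ⟨k, k', hk, m1, m2⟩ := hall t htN htT
          rw [h.jump_eq htT]
          rw [abs_le] at m1 m2
          push_cast
          rcases hk with hk | hk <;> linarith [m1.1, m2.2]
        · push_cast
          linarith [h1.1, h2.2]
      · refine ⟨-1, Or.inr rfl, fun t htN htT => ?_, ?_⟩
        · obtain ⟨k, k', hk, m1, m2⟩ := hall t htN htT
          rw [h.jump_eq htT]
          rw [abs_le] at m1 m2
          push_cast
          rcases hk with hk | hk <;> linarith [m1.2, m2.1]
        · push_cast
          linarith [h1.2, h2.1]
    rcases le_total (height a b c α₂) (height a b c α₁) with hle | hle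
    · refine main (κ₀ - κ₁) ⟨κ₀, κ₁, rfl, k12.1 hle, k21.2 hle⟩ (fun t htN htT => ?_) hκ
      obtain ⟨⟨a1, a2⟩, b1, b2⟩ := kt t htN htT
      rcases le_total (height a b c α₁) (height a b c (fun τ => x (t + τ))) with h1 | h1
      · exact ⟨κ₀, κ₀, Or.inr (sub_self _), b1 (hle.trans h1), a1 h1⟩
      · rcases le_total (height a b c α₂) (height a b c (fun τ => x (t + τ))) with h2 | h2
        · exact ⟨κ₀, κ₁, Or.inl rfl, b1 h2, a2 h1⟩
        · exact ⟨κ₁, κ₁, Or.inr (sub_self _), b2 h2, a2 h1⟩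
    · refine main (κ₁ - κ₀) ⟨κ₁, κ₀, rfl, k12.2 hle, k21.1 hle⟩ (fun t htN htT => ?_)
        (by rwa [abs_sub_comm])
      obtain ⟨⟨a1, a2⟩, b1, b2⟩ := kt t htN htT
      rcases le_total (height a b c α₂) (height a b c (fun τ => x (t + τ))) with h1 | h1
      · exact ⟨κ₀, κ₀, Or.inr (sub_self _), b1 h1, a1 (hle.trans h1)⟩
      · rcases le_total (height a b c α₁) (height a b c (fun τ => x (t + τ))) with h2 | h2
        · exact ⟨κ₁, κ₀, Or.inl rfl, b2 h1, a1 h2⟩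
        · exact ⟨κ₁, κ₁, Or.inr (sub_self _), b2 h1, a2 h2⟩
  have hσr : ∀ {u v : ℝ} {m n : ℤ} (r : ℝ) (k : ℤ), |u - 2 * Real.pi * m| ≤ 3 / 200 →
      |v - 2 * Real.pi * n| ≤ 3 / 200 → r ≤ σ * (v - u) →
      2 * Real.pi * (k - 1) + 3 / 100 < r → σ * m + k ≤ σ * n := by
    intro u v m n r k hu hv hr hk
    rcases hσ with rfl | rfl
    · have := int_near_le hu hv (r := r) (by push_cast at hr; linarith) k hk
      linarith
    · have := int_near_le hv hu (r := r) (by push_cast at hr; linarith) k hk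
      linarith
  have hpi := Real.pi_gt_three
  have hpi4 := Real.pi_lt_four
  have hjumpZ : ∀ t ∈ N, T ≤ t + a →
      σ * num ζ x s₁ s₂ (t + a) ≤ σ * num ζ x s₁ s₂ (t + b) := by
    intro t htN htT
    have := hσr _ 0 (h.near_num htT (h.add_a_notMem htN htT))
      (h.near_num (by linarith) (h.add_b_notMem htN (by linarith))) (hjump t htN htT)
      (by push_cast; linarith)
    linarith
  have hmono : ∀ t ∈ N, T ≤ t + a → ∀ t' ∈ N, t + ρ ≤ t' →
      σ * num ζ x s₁ s₂ (t + b) ≤ σ * num ζ x s₁ s₂ (t' + a) := by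
    intro t htN htT t' htN' htt
    obtain ⟨n, hn⟩ := exists_nat_ge ((t' - t) / b)
    exact h.mono_num hjumpZ n t htN htT t' htN' htt (by
      rw [div_le_iff₀ hb] at hn; linarith)
  obtain ⟨d, hdT, hd1, hd2, hd⟩ := htrack (min η1 η2) (by positivity) (T - s₁ - a)
  have hlt := h.lt
  have hρb := h.ρb
  have hρ := h.ρpos
  obtain ⟨d', hdT', hd1', -, hd'⟩ := htrack (min η1 η2) (by positivity) (d + s₂ + ρ - s₁)
  have j := htot d (by linarith) (fun s hs => (hd s hs).trans (min_le_left _ _))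
  have f1 := hang d (fun s hs => (hd s hs).trans (min_le_right _ _))
  have f2 := hang d' (fun s hs => (hd' s hs).trans (min_le_right _ _))
  have n1a := h.near_num (t := d + s₁ + a) (by linarith) (h.add_a_notMem hd1 (by linarith))
  have n1b := h.near_num (t := d + s₁ + b) (by linarith) (h.add_b_notMem hd1 (by linarith))
  have n2a := h.near_num (t := d + s₂ + a) (by linarith) (h.add_a_notMem hd2 (by linarith))
  have n2b := h.near_num (t := d + s₂ + b) (by linarith) (h.add_b_notMem hd2 (by linarith))
  have m1 := hmono _ hd1 (by linarith) _ hd2 (by linarith)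
  have m2 := hmono _ hd2 (by linarith) _ hd1' (by linarith)
  have m3 : num ζ x s₁ s₂ (d + s₁ + a) = num ζ x s₁ s₂ (d' + s₁ + a) := by
    apply h.num_eq_of_near (by linarith) (h.add_a_notMem hd1 (by linarith)) (by linarith)
      (h.add_a_notMem hd1' (by linarith))
    rw [abs_le] at *
    constructor <;> linarith [f1.1, f1.2, f2.1, f2.2]
  have j1 := hjumpZ _ hd1 (by linarith)
  have j2 := hjumpZ _ hd2 (by linarith)
  have hsum : (49 / 10 : ℝ) ≤ σ * ((ang ζ x s₁ s₂ (d + s₁ + b) - ang ζ x s₁ s₂ (d + s₁ + a)) +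
        (ang ζ x s₁ s₂ (d + s₂ + b) - ang ζ x s₁ s₂ (d + s₂ + a))) := by
    rw [abs_le] at j
    rcases hσ with rfl | rfl
    · push_cast at hfull ⊢
      linarith [j.1]
    · push_cast at hfull ⊢
      linarith [j.2]
  -- one of the two jumps is a full turn
  rcases le_total (49 / 20 : ℝ)
      (σ * (ang ζ x s₁ s₂ (d + s₁ + b) - ang ζ x s₁ s₂ (d + s₁ + a))) with hc | hc
  · have := hσr _ 1 n1a n1b hc (by push_cast; linarith)
    rw [m3] at this
    linarith
  · have := hσr (49 / 20) 1 n2a n2b (by linarith) (by push_cast; linarith)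
    rw [m3] at j1
    linarith

end Plane

open Topology

section Flow

variable {X : Type*} [NormedAddCommGroup X]

/-- `χ` is a flow on the compact set `K`. -/
structure CompactFlow (K : Set X) (χ : ℝ → X → X) : Prop where
  compact : IsCompact K
  maps : ∀ t, ∀ z ∈ K, χ t z ∈ K
  zero : ∀ z ∈ K, χ 0 z = z
  add : ∀ s t, ∀ z ∈ K, χ s (χ t z) = χ (s + t) z
  cont : ContinuousOn (fun p : ℝ × X => χ p.1 p.2) (univ ×ˢ K)

namespace CompactFlow

variable {K : Set X} {χ : ℝ → X → X}

theorem continuous_orbit (F : CompactFlow K χ) {z : X} (hz : z ∈ K) :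
    Continuous fun t => χ t z := by
  rw [← continuousOn_univ]
  exact F.cont.comp (f := fun t : ℝ => (t, z)) (by fun_prop) fun t _ => ⟨mem_univ _, hz⟩

theorem continuousOn_map (F : CompactFlow K χ) (t : ℝ) : ContinuousOn (χ t) K :=
  F.cont.comp (f := fun z : X => (t, z)) (by fun_prop) fun _ hz => ⟨mem_univ _, hz⟩

theorem reverse (F : CompactFlow K χ) : CompactFlow K (fun t => χ (-t)) where
  compact := F.compact
  maps t := F.maps _
  zero z hz := by rw [neg_zero]; exact F.zero z hz
  add s t z hz := by rw [F.add _ _ z hz, neg_add]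
  cont := F.cont.comp (f := fun p : ℝ × X => (-p.1, p.2)) (by fun_prop)
    fun p hp => ⟨mem_univ _, hp.2⟩

theorem uniform (F : CompactFlow K χ) (L : ℝ) {ε : ℝ} (hε : 0 < ε) :
    ∃ δ > 0, ∀ y ∈ K, ∀ y' ∈ K, ‖y - y'‖ < δ → ∀ h, |h| ≤ L → ‖χ h y - χ h y'‖ < ε := by
  have huc : UniformContinuousOn (fun p : ℝ × X => χ p.1 p.2) (Icc (-L) L ×ˢ K) :=
    (isCompact_Icc.prod F.compact).uniformContinuousOn_of_continuous
      (F.cont.mono (prod_mono (subset_univ _) le_rfl))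
  obtain ⟨δ, hδ, hu⟩ := Metric.uniformContinuousOn_iff.1 huc ε hε
  refine ⟨δ, hδ, fun y hy y' hy' hd h hh => ?_⟩
  rw [← dist_eq_norm]
  refine hu (h, y) ⟨abs_le.1 hh, hy⟩ (h, y') ⟨abs_le.1 hh, hy'⟩ ?_
  rw [Prod.dist_eq, dist_self, max_lt_iff, dist_eq_norm]
  exact ⟨hδ, hd⟩

theorem eq_iff (F : CompactFlow K χ) {z : X} (hz : z ∈ K) {s t : ℝ} :
    χ s z = χ t z ↔ χ (s - t) z = z := by
  constructor
  · intro h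
    rw [show s - t = -t + s by ring, ← F.add _ _ z hz, h, F.add _ _ z hz, neg_add_cancel,
      F.zero z hz]
  · intro h
    rw [show s = t + (s - t) by ring, ← F.add _ _ z hz, h]

/-- The group of periods of `z`. -/
def periods (F : CompactFlow K χ) {z : X} (hz : z ∈ K) : AddSubgroup ℝ where
  carrier := {r | χ r z = z}
  zero_mem' := F.zero z hz
  add_mem' := fun {a b} ha hb => by
    show χ (a + b) z = z
    rw [← F.add _ _ z hz, show χ b z = z from hb, show χ a z = z from ha]
  neg_mem' := fun {a} ha => by
    show χ (-a) z = z
    nth_rewrite 1 [← show χ a z = z from ha]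
    rw [F.add _ _ z hz, neg_add_cancel, F.zero z hz]

theorem mem_periods (F : CompactFlow K χ) {z : X} (hz : z ∈ K) {r : ℝ} :
    r ∈ F.periods hz ↔ χ r z = z := Iff.rfl

theorem isClosed_periods (F : CompactFlow K χ) {z : X} (hz : z ∈ K) :
    IsClosed (F.periods hz : Set ℝ) := isClosed_eq (F.continuous_orbit hz) continuous_const

theorem exists_no_small_period (F : CompactFlow K χ) {z : X} (hz : z ∈ K) (hne : ∃ r, χ r z ≠ z) :
    ∃ T > 0, ∀ r, 0 < |r| → |r| < T → χ r z ≠ z := by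
  by_contra! h
  have hd : Dense (F.periods hz : Set ℝ) := by
    refine AddSubgroup.dense_of_not_isolated_zero _ fun ε hε => ?_
    obtain ⟨r, hr0, hrε, hr⟩ := h ε hε
    rcases abs_choice r with h' | h'
    · exact ⟨r, hr, h' ▸ hr0, h' ▸ hrε⟩
    · exact ⟨-r, (F.periods hz).neg_mem hr, h' ▸ hr0, h' ▸ hrε⟩
  obtain ⟨r, hr⟩ := hne
  have := (F.isClosed_periods hz).closure_eq ▸ hd.closure_eq
  exact hr (this.symm.subset (mem_univ r))

theorem exists_minimal_period (F : CompactFlow K χ) {z : X} (hz : z ∈ K) (hne : ∃ r, χ r z ≠ z)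
    {T : ℝ} (hT : 0 < T) (hper : χ T z = z) :
    ∃ T > 0, χ T z = z ∧ ∀ r, 0 < r → r < T → χ r z ≠ z := by
  obtain ⟨T₀, hT₀, hno⟩ := F.exists_no_small_period hz hne
  have hno' : ∀ r, 0 < r → χ r z = z → T₀ ≤ r := fun r hr h => by
    by_contra! hlt
    exact hno r (by rwa [abs_of_pos hr]) (by rwa [abs_of_pos hr]) h
  set B := (F.periods hz : Set ℝ) ∩ Ici T₀
  have hbdd : BddBelow B := ⟨T₀, fun r hr => hr.2⟩
  have hmem := ((F.isClosed_periods hz).inter isClosed_Ici).csInf_mem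
    (s := B) ⟨T, hper, hno' T hT hper⟩ hbdd
  refine ⟨sInf B, hT₀.trans_le hmem.2, hmem.1, fun r hr hlt h => ?_⟩
  exact absurd (csInf_le hbdd ⟨h, hno' r hr h⟩) (not_le.2 hlt)

theorem map_periodic (F : CompactFlow K χ) {z : X} (hz : z ∈ K) {T : ℝ} (hper : χ T z = z) :
    Function.Periodic (fun t => χ t z) T := fun t => by
  show χ (t + T) z = χ t z
  rw [← F.add _ _ z hz, hper]

end CompactFlow

/-- `ξ` is a path which asymptotically follows the flow `χ` on `K` and accumulates on `K'`. -/
structure Asymp (χ : ℝ → X → X) (K K' : Set X) (ξ : ℝ → X) : Prop where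
  cont : Continuous ξ
  track : ∀ L ε : ℝ, 0 < ε → ∃ δ > 0, ∃ T, ∀ t ≥ T, ∀ y ∈ K, ‖ξ t - y‖ < δ →
    ∀ h, |h| ≤ L → ‖ξ (t + h) - χ h y‖ < ε
  lim : ∀ ε > 0, ∃ T, ∀ t ≥ T, ∃ y ∈ K', ‖ξ t - y‖ < ε

theorem CompactFlow.asymp {K K' : Set X} {χ : ℝ → X → X}
    (F : CompactFlow K χ) {z : X} (hz : z ∈ K) (h' : ∀ t, χ t z ∈ K') :
    Asymp χ K K' (fun t => χ t z) where
  cont := F.continuous_orbit hz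
  track L ε hε := by
    obtain ⟨δ, hδ, hu⟩ := F.uniform L hε
    refine ⟨δ, hδ, 0, fun t _ y hy hd h hh => ?_⟩
    have := hu (χ t z) (F.maps t z hz) y hy hd h hh
    rwa [F.add _ _ z hz, add_comm] at this
  lim ε hε := ⟨0, fun t _ => ⟨χ t z, h' t, by simpa using hε⟩⟩

end Flow

section NormedSpace

variable {X : Type*} [NormedAddCommGroup X] [NormedSpace ℝ X]

theorem exists_lower_bound {Y : Type*} [TopologicalSpace Y] {S : Set Y} (hS : IsCompact S)
    {f : Y → ℝ} (hf : ContinuousOn f S) (h : ∀ y ∈ S, 0 < f y) : ∃ m > 0, ∀ y ∈ S, m ≤ f y := by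
  rcases S.eq_empty_or_nonempty with he | hne
  · exact ⟨1, one_pos, by simp [he]⟩
  · obtain ⟨t, ht, hm⟩ := hS.exists_isMinOn hne hf
    exact ⟨f t, h t ht, fun s hs => hm hs⟩

theorem exists_lt_of_pos {s : Finset ℝ} (hs : ∀ r ∈ s, 0 < r) :
    ∃ m > 0, ∀ r ∈ s, m < r := by
  have h1 : ∀ᶠ m : ℝ in 𝓝[>] 0, 0 < m := self_mem_nhdsWithin
  have h2 : ∀ᶠ m : ℝ in 𝓝[>] 0, ∀ r ∈ s, m < r := by
    rw [Filter.eventually_all_finset]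
    exact fun r hr => nhdsWithin_le_nhds (eventually_lt_nhds (hs r hr))
  obtain ⟨m, hm⟩ := (h1.and h2).exists
  exact ⟨m, hm⟩

theorem norm_map_sub_le (P : X →L[ℝ] ℂ) (u v : X) : ‖P u - P v‖ ≤ (‖P‖ + 1) * ‖u - v‖ := by
  rw [← map_sub]
  refine (P.le_opNorm _).trans ?_
  nlinarith [norm_nonneg (u - v)]

theorem no_double_visit (P : X →L[ℝ] ℂ) {K K' : Set X} {χ : ℝ → X → X} (F : CompactFlow K χ)
    {ξ : ℝ → X} (hξ : Asymp χ K K' ξ) (hK' : IsCompact K') {w : X} (hw : w ∈ K)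
    {a b : ℝ} {c : ℂ} (g : IsGate (fun h => P (χ h w)) a b c)
    (huniq : ∀ u ∈ K', P u = P w → u = w) :
    ∃ ε > 0, ∀ z ∈ K, ∀ s₁ s₂ : ℝ, s₁ + b < s₂ + a →
      (∀ h ∈ Icc a b, ‖χ (s₁ + h) z - χ h w‖ ≤ ε) →
      (∀ h ∈ Icc a b, ‖χ (s₂ + h) z - χ h w‖ ≤ ε) →
      InjOn (fun s => P (χ s z)) (Icc (s₁ + a) (s₂ + b)) →
      (∃ t₀, ∀ t ≥ t₀, ∀ s ∈ Icc (s₁ + a) (s₂ + b), P (ξ t) ≠ P (χ s z)) →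
      (∀ η > 0, ∀ D, ∃ d ≥ D, ‖ξ d - z‖ < η) → False := by
  obtain ⟨ε, hε, hno⟩ := g.no_crossing
  have ha := g.neg
  have hb := g.pos
  set M := ‖P‖ + 1 with hM
  have hMpos : 0 < M := by positivity
  have hw0 : χ 0 w = w := F.zero w hw
  set ρ := min b (-a) / 2 with hρ
  have hρpos : 0 < ρ := by have := lt_min hb (neg_pos.2 ha); positivity
  have hρb : 2 * ρ ≤ b := by have := min_le_left b (-a); linarith
  have hρa : 2 * ρ ≤ -a := by have := min_le_right b (-a); linarith
  -- separation of visits along the gate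
  obtain ⟨m, hm, hmle⟩ := exists_lower_bound (S := Icc a b ∩ {h | ρ ≤ |h|})
    (f := fun h => ‖χ h w - w‖)
    (isCompact_Icc.inter_right (isClosed_le continuous_const continuous_abs))
    (((F.continuous_orbit hw).sub continuous_const).norm.continuousOn) (by
      rintro h ⟨hh, hr⟩
      refine norm_pos_iff.2 (sub_ne_zero.2 fun he => ?_)
      have : h = 0 := g.inj hh g.zero_mem (by simp only [he, hw0])
      rw [this] at hr
      simp at hr
      linarith)
  set L := max (-a) b with hL
  have hLab : ∀ h ∈ Icc a b, |h| ≤ L := fun h hh =>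
    abs_le.2 ⟨by linarith [hh.1, le_max_left (-a) b], hh.2.trans (le_max_right _ _)⟩
  obtain ⟨δ, hδ, T₁, htr⟩ := hξ.track L (min (m / 3) (ε / M)) (by positivity)
  obtain ⟨δN, hδN, hδlt⟩ := exists_lt_of_pos (s := {δ, m / 3}) (by
    simp only [Finset.mem_insert, Finset.mem_singleton]
    rintro r (rfl | rfl)
    · exact hδ
    · positivity)
  have hδN1 : δN < δ := hδlt _ (by simp)
  have hδN2 : δN < m / 3 := hδlt _ (by simp)
  obtain ⟨μ, hμ, hμle⟩ := exists_lower_bound (S := K' ∩ {u | δN / 2 ≤ ‖u - w‖})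
    (f := fun u => ‖P u - P w‖)
    (hK'.inter_right (isClosed_le continuous_const (by fun_prop)))
    (by fun_prop) (by
      rintro u ⟨hu, hr⟩
      refine norm_pos_iff.2 (sub_ne_zero.2 fun he => ?_)
      rw [huniq u hu he] at hr
      simp at hr
      linarith)
  obtain ⟨T₂, hlim⟩ := hξ.lim (min (δN / 2) (μ / (4 * M))) (by positivity)
  obtain ⟨ε', hε', hε'lt⟩ := exists_lt_of_pos (s := {δN / 2, μ / (1000 * M), ε / M}) (by
    simp only [Finset.mem_insert, Finset.mem_singleton]
    rintro r (rfl | rfl | rfl) <;> positivity)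
  have hε'1 : ε' < δN / 2 := hε'lt _ (by simp)
  have hε'2 : ε' < μ / (1000 * M) := hε'lt _ (by simp)
  have hε'3 : ε' < ε / M := hε'lt _ (by simp)
  refine ⟨ε', hε', fun z hz s₁ s₂ hlt hc₁ hc₂ hinj ⟨t₀, hdisj⟩ hret => ?_⟩
  have hcz := F.continuous_orbit hz
  have hPle : ∀ u v : X, ∀ r : ℝ, ‖u - v‖ ≤ r / M → ‖P u - P v‖ ≤ r := fun u v r h => by
    rw [le_div_iff₀ hMpos] at h
    have := norm_map_sub_le P u v
    rw [mul_comm] at this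
    exact this.trans h
  have hb1 : ‖P (χ s₁ z) - P w‖ ≤ μ / 1000 := hPle _ _ _ (by
    have := hc₁ 0 g.zero_mem
    rw [add_zero, hw0] at this
    rw [div_div]
    exact this.trans hε'2.le)
  have hb2 : ‖P (χ s₂ z) - P w‖ ≤ μ / 1000 := hPle _ _ _ (by
    have := hc₂ 0 g.zero_mem
    rw [add_zero, hw0] at this
    rw [div_div]
    exact this.trans hε'2.le)
  have htrN : ∀ t, T₁ ≤ t → ‖ξ t - w‖ ≤ δN → ∀ h ∈ Icc a b,
      ‖ξ (t + h) - χ h w‖ < min (m / 3) (ε / M) := fun t ht htN h hh =>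
    htr t ht w hw (htN.trans_lt hδN1) h (hLab h hh)
  have hcr : Crossing (fun h => P (χ h w)) a b ε (fun s => P (χ s z)) (fun t => P (ξ t)) s₁ s₂
      {t | ‖ξ t - w‖ ≤ δN} (max (max T₁ T₂) t₀) ρ :=
    { neg := ha
      pos := hb
      contζ := by fun_prop
      contx := by have := hξ.cont; fun_prop
      lt := hlt
      closed := isClosed_le (by have := hξ.cont; fun_prop) continuous_const
      ρpos := hρpos
      ρb := hρb
      ρa := hρa
      inj := hinj
      close₁ := fun h hh => hPle _ _ _ ((hc₁ h hh).trans hε'3.le)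
      close₂ := fun h hh => hPle _ _ _ ((hc₂ h hh).trans hε'3.le)
      disj := fun t ht s hs => hdisj t ((le_max_right _ _).trans ht) s hs
      closeN := fun t htN ht h hh => hPle _ _ _
        ((htrN t (((le_max_left _ _).trans (le_max_left _ _)).trans ht) htN h hh).le.trans
          (min_le_right _ _))
      sep := fun t htN t' htN' ht _ h1 h2 => by
        by_contra hcon
        push Not at hcon
        have hh : t' - t ∈ Icc a b := ⟨by linarith, by linarith⟩
        have e1 := htrN t (((le_max_left _ _).trans (le_max_left _ _)).trans ht) htN _ hh
        rw [add_sub_cancel] at e1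
        have e2 := hmle _ ⟨hh, hcon⟩
        have e3 := norm_sub_le (ξ t' - w) (ξ t' - χ (t' - t) w)
        rw [sub_sub_sub_cancel_left] at e3
        have e4 := lt_min_iff.1 e1
        simp only [mem_ofPred_eq] at htN'
        linarith [e4.1]
      off := fun t ht htN => by
        obtain ⟨y, hy, hyt⟩ := hlim t (((le_max_right _ _).trans (le_max_left _ _)).trans ht)
        obtain ⟨hy1, hy2⟩ := lt_min_iff.1 hyt
        simp only [mem_ofPred_eq, not_le] at htN
        have e1 := norm_add_le (ξ t - y) (y - w)
        rw [sub_add_sub_cancel] at e1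
        have e2 := hμle y ⟨hy, by simp only [mem_ofPred_eq]; linarith⟩
        have e3 := hPle (ξ t) y (μ / 4) (by rw [div_div]; exact hy2.le)
        have e4 := norm_sub_le (P y - P w) (P (χ s₁ z) - P w)
        rw [sub_sub_sub_cancel_right] at e4
        have e5 := norm_sub_norm_le (P y - P w) (P (χ s₁ z) - P w)
        rw [sub_sub_sub_cancel_right] at e5
        have e6 := norm_sub_le (P (ξ t) - P y) (P (ξ t) - P (χ s₁ z))
        rw [sub_sub_sub_cancel_left, norm_sub_rev (P (χ s₁ z)) (P y),
          norm_sub_rev (P (ξ t)) (P (χ s₁ z))] at e6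
        have e7 := norm_sub_le (P (χ s₂ z) - P w) (P (χ s₁ z) - P w)
        rw [sub_sub_sub_cancel_right] at e7
        linarith }
  refine hno _ _ _ _ _ _ _ hcr fun η hη D => ?_
  obtain ⟨δ', hδ', T', htr'⟩ := hξ.track (max (max (-(s₁ + a)) (s₂ + b)) 0)
    (min (δN / 2) (η / M)) (by positivity)
  obtain ⟨d, hd, hdz⟩ := hret δ' hδ' (max D T')
  have hmem : ∀ s ∈ Icc (s₁ + a) (s₂ + b), ‖ξ (d + s) - χ s z‖ < min (δN / 2) (η / M) :=
    fun s hs => htr' d ((le_max_right _ _).trans hd) z hz hdz s (abs_le.2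
      ⟨by
        have := le_max_left (max (-(s₁ + a)) (s₂ + b)) 0
        have := le_max_left (-(s₁ + a)) (s₂ + b)
        linarith [hs.1], by
        have := le_max_left (max (-(s₁ + a)) (s₂ + b)) 0
        have := le_max_right (-(s₁ + a)) (s₂ + b)
        linarith [hs.2]⟩)
  have hN : ∀ s ∈ Icc (s₁ + a) (s₂ + b), ‖χ s z - w‖ ≤ δN / 2 → ‖ξ (d + s) - w‖ ≤ δN :=
    fun s hs h => by
      have e1 := norm_add_le (ξ (d + s) - χ s z) (χ s z - w)
      rw [sub_add_sub_cancel] at e1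
      linarith [(lt_min_iff.1 (hmem s hs)).1]
  refine ⟨d, (le_max_left _ _).trans hd, hN s₁ ⟨by linarith, by linarith⟩ ?_,
    hN s₂ ⟨by linarith, by linarith⟩ ?_, fun s hs => hPle _ _ _
      ((hmem s hs).le.trans (min_le_right _ _))⟩
  · have := hc₁ 0 g.zero_mem
    rw [add_zero, hw0] at this
    linarith
  · have := hc₂ 0 g.zero_mem
    rw [add_zero, hw0] at this
    linarith

/-- The semiorbit of `x`, extended to a path over `ℝ` that is constant for negative times. -/
def path (Φ : Semiflow X) (x : X) (t : ℝ) : X := Φ.toFun (max t 0) x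

theorem path_of_nonneg (Φ : Semiflow X) (x : X) {t : ℝ} (ht : 0 ≤ t) :
    path Φ x t = Φ.toFun t x := by
  rw [path, max_eq_left ht]

theorem path_add (Φ : Semiflow X) (x : X) {t h : ℝ} (ht : 0 ≤ t) (hh : 0 ≤ h) :
    path Φ x (t + h) = Φ.toFun h (path Φ x t) := by
  rw [path_of_nonneg Φ x ht, path_of_nonneg Φ x (add_nonneg ht hh), add_comm,
    Φ.map_add h t hh ht]

theorem continuous_path (Φ : Semiflow X) (x : X) : Continuous (path Φ x) := by
  rw [← continuousOn_univ]
  exact Φ.cont.comp (f := fun t : ℝ => (max t 0, x)) (by fun_prop)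
    fun t _ => ⟨mem_Ici.2 (le_max_right t 0), mem_univ _⟩

theorem path_mem (Φ : Semiflow X) (x : X) (t : ℝ) : path Φ x t ∈ posOrbit Φ x :=
  ⟨_, le_max_right _ _, rfl⟩

theorem mem_omegaSet {Φ : Semiflow X} {x y : X} :
    y ∈ omegaSet Φ x ↔ ∀ ε > 0, ∀ D, ∃ t ≥ D, ‖path Φ x t - y‖ < ε := by
  simp only [omegaSet, mem_iInter, mem_Ici, Metric.mem_closure_iff]
  constructor
  · intro h ε hε D
    obtain ⟨_, ⟨t, ht, rfl⟩, hd⟩ := h (max D 0) (le_max_right _ _) ε hε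
    refine ⟨t, (le_max_left _ _).trans ht, ?_⟩
    rwa [path_of_nonneg Φ x ((le_max_right _ _).trans ht), ← dist_eq_norm, dist_comm]
  · intro h s hs ε hε
    obtain ⟨t, ht, hd⟩ := h ε hε s
    refine ⟨_, ⟨t, ht, rfl⟩, ?_⟩
    rwa [path_of_nonneg Φ x (hs.trans ht), ← dist_eq_norm, dist_comm] at hd

theorem isClosed_omegaSet (Φ : Semiflow X) (x : X) : IsClosed (omegaSet Φ x) :=
  isClosed_biInter fun _ _ => isClosed_closure

theorem omegaSet_subset (Φ : Semiflow X) (x : X) : omegaSet Φ x ⊆ closure (posOrbit Φ x) :=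
  fun y hy => Metric.mem_closure_iff.2 fun ε hε => by
    obtain ⟨t, -, ht⟩ := mem_omegaSet.1 hy ε hε 0
    exact ⟨_, path_mem Φ x t, by rwa [dist_comm, dist_eq_norm]⟩

theorem exists_omega_limit {Φ : Semiflow X} {x : X} (hpre : IsCompact (closure (posOrbit Φ x)))
    {u : ℕ → ℝ} (hu : Tendsto u atTop atTop) :
    ∃ y ∈ omegaSet Φ x, ∃ φ : ℕ → ℕ, StrictMono φ ∧
      Tendsto (fun n => path Φ x (u (φ n))) atTop (𝓝 y) := by
  obtain ⟨y, -, φ, hφ, hy⟩ := hpre.tendsto_subseq (x := fun n => path Φ x (u n))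
    fun n => subset_closure (path_mem Φ x _)
  refine ⟨y, mem_omegaSet.2 fun ε hε D => ?_, φ, hφ, hy⟩
  have h1 := (hu.comp hφ.tendsto_atTop).eventually_ge_atTop D
  have h2 := (Metric.tendsto_nhds.1 hy) ε hε
  obtain ⟨n, hn1, hn2⟩ := (h1.and h2).exists
  exact ⟨_, hn1, by rwa [dist_eq_norm] at hn2⟩

theorem exists_times_of_frequently {p : ℝ → Prop} (h : ∀ D : ℝ, ∃ t ≥ D, p t) :
    ∃ u : ℕ → ℝ, Tendsto u atTop atTop ∧ ∀ n, p (u n) := by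
  choose f hf hp using h
  exact ⟨fun n => f n, tendsto_atTop_mono (fun n => hf n) tendsto_natCast_atTop_atTop,
    fun n => hp _⟩

theorem omegaSet_lim {Φ : Semiflow X} {x : X} (hpre : IsCompact (closure (posOrbit Φ x)))
    {ε : ℝ} (hε : 0 < ε) : ∃ T, ∀ t ≥ T, ∃ y ∈ omegaSet Φ x, ‖path Φ x t - y‖ < ε := by
  by_contra! h
  obtain ⟨u, hu, hp⟩ := exists_times_of_frequently h
  obtain ⟨y, hy, φ, -, hlim⟩ := exists_omega_limit hpre hu
  obtain ⟨n, hn⟩ := ((Metric.tendsto_nhds.1 hlim) ε hε).exists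
  rw [dist_eq_norm] at hn
  exact absurd (hp _ y hy) (not_le.2 hn)

theorem exists_times_of_mem_omegaSet {Φ : Semiflow X} {x y : X} (hy : y ∈ omegaSet Φ x) :
    ∃ u : ℕ → ℝ, Tendsto u atTop atTop ∧ Tendsto (fun n => path Φ x (u n)) atTop (𝓝 y) := by
  choose u hu hd using fun n : ℕ => mem_omegaSet.1 hy (1 / (n + 1)) (by positivity) n
  refine ⟨u, tendsto_atTop_mono hu tendsto_natCast_atTop_atTop, ?_⟩
  rw [tendsto_iff_norm_sub_tendsto_zero]
  exact squeeze_zero (fun _ => norm_nonneg _) (fun n => (hd n).le)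
    tendsto_one_div_add_atTop_nhds_zero_nat

/-- A semiflow that is strongly monotone for the cone `C`, a pseudo-ordered precompact
semiorbit, and a flow extension on its limit set. -/
structure OrderedOmega (Φ : Semiflow X) (C : Set X) (x : X) (ψ : ℝ → X → X) : Prop where
  closed : IsClosed C
  smul : ∀ (t : ℝ) (v : X), v ∈ C → t • v ∈ C
  mono : StronglyMonotone Φ C
  pre : IsCompact (closure (posOrbit Φ x))
  pseudo : PseudoOrdered Φ C x
  ext : IsFlowExtensionOn Φ ψ (omegaSet Φ x)

namespace OrderedOmega

variable {Φ : Semiflow X} {C : Set X} {x : X} {ψ : ℝ → X → X}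

theorem flow (S : OrderedOmega Φ C x ψ) : CompactFlow (omegaSet Φ x) ψ where
  compact := S.pre.of_isClosed_subset (isClosed_omegaSet Φ x) (omegaSet_subset Φ x)
  maps := S.ext.2.1
  zero z hz := by rw [S.ext.1 0 le_rfl z hz, Φ.map_zero]
  add := S.ext.2.2.1
  cont := S.ext.2.2.2

theorem eq_toFun (S : OrderedOmega Φ C x ψ) {t : ℝ} (ht : 0 ≤ t) {z : X}
    (hz : z ∈ omegaSet Φ x) : ψ t z = Φ.toFun t z := S.ext.1 t ht z hz

theorem asymp (S : OrderedOmega Φ C x ψ) :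
    Asymp ψ (omegaSet Φ x) (omegaSet Φ x) (path Φ x) where
  cont := continuous_path Φ x
  lim ε hε := omegaSet_lim S.pre hε
  track L ε hε := by
    have F := S.flow
    rcases lt_or_ge L 0 with hL | hL
    · exact ⟨1, one_pos, 0, fun t _ y _ _ h hh => absurd ((abs_nonneg h).trans hh) (not_le.2 hL)⟩
    obtain ⟨δ₁, hδ₁, hu₁⟩ := F.uniform L (half_pos hε)
    have huc : UniformContinuousOn (fun p : ℝ × X => Φ.toFun p.1 p.2)
        (Icc 0 (2 * L) ×ˢ closure (posOrbit Φ x)) :=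
      (isCompact_Icc.prod S.pre).uniformContinuousOn_of_continuous
        (Φ.cont.mono (prod_mono (fun t ht => ht.1) (subset_univ _)))
    obtain ⟨δ₂, hδ₂, hu₂⟩ := Metric.uniformContinuousOn_iff.1 huc (min (ε / 2) (δ₁ / 2))
      (by positivity)
    obtain ⟨T, hT⟩ := omegaSet_lim S.pre hδ₂
    refine ⟨δ₁ / 2, by positivity, max (T + L) L, fun t ht y hy hd h hh => ?_⟩
    have ht1 : T ≤ t - L := by have := (le_max_left _ _).trans ht; linarith
    have ht2 : 0 ≤ t - L := by have := (le_max_right _ _).trans ht; linarith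
    obtain ⟨u, hu, hud⟩ := hT (t - L) ht1
    have key : ∀ h, |h| ≤ L → ‖path Φ x (t + h) - ψ h (ψ L u)‖ < min (ε / 2) (δ₁ / 2) := by
      intro h hh
      rw [abs_le] at hh
      have e : t + h = (t - L) + (h + L) := by ring
      rw [e, path_add Φ x ht2 (by linarith), F.add _ _ u hu, S.eq_toFun (by linarith) hu,
        ← dist_eq_norm]
      refine hu₂ (h + L, _) ⟨⟨by simp only; linarith, by simp only; linarith⟩,
        subset_closure (path_mem Φ x _)⟩ (h + L, u)
        ⟨⟨by simp only; linarith, by simp only; linarith⟩, omegaSet_subset Φ x hu⟩ ?_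
      rw [Prod.dist_eq, dist_self, max_lt_iff, dist_eq_norm]
      exact ⟨hδ₂, hud⟩
    have huL : ψ L u ∈ omegaSet Φ x := F.maps _ _ hu
    have h0 := key 0 (by simpa using hL)
    rw [add_zero, F.zero _ huL] at h0
    have h0' : ‖ψ L u - y‖ < δ₁ := by
      have e : ψ L u - y = (path Φ x t - y) - (path Φ x t - ψ L u) := by abel
      rw [e]
      refine (norm_sub_le _ _).trans_lt ?_
      have := h0.trans_le (min_le_right _ _)
      linarith
    have h1 := hu₁ _ huL y hy h0' h hh
    have h2 := (key h hh).trans_le (min_le_left _ _)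
    have e : path Φ x (t + h) - ψ h y =
      (path Φ x (t + h) - ψ h (ψ L u)) + (ψ h (ψ L u) - ψ h y) := by abel
    rw [e]
    refine (norm_add_le _ _).trans_lt ?_
    linarith

/-- If `x` approaches `y` along a sequence of times, the shifted times approach `ψ h y`. -/
theorem tendsto_shift (S : OrderedOmega Φ C x ψ) {u : ℕ → ℝ} (hu : Tendsto u atTop atTop) {y : X}
    (hy : y ∈ omegaSet Φ x) (hlim : Tendsto (fun n => path Φ x (u n)) atTop (𝓝 y)) (h : ℝ) :
    Tendsto (fun n => path Φ x (u n + h)) atTop (𝓝 (ψ h y)) := by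
  rw [Metric.tendsto_nhds]
  intro ε hε
  obtain ⟨δ, hδ, T, htr⟩ := S.asymp.track |h| ε hε
  filter_upwards [(Metric.tendsto_nhds.1 hlim) δ hδ, hu.eventually_ge_atTop T] with n h1 h2
  rw [dist_eq_norm] at h1 ⊢
  exact htr _ h2 y hy h1 h le_rfl

end OrderedOmega

/-- The closure of the full orbit of `z` under `χ`. -/
def orbitClosure (χ : ℝ → X → X) (z : X) : Set X := closure (range fun t => χ t z)

namespace OrderedOmega

variable {Φ : Semiflow X} {C : Set X} {x : X} {ψ : ℝ → X → X}

theorem symm (S : OrderedOmega Φ C x ψ) {u v : X} (h : u - v ∈ C) : v - u ∈ C := by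
  have := S.smul (-1) _ h
  rwa [neg_one_smul, neg_sub] at this

theorem zero_mem (S : OrderedOmega Φ C x ψ) : (0 : X) ∈ C := by
  obtain ⟨t₁, t₂, -, -, -, h⟩ := S.pseudo
  have := S.smul 0 _ h
  rwa [zero_smul] at this

theorem path_ordered_later (S : OrderedOmega Φ C x ψ) {d t t' : ℝ} (ht : 0 ≤ t) (htd : 0 ≤ t + d)
    (htt : t ≤ t') (h : path Φ x (t + d) - path Φ x t ∈ C) :
    path Φ x (t' + d) - path Φ x t' ∈ C := by
  have h1 : t' = t + (t' - t) := by ring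
  have h2 : t' + d = (t + d) + (t' - t) := by ring
  rw [h2, path_add Φ x htd (sub_nonneg.2 htt)]
  nth_rewrite 2 [h1]
  rw [path_add Φ x ht (sub_nonneg.2 htt)]
  exact S.mono.1 _ (sub_nonneg.2 htt) _ _ h

/-- The shifts that keep every point of the limit set ordered with itself. -/
def shifts (_ : OrderedOmega Φ C x ψ) : Set ℝ := {r | ∀ z ∈ omegaSet Φ x, ψ r z - z ∈ C}

theorem mem_shifts_of_path (S : OrderedOmega Φ C x ψ) {d t : ℝ} (ht : 0 ≤ t) (htd : 0 ≤ t + d)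
    (h : path Φ x (t + d) - path Φ x t ∈ C) : d ∈ S.shifts := by
  intro z hz
  obtain ⟨u, hu, hlim⟩ := exists_times_of_mem_omegaSet hz
  refine S.closed.mem_of_tendsto ((S.tendsto_shift hu hz hlim d).sub hlim) ?_
  filter_upwards [hu.eventually_ge_atTop t] with n hn
  exact S.path_ordered_later ht htd hn h

theorem shifts_mem_nhds (S : OrderedOmega Φ C x ψ) {d t : ℝ} (ht : 0 ≤ t) (htd : 0 < t + d)
    (h : path Φ x (t + d) - path Φ x t ∈ interior C) : S.shifts ∈ 𝓝 d := by
  have hc : Continuous fun d => path Φ x (t + d) - path Φ x t := by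
    have := continuous_path Φ x
    fun_prop
  have h1 : ∀ᶠ d' in 𝓝 d, path Φ x (t + d') - path Φ x t ∈ interior C :=
    hc.continuousAt.eventually (isOpen_interior.mem_nhds h)
  have h2 : ∀ᶠ d' in 𝓝 d, 0 < t + d' :=
    (continuous_const.add continuous_id).continuousAt.eventually (lt_mem_nhds htd)
  filter_upwards [h1, h2] with d' h3 h4
  exact S.mem_shifts_of_path ht h4.le (interior_subset h3)

theorem shifts_nhds_of_ne (S : OrderedOmega Φ C x ψ) {r : ℝ} (hr : r ∈ S.shifts) {z : X}
    (hz : z ∈ omegaSet Φ x) (hne : ψ r z ≠ z) : S.shifts ∈ 𝓝 r := by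
  have F := S.flow
  have h1 := S.mono.2 1 one_pos _ _ (hr z hz) hne
  rw [← S.eq_toFun zero_le_one hz, ← S.eq_toFun zero_le_one (F.maps r z hz), F.add _ _ z hz,
    add_comm, ← F.add _ _ z hz] at h1
  set w := ψ 1 z
  have hw : w ∈ omegaSet Φ x := F.maps 1 z hz
  obtain ⟨u, hu, hlim⟩ := exists_times_of_mem_omegaSet hw
  have h2 := ((S.tendsto_shift hu hw hlim r).sub hlim).eventually (isOpen_interior.mem_nhds h1)
  obtain ⟨n, hn1, hn2⟩ := (h2.and (hu.eventually_gt_atTop (max 0 (-r)))).exists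
  refine S.shifts_mem_nhds ((le_max_left _ _).trans hn2.le) ?_ hn1
  have := (le_max_right _ _).trans_lt hn2
  linarith

theorem exists_shifts_nhds (S : OrderedOmega Φ C x ψ) : ∃ r, S.shifts ∈ 𝓝 r := by
  obtain ⟨t₁, t₂, h₁, h₂, hne, h⟩ := S.pseudo
  have h3 := S.mono.2 1 one_pos _ _ h hne
  rw [← path_of_nonneg Φ x h₁, ← path_of_nonneg Φ x h₂, ← path_add Φ x h₁ zero_le_one,
    ← path_add Φ x h₂ zero_le_one] at h3
  refine ⟨t₁ - t₂, S.shifts_mem_nhds (t := t₂ + 1) (by linarith) (by linarith) ?_⟩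
  convert h3 using 3
  ring

theorem isClosed_shifts (S : OrderedOmega Φ C x ψ) : IsClosed S.shifts := by
  have : S.shifts = ⋂ z ∈ omegaSet Φ x, {r | ψ r z - z ∈ C} := by
    ext r; simp [shifts]
  rw [this]
  exact isClosed_biInter fun z hz =>
    S.closed.preimage ((S.flow.continuous_orbit hz).sub continuous_const)

theorem neg_mem_shifts (S : OrderedOmega Φ C x ψ) {r : ℝ} (hr : r ∈ S.shifts) :
    -r ∈ S.shifts := fun z hz => by
  have h := hr _ (S.flow.maps (-r) z hz)
  rw [S.flow.add _ _ z hz, add_neg_cancel, S.flow.zero z hz] at h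
  exact S.symm h

/-- The shifts that fix the limit set pointwise. -/
def fixers (S : OrderedOmega Φ C x ψ) : AddSubgroup ℝ where
  carrier := {r | ∀ z ∈ omegaSet Φ x, ψ r z = z}
  zero_mem' := fun z hz => S.flow.zero z hz
  add_mem' := fun {a b} ha hb z hz => by rw [← S.flow.add _ _ z hz, hb z hz, ha z hz]
  neg_mem' := fun {a} ha z hz => by
    nth_rewrite 1 [← ha z hz]
    rw [S.flow.add _ _ z hz, neg_add_cancel, S.flow.zero z hz]

theorem mem_fixers (S : OrderedOmega Φ C x ψ) {r : ℝ} :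
    r ∈ S.fixers ↔ ∀ z ∈ omegaSet Φ x, ψ r z = z := Iff.rfl

theorem isClosed_fixers (S : OrderedOmega Φ C x ψ) : IsClosed (S.fixers : Set ℝ) := by
  have : (S.fixers : Set ℝ) = ⋂ z ∈ omegaSet Φ x, {r | ψ r z = z} := by
    ext r; simp [mem_fixers]
  rw [this]
  exact isClosed_biInter fun z hz => isClosed_eq (S.flow.continuous_orbit hz) continuous_const

theorem shifts_add_fixers (S : OrderedOmega Φ C x ψ) {r f : ℝ} (hr : r ∈ S.shifts)
    (hf : f ∈ S.fixers) : r + f ∈ S.shifts := fun z hz => by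
  rw [← S.flow.add _ _ z hz, hf z hz]
  exact hr z hz

theorem fixers_subset_shifts (S : OrderedOmega Φ C x ψ) : (S.fixers : Set ℝ) ⊆ S.shifts :=
  fun r hr z hz => by
    rw [(S.mem_fixers.1 hr) z hz, sub_self]; exact S.zero_mem

theorem shifts_nhds_of_not_mem (S : OrderedOmega Φ C x ψ) {r : ℝ} (hr : r ∈ S.shifts)
    (hf : r ∉ S.fixers) : S.shifts ∈ 𝓝 r := by
  rw [mem_fixers] at hf
  push Not at hf
  obtain ⟨z, hz, hne⟩ := hf
  exact S.shifts_nhds_of_ne hr hz hne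

theorem shifts_nhds_zero (S : OrderedOmega Φ C x ψ) : S.shifts ∈ 𝓝 0 := by
  -- a positive shift outside the fixers propagates down to the nearest fixer below it
  have key : ∀ r ∈ S.shifts, 0 < r → r ∉ S.fixers → S.shifts ∈ 𝓝 0 := by
    intro r hr hr0 hrf
    set B := (S.fixers : Set ℝ) ∩ Iic r with hB
    have hBne : B.Nonempty := ⟨0, S.fixers.zero_mem, hr0.le⟩
    have hBbdd : BddAbove B := ⟨r, fun s hs => hs.2⟩
    have hBcl : IsClosed B := S.isClosed_fixers.inter isClosed_Iic
    obtain ⟨hf, hfr⟩ := hBcl.csSup_mem hBne hBbdd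
    set f := sSup B
    have hlt : f < r := lt_of_le_of_ne hfr fun h => hrf (h ▸ hf)
    have hno : ∀ s ∈ Ioc f r, s ∉ S.fixers := fun s hs hsf =>
      absurd (le_csSup hBbdd ⟨hsf, hs.2⟩) (not_le.2 hs.1)
    have hsub : Ioc f r ⊆ interior S.shifts := by
      refine isPreconnected_Ioc.subset_of_closure_inter_subset isOpen_interior
        ⟨r, ⟨hlt, le_rfl⟩, mem_interior_iff_mem_nhds.2 (S.shifts_nhds_of_not_mem hr hrf)⟩ ?_
      rintro s ⟨hs1, hs2⟩
      have : s ∈ S.shifts := S.isClosed_shifts.closure_subset_iff.2 interior_subset hs1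
      exact mem_interior_iff_mem_nhds.2 (S.shifts_nhds_of_not_mem this (hno s hs2))
    have hpos : ∀ s ∈ Ioc 0 (r - f), s ∈ S.shifts := fun s hs => by
      have h1 := interior_subset (hsub (show s + f ∈ Ioc f r from
        ⟨by linarith [hs.1], by linarith [hs.2]⟩))
      simpa using S.shifts_add_fixers h1 (S.fixers.neg_mem hf)
    filter_upwards [Ioo_mem_nhds (neg_lt_zero.2 (sub_pos.2 hlt)) (sub_pos.2 hlt)] with s hs
    rcases lt_trichotomy s 0 with h | h | h
    · simpa using S.neg_mem_shifts (hpos (-s) ⟨by linarith, by linarith [hs.1]⟩)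
    · exact h ▸ S.fixers_subset_shifts S.fixers.zero_mem
    · exact hpos s ⟨h, hs.2.le⟩
  obtain ⟨r, hr⟩ := S.exists_shifts_nhds
  by_cases hall : S.shifts ⊆ S.fixers
  · have h1 : Tendsto (fun s => r + s) (𝓝 0) (𝓝 r) := by
      have : Tendsto (fun s => r + s) (𝓝 0) (𝓝 (r + 0)) := tendsto_id.const_add r
      rwa [add_zero] at this
    filter_upwards [h1 hr] with s hs
    have := S.fixers.sub_mem (hall hs) (hall (mem_of_mem_nhds hr))
    rw [add_sub_cancel_left] at this
    exact S.fixers_subset_shifts this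
  · obtain ⟨q, hq, hqf⟩ := not_subset.1 hall
    rcases lt_trichotomy q 0 with h | h | h
    · exact key (-q) (S.neg_mem_shifts hq) (by linarith) fun h' => hqf (by
        simpa using S.fixers.neg_mem h')
    · exact absurd (h ▸ S.fixers.zero_mem) hqf
    · exact key q hq h hqf

theorem ordered_orbit (S : OrderedOmega Φ C x ψ) (r : ℝ) {z : X} (hz : z ∈ omegaSet Φ x) :
    ψ r z - z ∈ C := by
  have hopen : IsOpen S.shifts := by
    rw [isOpen_iff_mem_nhds]
    intro r hr
    by_cases hf : r ∈ S.fixers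
    · have h1 : Tendsto (fun s => s - r) (𝓝 r) (𝓝 0) := by
        have : Tendsto (fun s => s - r) (𝓝 r) (𝓝 (r - r)) := tendsto_id.sub_const r
        rwa [sub_self] at this
      filter_upwards [h1 S.shifts_nhds_zero] with s hs
      simpa using S.shifts_add_fixers hs hf
    · exact S.shifts_nhds_of_not_mem hr hf
  have := IsClopen.eq_univ ⟨S.isClosed_shifts, hopen⟩
    ⟨0, S.fixers_subset_shifts S.fixers.zero_mem⟩
  exact this.symm.subset (mem_univ r) z hz

theorem interior_of_back (S : OrderedOmega Φ C x ψ) {u v : X} (hu : u ∈ omegaSet Φ x)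
    (hv : v ∈ omegaSet Φ x) (h : ψ (-1) u - ψ (-1) v ∈ C) (hne : u ≠ v) :
    u - v ∈ interior C := by
  have F := S.flow
  have e : ∀ u ∈ omegaSet Φ x, Φ.toFun 1 (ψ (-1) u) = u := fun u hu => by
    rw [← S.eq_toFun zero_le_one (F.maps _ u hu), F.add _ _ u hu, add_neg_cancel, F.zero u hu]
  have := S.mono.2 1 one_pos _ _ h fun h' => hne (by rw [← e u hu, h', e v hv])
  rwa [e u hu, e v hv] at this

theorem orbitClosure_subset (S : OrderedOmega Φ C x ψ) {z : X} (hz : z ∈ omegaSet Φ x) :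
    orbitClosure ψ z ⊆ omegaSet Φ x :=
  (isClosed_omegaSet Φ x).closure_subset_iff.2 (by
    rintro _ ⟨t, rfl⟩; exact S.flow.maps t z hz)

theorem isCompact_orbitClosure (S : OrderedOmega Φ C x ψ) {z : X} (hz : z ∈ omegaSet Φ x) :
    IsCompact (orbitClosure ψ z) :=
  S.flow.compact.of_isClosed_subset isClosed_closure (S.orbitClosure_subset hz)

theorem ordered_orbitClosure (S : OrderedOmega Φ C x ψ) {z v : X} (hz : z ∈ omegaSet Φ x)
    (hv : v ∈ orbitClosure ψ z) : v - z ∈ C := by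
  have : IsClosed {v | v - z ∈ C} := S.closed.preimage (by fun_prop)
  refine this.closure_subset_iff.2 ?_ hv
  rintro _ ⟨t, rfl⟩
  exact S.ordered_orbit t hz

theorem interior_orbitClosure (S : OrderedOmega Φ C x ψ) {z v : X} (hz : z ∈ omegaSet Φ x)
    (hv : v ∈ orbitClosure ψ z) (hne : v ≠ z) : v - z ∈ interior C := by
  have hvK := S.orbitClosure_subset hz hv
  refine S.interior_of_back hvK hz ?_ hne
  obtain ⟨u, hu, hlim⟩ := mem_closure_iff_seq_limit.1 hv
  choose t ht using hu
  have hK : ∀ n, u n ∈ omegaSet Φ x := fun n => by rw [← ht n]; exact S.flow.maps _ z hz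
  have h1 : Tendsto (fun n => ψ (-1) (u n)) atTop (𝓝 (ψ (-1) v)) :=
    (S.flow.continuousOn_map (-1) v hvK).tendsto.comp
      (tendsto_nhdsWithin_iff.2 ⟨hlim, Eventually.of_forall hK⟩)
  refine S.closed.mem_of_tendsto (h1.sub_const _) (Eventually.of_forall fun n => ?_)
  have := S.ordered_orbit (t n) (S.flow.maps (-1) z hz)
  rwa [S.flow.add _ _ z hz, add_comm, ← S.flow.add _ _ z hz, show ψ (t n) z = u n from ht n]
    at this

end OrderedOmega

/-- From some time on `x` is ordered with, and distinct from, every point of the orbit of `z`. -/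
def Parallel (C : Set X) (ξ : ℝ → X) (χ : ℝ → X → X) (z : X) : Prop :=
  ∃ T, ∀ t ≥ T, ∀ s, ξ t - χ s z ∈ C ∧ ξ t ≠ χ s z

/-- The path `ξ` shadows the orbit of `z`. -/
def Shadows (ξ : ℝ → X) (χ : ℝ → X → X) (z : X) : Prop :=
  ∃ d, Tendsto (fun t => ξ t - χ (t - d) z) atTop (𝓝 0)

/-- The positive semiorbit of `z` returns to `z` at arbitrarily late times. -/
def PosRec (χ : ℝ → X → X) (z : X) : Prop := ∀ η > 0, ∀ D, ∃ d ≥ D, ‖χ d z - z‖ < η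

/-- A shadowed orbit accumulates on every point of the limit set. -/
theorem Shadows.near {Φ : Semiflow X} {x : X} {ψ : ℝ → X → X} {z y : X}
    (hs : Shadows (path Φ x) ψ z) (hy : y ∈ omegaSet Φ x) :
    ∀ η > 0, ∀ D, ∃ d ≥ D, ‖ψ d z - y‖ < η := by
  obtain ⟨d, hd⟩ := hs
  intro η hη D
  obtain ⟨u, hu, hlim⟩ := exists_times_of_mem_omegaSet hy
  have h1 := hlim.sub (hd.comp hu)
  simp only [Function.comp_def, sub_sub_cancel, sub_zero] at h1
  obtain ⟨n, hn, hn'⟩ := (((Metric.tendsto_nhds.1 h1) η hη).and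
    (hu.eventually_ge_atTop (D + d))).exists
  exact ⟨u n - d, by linarith, by rwa [dist_eq_norm] at hn⟩

namespace OrderedOmega

variable {Φ : Semiflow X} {C : Set X} {x : X} {ψ : ℝ → X → X}

/-- The delays `d` for which `x` is eventually ordered with the orbit of `z` delayed by `d`. -/
def delays (_ : OrderedOmega Φ C x ψ) (z : X) : Set ℝ :=
  {d | ∃ t ≥ 0, path Φ x t - ψ (t - d) z ∈ C}

theorem step (S : OrderedOmega Φ C x ψ) {z : X} (hz : z ∈ omegaSet Φ x) {t s h : ℝ} (ht : 0 ≤ t)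
    (hh : 0 ≤ h) (hC : path Φ x t - ψ s z ∈ C) : path Φ x (t + h) - ψ (s + h) z ∈ C := by
  have := S.mono.1 h hh _ _ hC
  rwa [← path_add Φ x ht hh, ← S.eq_toFun hh (S.flow.maps s z hz), S.flow.add _ _ z hz,
    add_comm h s] at this

theorem step_interior (S : OrderedOmega Φ C x ψ) {z : X} (hz : z ∈ omegaSet Φ x) {t s h : ℝ}
    (ht : 0 ≤ t) (hh : 0 < h) (hC : path Φ x t - ψ s z ∈ C) (hne : path Φ x t ≠ ψ s z) :
    path Φ x (t + h) - ψ (s + h) z ∈ interior C := by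
  have := S.mono.2 h hh _ _ hC hne
  rwa [← path_add Φ x ht hh.le, ← S.eq_toFun hh.le (S.flow.maps s z hz), S.flow.add _ _ z hz,
    add_comm h s] at this

theorem step_eq (S : OrderedOmega Φ C x ψ) {z : X} (hz : z ∈ omegaSet Φ x) {t s h : ℝ}
    (ht : 0 ≤ t) (hh : 0 ≤ h) (hC : path Φ x t = ψ s z) :
    path Φ x (t + h) = ψ (s + h) z := by
  rw [path_add Φ x ht hh, hC, ← S.eq_toFun hh (S.flow.maps s z hz), S.flow.add _ _ z hz,
    add_comm h s]

theorem delays_later (S : OrderedOmega Φ C x ψ) {z : X} (hz : z ∈ omegaSet Φ x) {d : ℝ}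
    (hd : d ∈ S.delays z) : ∃ T, ∀ t ≥ T, path Φ x t - ψ (t - d) z ∈ C := by
  obtain ⟨t, ht, h⟩ := hd
  refine ⟨t, fun t' ht' => ?_⟩
  have := S.step hz ht (sub_nonneg.2 ht') h
  convert this using 3 <;> ring

theorem shadows_of_boundary (S : OrderedOmega Φ C x ψ) {z : X} (hz : z ∈ omegaSet Φ x) {d : ℝ}
    (hd : d ∈ closure (S.delays z)) (hnd : d ∉ S.delays z) : Shadows (path Φ x) ψ z := by
  have F := S.flow
  refine ⟨d, ?_⟩
  rw [tendsto_zero_iff_norm_tendsto_zero]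
  by_contra hcon
  rw [Metric.tendsto_atTop] at hcon
  push Not at hcon
  obtain ⟨ε, hε, hcon⟩ := hcon
  obtain ⟨u, hu, hp⟩ := exists_times_of_frequently hcon
  obtain ⟨y, hy, φ, hφ, hlim⟩ := exists_omega_limit S.pre hu
  obtain ⟨v, hv, φ', hφ', hlim'⟩ := F.compact.tendsto_subseq
    (x := fun n => ψ (u (φ n) - d) z) fun n => F.maps _ z hz
  set q : ℕ → ℝ := fun n => u (φ (φ' n)) with hq
  have hqtop : Tendsto q atTop atTop := hu.comp (hφ.tendsto_atTop.comp hφ'.tendsto_atTop)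
  have hqy : Tendsto (fun n => path Φ x (q n)) atTop (𝓝 y) := hlim.comp hφ'.tendsto_atTop
  have hqv : Tendsto (fun n => ψ (q n - d) z) atTop (𝓝 v) := hlim'
  have hne : y ≠ v := by
    rintro rfl
    have h0 := (hqy.sub hqv).norm
    rw [sub_self, norm_zero] at h0
    obtain ⟨n, hn⟩ := (h0.eventually (gt_mem_nhds hε)).exists
    have := hp (φ (φ' n))
    simp only [dist_zero_right, norm_norm] at this
    linarith
  have hvs : ∀ h, Tendsto (fun n => ψ (q n - d + h) z) atTop (𝓝 (ψ h v)) := fun h => by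
    have h1 : Tendsto (fun n => ψ h (ψ (q n - d) z)) atTop (𝓝 (ψ h v)) :=
      (F.continuousOn_map h v hv).tendsto.comp
        (tendsto_nhdsWithin_iff.2 ⟨hqv, Eventually.of_forall fun n => F.maps _ z hz⟩)
    refine h1.congr fun n => ?_
    rw [F.add _ _ z hz, add_comm]
  have hdel : ∀ d' ∈ S.delays z, ψ (-1) y - ψ (-1 + (d - d')) v ∈ C := fun d' hd' => by
    obtain ⟨T, hT⟩ := S.delays_later hz hd'
    refine S.closed.mem_of_tendsto ((S.tendsto_shift hqtop hy hqy (-1)).sub (hvs _)) ?_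
    filter_upwards [hqtop.eventually_ge_atTop (T + 1)] with n hn
    have := hT (q n + -1) (by linarith)
    convert this using 3
    ring
  have hback : ψ (-1) y - ψ (-1) v ∈ C := by
    have hcl : IsClosed {d' | ψ (-1) y - ψ (-1 + (d - d')) v ∈ C} := by
      have := F.continuous_orbit hv
      exact S.closed.preimage (continuous_const.sub (this.comp (by fun_prop)))
    have := hcl.closure_subset_iff.2 hdel hd
    simpa using this
  have hZ := S.interior_of_back hy hv hback hne
  obtain ⟨n, hn, hn0⟩ := (((hqy.sub hqv).eventually (isOpen_interior.mem_nhds hZ)).and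
    (hqtop.eventually_ge_atTop 0)).exists
  exact hnd ⟨q n, hn0, interior_subset hn⟩

theorem shadows_of_eq (S : OrderedOmega Φ C x ψ) {z : X} (hz : z ∈ omegaSet Φ x) {t s : ℝ}
    (ht : 0 ≤ t) (h : path Φ x t = ψ s z) : Shadows (path Φ x) ψ z := by
  refine ⟨t - s, tendsto_const_nhds.congr' ?_⟩
  filter_upwards [eventually_ge_atTop t] with t' ht'
  have := S.step_eq hz ht (sub_nonneg.2 ht') h
  rw [show t + (t' - t) = t' by ring, show s + (t' - t) = t' - (t - s) by ring] at this
  rw [this, sub_self]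

/-- A delay has a neighborhood of delays with a common threshold. -/
theorem delays_locally_uniform (S : OrderedOmega Φ C x ψ) {z : X} (hz : z ∈ omegaSet Φ x)
    (hns : ¬ Shadows (path Φ x) ψ z) {d : ℝ} (hd : d ∈ S.delays z) :
    ∃ T ≥ 0, ∀ᶠ d' in 𝓝 d, ∀ t ≥ T, path Φ x t - ψ (t - d') z ∈ C := by
  obtain ⟨t, ht, h⟩ := hd
  have hne : path Φ x t ≠ ψ (t - d) z := fun he => hns (S.shadows_of_eq hz ht he)
  have h1 := S.step_interior hz ht one_pos h hne
  refine ⟨t + 1, by linarith, ?_⟩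
  have hc : Continuous fun d' => path Φ x (t + 1) - ψ (t - d' + 1) z :=
    continuous_const.sub ((S.flow.continuous_orbit hz).comp (by fun_prop))
  filter_upwards [hc.continuousAt.eventually (isOpen_interior.mem_nhds h1)] with d' hd' t' ht'
  have := S.step hz (by linarith) (sub_nonneg.2 ht') (interior_subset hd')
  convert this using 3 <;> ring

theorem delays_eq_univ (S : OrderedOmega Φ C x ψ) {z : X} (hz : z ∈ omegaSet Φ x)
    (hns : ¬ Shadows (path Φ x) ψ z) (hne : ∃ r, ψ r z ≠ z) : S.delays z = univ := by
  refine IsClopen.eq_univ ⟨?_, ?_⟩ ?_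
  · refine isClosed_of_closure_subset fun d hd => ?_
    by_contra hnd
    exact hns (S.shadows_of_boundary hz hd hnd)
  · rw [isOpen_iff_mem_nhds]
    intro d hd
    obtain ⟨T, hT, h⟩ := S.delays_locally_uniform hz hns hd
    filter_upwards [h] with d' hd'
    exact ⟨T, hT, hd' T le_rfl⟩
  · obtain ⟨r, hr⟩ := hne
    have h1 : ψ r z - z ∈ interior C :=
      S.interior_orbitClosure hz (subset_closure ⟨r, rfl⟩) hr
    obtain ⟨u, hu, hlim⟩ := exists_times_of_mem_omegaSet (S.flow.maps r z hz)
    obtain ⟨n, hn, hn0⟩ := (((hlim.sub_const z).eventually (isOpen_interior.mem_nhds h1)).and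
      (hu.eventually_ge_atTop 0)).exists
    refine ⟨u n, u n, hn0, ?_⟩
    rw [sub_self, S.flow.zero z hz]
    exact interior_subset hn

theorem delays_uniform (S : OrderedOmega Φ C x ψ) {z : X} (hz : z ∈ omegaSet Φ x)
    (hns : ¬ Shadows (path Φ x) ψ z) (hne : ∃ r, ψ r z ≠ z) (p q : ℝ) :
    ∃ T ≥ 0, ∀ d ∈ Icc p q, ∀ t ≥ T, path Φ x t - ψ (t - d) z ∈ C := by
  have huniv := S.delays_eq_univ hz hns hne
  refine isCompact_Icc.induction_on
    (p := fun s => ∃ T ≥ 0, ∀ d ∈ s, ∀ t ≥ T, path Φ x t - ψ (t - d) z ∈ C)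
    ⟨0, le_rfl, by simp⟩ ?_ ?_ ?_
  · rintro s s' hss ⟨T, hT, h⟩
    exact ⟨T, hT, fun d hd => h d (hss hd)⟩
  · rintro s s' ⟨T, hT, h⟩ ⟨T', hT', h'⟩
    refine ⟨max T T', hT.trans (le_max_left _ _), ?_⟩
    rintro d (hd | hd) t ht
    · exact h d hd t ((le_max_left _ _).trans ht)
    · exact h' d hd t ((le_max_right _ _).trans ht)
  · intro d _
    obtain ⟨T, hT, h⟩ := S.delays_locally_uniform hz hns (huniv.symm.subset (mem_univ d))
    exact ⟨_, nhdsWithin_le_nhds h, T, hT, fun d' hd' => hd'⟩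

theorem parallel_of_ordered (S : OrderedOmega Φ C x ψ) {z : X} (hz : z ∈ omegaSet Φ x)
    (hns : ¬ Shadows (path Φ x) ψ z) {T : ℝ}
    (h : ∀ t ≥ T, ∀ s, path Φ x t - ψ s z ∈ C) : Parallel C (path Φ x) ψ z :=
  ⟨max T 0, fun t ht s => ⟨h t ((le_max_left _ _).trans ht) s, fun he =>
    hns (S.shadows_of_eq hz ((le_max_right _ _).trans ht) he)⟩⟩

theorem parallel_of_periodic (S : OrderedOmega Φ C x ψ) {z : X} (hz : z ∈ omegaSet Φ x)
    (hns : ¬ Shadows (path Φ x) ψ z) (hne : ∃ r, ψ r z ≠ z) {T : ℝ} (hT : 0 < T)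
    (hper : ψ T z = z) : Parallel C (path Φ x) ψ z := by
  obtain ⟨T₀, -, h⟩ := S.delays_uniform hz hns hne 0 T
  have hP : Function.Periodic (fun t => ψ t z) T := fun t => by
    show ψ (t + T) z = ψ t z
    rw [← S.flow.add _ _ z hz, hper]
  refine S.parallel_of_ordered hz hns (T := T₀) fun t ht s => ?_
  obtain ⟨r, hr, he⟩ := hP.exists_mem_Ico hT s (t - T)
  rw [show ψ s z = ψ r z from he]
  have := h (t - r) ⟨by linarith [hr.2], by linarith [hr.1]⟩ t ht
  rwa [sub_sub_cancel] at this

theorem parallel_of_not_recurrent (S : OrderedOmega Φ C x ψ) {z : X} (hz : z ∈ omegaSet Φ x)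
    (hns : ¬ Shadows (path Φ x) ψ z) (hne : ∃ r, ψ r z ≠ z)
    (hp : ¬ PosRec ψ z) (hn : ¬ PosRec (fun t => ψ (-t)) z) : Parallel C (path Φ x) ψ z := by
  have F := S.flow
  simp only [PosRec] at hp hn
  push Not at hp hn
  obtain ⟨η₁, hη₁, D₁, h₁⟩ := hp
  obtain ⟨η₂, hη₂, D₂, h₂⟩ := hn
  set D := max D₁ D₂
  set B := closure ((fun h => ψ h z) '' {h | D ≤ |h|}) with hB
  have hBsub : B ⊆ orbitClosure ψ z := closure_mono (image_subset_range _ _)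
  have hBc : IsCompact B := (S.isCompact_orbitClosure hz).of_isClosed_subset isClosed_closure hBsub
  have hfar : ∀ v ∈ B, v ≠ z := by
    have hcl : IsClosed {v | min η₁ η₂ ≤ ‖v - z‖} := isClosed_le continuous_const (by fun_prop)
    have : B ⊆ {v | min η₁ η₂ ≤ ‖v - z‖} := hcl.closure_subset_iff.2 (by
      rintro _ ⟨h, hh, rfl⟩
      rcases le_abs.1 (show D ≤ |h| from hh) with h' | h'
      · exact (min_le_left _ _).trans (h₁ h ((le_max_left _ _).trans h'))
      · have := h₂ (-h) ((le_max_right _ _).trans h')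
        rw [neg_neg] at this
        exact (min_le_right _ _).trans this)
    rintro v hv rfl
    have := this hv
    simp only [mem_ofPred_eq, sub_self, norm_zero] at this
    exact absurd this (not_le.2 (lt_min hη₁ hη₂))
  have hnear : ∀ᶠ u in 𝓝 z, ∀ v ∈ B, u - v ∈ C := by
    have : ∀ᶠ u in 𝓝 z, ∀ v ∈ B, v - u ∈ C := by
      refine hBc.eventually_forall_of_forall_eventually fun v hv => ?_
      have hc : Continuous fun p : X × X => p.2 - p.1 := by fun_prop
      have := (hc.continuousAt (x := (z, v))).eventually (isOpen_interior.mem_nhds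
        (S.interior_orbitClosure hz (hBsub hv) (hfar v hv)))
      exact this.mono fun p hp => interior_subset hp
    exact this.mono fun u hu v hv => S.symm (hu v hv)
  obtain ⟨u, hu, hlim⟩ := exists_times_of_mem_omegaSet hz
  obtain ⟨n, hn1, hn0⟩ := ((hlim.eventually hnear).and (hu.eventually_ge_atTop 0)).exists
  set t₁ := u n
  obtain ⟨T₀, -, h⟩ := S.delays_uniform hz hns hne (t₁ - D) (t₁ + D)
  refine S.parallel_of_ordered hz hns (T := max T₀ t₁) fun t ht s => ?_
  have ht0 := (le_max_left _ _).trans ht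
  have ht1 := (le_max_right _ _).trans ht
  rcases le_or_gt D |s - (t - t₁)| with hD | hD
  · have h1 := hn1 _ (subset_closure ⟨s - (t - t₁), hD, rfl⟩)
    have := S.step hz hn0 (sub_nonneg.2 ht1) h1
    convert this using 3 <;> ring
  · have hD' := abs_lt.1 hD
    have := h (t - s) ⟨by linarith [hD'.2], by linarith [hD'.1]⟩ t ht0
    rwa [sub_sub_cancel] at this

theorem ordered_of_parallel (S : OrderedOmega Φ C x ψ) {z y v : X}
    (hpar : Parallel C (path Φ x) ψ z) (hy : y ∈ omegaSet Φ x) (hv : v ∈ orbitClosure ψ z) :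
    y - v ∈ C := by
  obtain ⟨T, hT⟩ := hpar
  have : IsClosed {v | y - v ∈ C} := S.closed.preimage (by fun_prop)
  refine this.closure_subset_iff.2 ?_ hv
  rintro _ ⟨s, rfl⟩
  obtain ⟨u, hu, hlim⟩ := exists_times_of_mem_omegaSet hy
  refine S.closed.mem_of_tendsto (hlim.sub_const _) ?_
  filter_upwards [hu.eventually_ge_atTop T] with n hn
  exact (hT _ hn s).1

end OrderedOmega

theorem exists_projection {C : Set X} (hC : IsComplementedCone C 2) :
    ∃ P : X →L[ℝ] ℂ, ∀ v ∈ C, P v = 0 → v = 0 := by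
  obtain ⟨H, hcl, hrk, hZ⟩ := hC
  have := hcl
  have hfr : Module.finrank ℝ (X ⧸ H) = 2 := Module.finrank_eq_of_rank_eq (by exact_mod_cast hrk)
  have hfd : FiniteDimensional ℝ (X ⧸ H) := FiniteDimensional.of_finrank_pos (by omega)
  let e : (X ⧸ H) ≃L[ℝ] ℂ :=
    ContinuousLinearEquiv.ofFinrankEq (by rw [hfr, Complex.finrank_real_complex])
  refine ⟨(e : (X ⧸ H) →L[ℝ] ℂ).comp H.mkQL, fun v hv h => ?_⟩
  have h1 : H.mkQ v = 0 := e.map_eq_zero_iff.1 h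
  have h2 : v ∈ H := by simpa using h1
  have : v ∈ (H : Set X) ∩ C := ⟨h2, hv⟩
  rwa [hZ] at this

namespace CompactFlow

variable {K : Set X} {χ : ℝ → X → X}

theorem exists_gate (F : CompactFlow K χ) (P : X →L[ℝ] ℂ) {w : X} (hw : w ∈ K) {l : ℝ}
    (hl : 0 < l) (hinj : InjOn (fun t => P (χ t w)) (Icc (-l) l)) :
    ∃ s c, |s| < l ∧ IsGate (fun h => P (χ h (χ s w))) (-l - s) (l - s) c := by
  obtain ⟨s, c, hs, g⟩ := SolidPB.exists_gate
    (P.continuous.comp (F.continuous_orbit hw)) hl hinj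
  refine ⟨s, c, hs, ?_⟩
  convert g using 2 with h
  rw [F.add _ _ w hw, add_comm]; rfl

theorem not_posRec (F : CompactFlow K χ) (P : X →L[ℝ] ℂ) {z : X} (hz : z ∈ K)
    (hnp : ∀ r, r ≠ 0 → χ r z ≠ z)
    (huniq : ∀ s, ∀ u ∈ orbitClosure χ z, P u = P (χ s z) → u = χ s z) : ¬ PosRec χ z := by
  intro hrec
  have hcompact : IsCompact (orbitClosure χ z) := F.compact.of_isClosed_subset isClosed_closure
    (F.compact.isClosed.closure_subset_iff.2 (by rintro _ ⟨t, rfl⟩; exact F.maps t z hz))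
  have hmem : ∀ t, χ t z ∈ orbitClosure χ z := fun t => subset_closure ⟨t, rfl⟩
  have hinj : ∀ s t, P (χ s z) = P (χ t z) → s = t := fun s t h => by
    by_contra hne
    exact hnp (s - t) (sub_ne_zero.2 hne) ((F.eq_iff hz).1 (huniq t _ (hmem s) h))
  obtain ⟨s, c, hs, g⟩ := F.exists_gate P hz one_pos (fun s _ t _ h => hinj s t h)
  set w := χ s z with hw_def
  have hw : w ∈ K := F.maps s z hz
  have hsw : ∀ t, χ t w = χ (t + s) z := fun t => F.add t s z hz
  have hinjw : ∀ q t, P (χ q w) = P (χ t w) → q = t := fun q t h => by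
    rw [hsw, hsw] at h
    linarith [hinj _ _ h]
  have hrecw : PosRec χ w := fun η hη D => by
    obtain ⟨δ, hδ, hu⟩ := F.uniform |s| hη
    obtain ⟨d, hd, hdz⟩ := hrec δ hδ D
    refine ⟨d, hd, ?_⟩
    have := hu _ (F.maps d z hz) z hz hdz s le_rfl
    rwa [F.add _ _ z hz, add_comm, ← hsw] at this
  obtain ⟨ε, hε, hno⟩ := no_double_visit P F
    (F.asymp hw (K' := orbitClosure χ z) fun t => by rw [hsw]; exact hmem _) hcompact hw g
    (huniq s)
  obtain ⟨δ, hδ, hu⟩ := F.uniform 2 hε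
  obtain ⟨d, hd, hdw⟩ := hrecw δ hδ 3
  rw [abs_lt] at hs
  refine hno w hw 0 d (by linarith) (fun h _ => by simpa using hε.le) (fun h hh => ?_)
    (fun q _ t _ h => hinjw q t h) ⟨d + 3, fun t ht q hq h => ?_⟩ hrecw
  · rw [add_comm, ← F.add _ _ w hw]
    exact (hu _ (F.maps d w hw) w hw hdw h
      (abs_le.2 ⟨by linarith [hh.1], by linarith [hh.2]⟩)).le
  · have := hinjw _ _ h
    linarith [hq.2]

end CompactFlow

namespace OrderedOmega

variable {Φ : Semiflow X} {C : Set X} {x : X} {ψ : ℝ → X → X} {P : X →L[ℝ] ℂ}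

theorem eq_of_ordered (hP : ∀ v ∈ C, P v = 0 → v = 0) {u v : X} (h : u - v ∈ C)
    (he : P u = P v) : u = v :=
  sub_eq_zero.1 (hP _ h (by rw [map_sub, he, sub_self]))

theorem orbit_inj (S : OrderedOmega Φ C x ψ) (hP : ∀ v ∈ C, P v = 0 → v = 0) {z : X}
    (hz : z ∈ omegaSet Φ x) {s t : ℝ} (h : P (ψ s z) = P (ψ t z)) : ψ (s - t) z = z := by
  refine (S.flow.eq_iff hz).1 (eq_of_ordered hP ?_ h)
  have := S.ordered_orbit (s - t) (S.flow.maps t z hz)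
  rwa [S.flow.add _ _ z hz, sub_add_cancel] at this

theorem ordered_orbitClosure_shift (S : OrderedOmega Φ C x ψ) {z u : X} (hz : z ∈ omegaSet Φ x)
    (hu : u ∈ orbitClosure ψ z) (s : ℝ) : u - ψ s z ∈ C := by
  refine S.ordered_orbitClosure (S.flow.maps s z hz) ?_
  convert hu using 1
  unfold orbitClosure
  congr 1
  ext v
  constructor
  · rintro ⟨t, rfl⟩; exact ⟨t + s, (S.flow.add t s z hz).symm⟩
  · rintro ⟨t, rfl⟩; exact ⟨t - s, by simp only [S.flow.add _ _ z hz, sub_add_cancel]⟩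

theorem not_posRec (S : OrderedOmega Φ C x ψ) (hP : ∀ v ∈ C, P v = 0 → v = 0) {z : X}
    (hz : z ∈ omegaSet Φ x) (hnp : ∀ r, r ≠ 0 → ψ r z ≠ z) : ¬ PosRec ψ z :=
  S.flow.not_posRec P hz hnp fun s _ hu he =>
    eq_of_ordered hP (S.ordered_orbitClosure_shift hz hu s) he

theorem not_negRec (S : OrderedOmega Φ C x ψ) (hP : ∀ v ∈ C, P v = 0 → v = 0) {z : X}
    (hz : z ∈ omegaSet Φ x) (hnp : ∀ r, r ≠ 0 → ψ r z ≠ z) : ¬ PosRec (fun t => ψ (-t)) z := by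
  refine S.flow.reverse.not_posRec P hz (fun r hr => hnp (-r) (neg_ne_zero.2 hr))
    fun s u hu he => eq_of_ordered hP (S.ordered_orbitClosure_shift hz ?_ (-s)) he
  refine closure_mono ?_ hu
  rintro _ ⟨t, rfl⟩
  exact ⟨-t, rfl⟩

theorem parallel_of_nonperiodic (S : OrderedOmega Φ C x ψ) (hP : ∀ v ∈ C, P v = 0 → v = 0) {z : X}
    (hz : z ∈ omegaSet Φ x) (hnp : ∀ r, r ≠ 0 → ψ r z ≠ z) : Parallel C (path Φ x) ψ z :=
  S.parallel_of_not_recurrent hz (fun hs => S.not_posRec hP hz hnp (hs.near hz))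
    ⟨1, hnp 1 one_ne_zero⟩ (S.not_posRec hP hz hnp) (S.not_negRec hP hz hnp)

theorem fixed_of_visits (S : OrderedOmega Φ C x ψ) (hP : ∀ v ∈ C, P v = 0 → v = 0) {z w : X}
    (hz : z ∈ omegaSet Φ x) (hnp : ∀ r, r ≠ 0 → ψ r z ≠ z)
    (hvis : ∀ ε > 0, ∀ D, ∃ s₁ s₂, s₁ + D ≤ s₂ ∧ ‖ψ s₁ z - w‖ < ε ∧ ‖ψ s₂ z - w‖ < ε) :
    ∀ r, ψ r w = w := by
  by_contra! hne
  have F := S.flow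
  have hw' : w ∈ orbitClosure ψ z := Metric.mem_closure_iff.2 fun ε hε => by
    obtain ⟨s₁, -, -, h, -⟩ := hvis ε hε 0
    exact ⟨_, ⟨s₁, rfl⟩, by rwa [dist_comm, dist_eq_norm]⟩
  have hw := S.orbitClosure_subset hz hw'
  have hpar := S.parallel_of_nonperiodic hP hz hnp
  obtain ⟨T, hT, hno⟩ := F.exists_no_small_period hw hne
  have hinj : InjOn (fun t => P (ψ t w)) (Icc (-(T / 4)) (T / 4)) := fun s hs t ht h => by
    by_contra hst
    refine hno (s - t) (abs_pos.2 (sub_ne_zero.2 hst)) ?_ (S.orbit_inj hP hw h)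
    exact abs_lt.2 ⟨by linarith [hs.1, ht.2], by linarith [hs.2, ht.1]⟩
  obtain ⟨s, c, hs, g⟩ := F.exists_gate P hw (by positivity) hinj
  rw [abs_lt] at hs
  set v := ψ s w with hv_def
  have hv' : v ∈ orbitClosure ψ z := by
    obtain ⟨u, hu, hlim⟩ := mem_closure_iff_seq_limit.1 hw'
    choose q hq using hu
    have hK : ∀ n, u n ∈ omegaSet Φ x := fun n => by rw [← hq n]; exact F.maps _ z hz
    have h1 : Tendsto (fun n => ψ s (u n)) atTop (𝓝 v) :=
      (F.continuousOn_map s w hw).tendsto.comp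
        (tendsto_nhdsWithin_iff.2 ⟨hlim, Eventually.of_forall hK⟩)
    refine mem_closure_of_tendsto h1 (Eventually.of_forall fun n => ⟨s + q n, ?_⟩)
    rw [← hq n]
    exact (F.add _ _ z hz).symm
  obtain ⟨ε, hε, hnd⟩ := no_double_visit P F S.asymp F.compact (F.maps s w hw) g
    fun u hu he => eq_of_ordered hP (S.ordered_of_parallel hpar hu hv') he
  obtain ⟨δ, hδ, hu⟩ := F.uniform (T / 4) hε
  obtain ⟨s₁, s₂, h12, h1, h2⟩ := hvis δ hδ T
  obtain ⟨t₀, hpar⟩ := hpar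
  have hclose : ∀ q, ‖ψ q z - w‖ < δ → ∀ h ∈ Icc (-(T / 4) - s) (T / 4 - s),
      ‖ψ (q + s + h) z - ψ h v‖ ≤ ε := fun q hq h hh => by
    have := hu _ (F.maps q z hz) w hw hq (h + s)
      (abs_le.2 ⟨by linarith [hh.1], by linarith [hh.2]⟩)
    rw [F.add _ _ z hz, ← F.add _ _ w hw, show h + s + q = q + s + h by ring] at this
    exact this.le
  refine hnd z hz (s₁ + s) (s₂ + s) (by linarith) (hclose s₁ h1) (hclose s₂ h2)
    (fun q _ t _ h => ?_) ⟨t₀, fun t ht q _ h => ?_⟩ fun η hη D => mem_omegaSet.1 hz η hη D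
  · by_contra hqt
    exact hnp _ (sub_ne_zero.2 hqt) (S.orbit_inj hP hz h)
  · exact (hpar t ht q).2 (eq_of_ordered hP (hpar t ht q).1 h)

/-- A periodic orbit that is not the whole limit set is not isolated in it. -/
theorem exists_near_periodic (S : OrderedOmega Φ C x ψ) {w u : X} (hw : w ∈ omegaSet Φ x)
    {T : ℝ} (hT : 0 < T) (hper : ψ T w = w) (hu : u ∈ omegaSet Φ x) (hout : ∀ s, u ≠ ψ s w)
    {δ : ℝ} (hδ : 0 < δ) :
    ∃ y ∈ omegaSet Φ x, (∀ s, y ≠ ψ s w) ∧ ‖y - w‖ < δ := by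
  have F := S.flow
  have hP := F.map_periodic hw hper
  set γ := range fun s => ψ s w with hγ
  have hγc : IsCompact γ := hP.compact_of_continuous hT.ne' (F.continuous_orbit hw)
  have hγne : γ.Nonempty := range_nonempty _
  have huγ : u ∉ γ := by rintro ⟨s, hs⟩; exact hout s hs.symm
  have hpos : 0 < infDist u γ := (hγc.isClosed.notMem_iff_infDist_pos hγne).1 huγ
  obtain ⟨δ', hδ', huni⟩ := F.uniform T hδ
  set e := min (infDist u γ / 2) (δ' / 2) with he
  have hepos : 0 < e := by positivity
  have he1 : e ≤ infDist u γ / 2 := min_le_left _ _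
  have he2 : e ≤ δ' / 2 := min_le_right _ _
  have hcont : Continuous fun t => infDist (path Φ x t) γ :=
    (continuous_infDist_pt γ).comp (continuous_path Φ x)
  have hfreq : ∀ D : ℝ, ∃ t ≥ D, infDist (path Φ x t) γ = e := by
    intro D
    obtain ⟨t₁, ht₁, h₁⟩ := mem_omegaSet.1 hw e hepos D
    obtain ⟨t₂, ht₂, h₂⟩ := mem_omegaSet.1 hu (infDist u γ / 2) (by positivity) t₁
    have h1 : infDist (path Φ x t₁) γ ≤ e :=
      (infDist_le_dist_of_mem (show w ∈ γ from ⟨0, F.zero w hw⟩)).trans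
        (by rw [dist_eq_norm]; exact h₁.le)
    have h2 : e ≤ infDist (path Φ x t₂) γ := by
      have := infDist_le_infDist_add_dist (s := γ) (x := u) (y := path Φ x t₂)
      rw [dist_comm, dist_eq_norm] at this
      linarith
    obtain ⟨t, ht, h⟩ := intermediate_value_Icc ht₂ hcont.continuousOn ⟨h1, h2⟩
    exact ⟨t, ht₁.trans ht.1, h⟩
  obtain ⟨q, hq, hqe⟩ := exists_times_of_frequently hfreq
  obtain ⟨y, hy, φ, -, hlim⟩ := exists_omega_limit S.pre hq
  have hye : infDist y γ = e := by
    have h1 := ((continuous_infDist_pt γ).tendsto y).comp hlim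
    refine tendsto_nhds_unique h1 ?_
    simp only [Function.comp_def, hqe]
    exact tendsto_const_nhds
  obtain ⟨_, ⟨s, rfl⟩, hs⟩ := (infDist_lt_iff (r := δ') hγne).1 (by linarith : infDist y γ < δ')
  obtain ⟨r, hr, hrs⟩ := hP.exists_mem_Ico₀ hT s
  have hrs' : ψ s w = ψ r w := hrs
  simp only [hrs', dist_eq_norm] at hs
  refine ⟨ψ (-r) y, F.maps _ y hy, fun s' hs' => ?_, ?_⟩
  · have hyγ : y ∈ γ := ⟨r + s', by
      show ψ (r + s') w = y
      rw [← F.add _ _ w hw, ← hs', F.add _ _ y hy, add_neg_cancel, F.zero y hy]⟩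
    rw [infDist_zero_of_mem hyγ] at hye
    exact hepos.ne hye
  · have := huni y hy _ (F.maps r w hw) hs (-r) (by rw [abs_neg, abs_of_nonneg hr.1]; exact hr.2.le)
    rwa [F.add _ _ w hw, neg_add_cancel, F.zero w hw] at this

/-- Orbits near a periodic orbit are periodic, with a nearby period. -/
theorem exists_near_period (S : OrderedOmega Φ C x ψ) (hP : ∀ v ∈ C, P v = 0 → v = 0)
    (hpar : ∀ y ∈ omegaSet Φ x, (∃ r, ψ r y ≠ y) → Parallel C (path Φ x) ψ y)
    {w : X} (hw : w ∈ omegaSet Φ x) {T : ℝ} (hT : 0 < T) (hper : ψ T w = w)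
    (hmin : ∀ r, 0 < r → r < T → ψ r w ≠ w) {a b : ℝ} {c : ℂ}
    (g : IsGate (fun h => P (ψ h w)) a b c) (hab : b - a ≤ T / 8) {ρ : ℝ} (hρ : 0 < ρ) :
    ∃ δ > 0, ∀ y ∈ omegaSet Φ x, ‖y - w‖ < δ →
      Parallel C (path Φ x) ψ y ∧ ∃ p, T / 2 ≤ p ∧ p ≤ T + ρ ∧ ψ p y = y := by
  have F := S.flow
  have ha := g.neg
  have hb := g.pos
  have hhalf : ψ (T / 2) w ≠ w := hmin _ (by positivity) (by linarith)
  have hwpar := hpar w hw ⟨_, hhalf⟩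
  have hwcl : w ∈ orbitClosure ψ w := subset_closure ⟨0, F.zero w hw⟩
  obtain ⟨ε, hε, hnd⟩ := no_double_visit P F S.asymp F.compact hw g
    fun u hu he => eq_of_ordered hP (S.ordered_of_parallel hwpar hu hwcl) he
  obtain ⟨m, hm, hmle⟩ := exists_lower_bound
    (S := Icc (T / 8) (T / 2) ∪ Icc (T + ρ) (T + T / 8)) (f := fun s => ‖ψ s w - w‖)
    (isCompact_Icc.union isCompact_Icc)
    (((F.continuous_orbit hw).sub continuous_const).norm.continuousOn) (by
      rintro s (hs | hs) <;> refine norm_pos_iff.2 (sub_ne_zero.2 fun he => ?_)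
      · exact hmin s (by linarith [hs.1]) (by linarith [hs.2]) he
      · refine hmin (s - T) (by linarith [hs.1]) (by linarith [hs.2]) ?_
        rw [← F.eq_iff hw, he, hper])
  obtain ⟨δ₀, hδ₀, hu⟩ := F.uniform (2 * T) (ε := min ε (m / 2)) (by positivity)
  refine ⟨min δ₀ (m / 2), by positivity, fun y hy hyw => ?_⟩
  have hyw1 := hyw.trans_le (min_le_left _ _)
  have hyw2 := hyw.trans_le (min_le_right _ _)
  have hnot : ∀ q ∈ Icc (T / 8) (T / 2) ∪ Icc (T + ρ) (T + T / 8), ψ q y ≠ y := by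
    intro q hq he
    have h1 := hmle q hq
    have h2 := (hu y hy w hw hyw1 q (by
      rcases hq with hq | hq <;> exact abs_le.2 ⟨by linarith [hq.1], by linarith [hq.2]⟩)).trans_le
        (min_le_right _ _)
    rw [he] at h2
    have e : ψ q w - w = (y - w) - (y - ψ q w) := by abel
    have h3 := norm_sub_le (y - w) (y - ψ q w)
    rw [← e] at h3
    linarith
  have hypar := hpar y hy ⟨_, hnot (T / 2) (Or.inl ⟨by linarith, le_rfl⟩)⟩
  refine ⟨hypar, ?_⟩
  have hclose : ∀ h ∈ Icc a b, ∀ s, 0 ≤ s → s ≤ T → ‖ψ (s + h) y - ψ (s + h) w‖ ≤ ε :=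
    fun h hh s hs0 hs => ((hu y hy w hw hyw1 (s + h)
      (abs_le.2 ⟨by linarith [hh.1], by linarith [hh.2]⟩)).trans_le (min_le_left _ _)).le
  have hninj : ¬ InjOn (fun s => P (ψ s y)) (Icc (0 + a) (T + b)) := fun hinj => by
    obtain ⟨t₀, ht₀⟩ := hypar
    refine hnd y hy 0 T (by linarith) (fun h hh => ?_) (fun h hh => ?_) hinj
      ⟨t₀, fun t ht s _ he => (ht₀ t ht s).2 (eq_of_ordered hP (ht₀ t ht s).1 he)⟩
      fun η hη D => mem_omegaSet.1 hy η hη D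
    · have := hclose h hh 0 le_rfl hT.le
      rwa [zero_add] at this ⊢
    · have := hclose h hh T hT.le le_rfl
      rwa [show ψ (T + h) w = ψ h w by rw [add_comm, ← F.add _ _ w hw, hper]] at this
  have hperiod : ∃ p, 0 < p ∧ p ≤ T + T / 8 ∧ ψ p y = y := by
    simp only [InjOn] at hninj
    push Not at hninj
    obtain ⟨s, hs, t, ht, he, hne⟩ := hninj
    rw [zero_add] at hs ht
    have h1 := S.orbit_inj hP hy he
    have h2 := S.orbit_inj hP hy he.symm
    rcases lt_or_gt_of_ne hne with h | h
    · exact ⟨t - s, by linarith, by linarith [hs.1, ht.2], h2⟩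
    · exact ⟨s - t, by linarith, by linarith [hs.2, ht.1], h1⟩
  obtain ⟨p, hp0, hp, hpy⟩ := hperiod
  have hbig : T / 8 ≤ p := by
    by_contra! hlt
    set k := ⌈T / 8 / p⌉₊
    have h1 : T / 8 ≤ k * p := by
      have := Nat.le_ceil (T / 8 / p)
      rwa [div_le_iff₀ hp0] at this
    have h2 : k * p < T / 8 + p := by
      have := Nat.ceil_lt_add_one (a := T / 8 / p) (by positivity)
      have := mul_lt_mul_of_pos_right this hp0
      rwa [add_mul, div_mul_cancel₀ _ hp0.ne', one_mul] at this
    refine hnot (k * p) (Or.inl ⟨h1, by linarith⟩) ?_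
    have := (F.periods hy).nsmul_mem hpy k
    rwa [nsmul_eq_mul, F.mem_periods] at this
  refine ⟨p, ?_, ?_, hpy⟩
  · by_contra! h
    exact hnot p (Or.inl ⟨hbig, h.le⟩) hpy
  · by_contra! h
    exact hnot p (Or.inr ⟨h.le, hp⟩) hpy

/-- The rotation of a periodic orbit, seen from another point of the limit set, does not depend
on that point. -/
theorem rot_periodic_eq (S : OrderedOmega Φ C x ψ) (hP : ∀ v ∈ C, P v = 0 → v = 0) {y v v' : X}
    (hy : y ∈ omegaSet Φ x) (hpar : Parallel C (path Φ x) ψ y) {p : ℝ} (hper : ψ p y = y)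
    (hv : v ∈ omegaSet Φ x) (hv' : v' ∈ omegaSet Φ x) (hne : ∀ s, v ≠ ψ s y)
    (hne' : ∀ s, v' ≠ ψ s y) (a : ℝ) :
    rot (fun s => P v - P (ψ s y)) a (p + a) = rot (fun s => P v' - P (ψ s y)) a (p + a) := by
  have F := S.flow
  obtain ⟨T, hT⟩ := id hpar
  have hcy := F.continuous_orbit hy
  have hcx := continuous_path Φ x
  set R : ℝ → ℝ := fun t => rot (fun s => P (path Φ x t) - P (ψ s y)) a (p + a) with hR
  have hconst : ∀ t ≥ T, ∀ t' ≥ T, R t = R t' := by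
    intro t ht t' ht'
    have h0 : ∀ s, ∀ q ∈ uIcc t t', P (path Φ x q) - P (ψ s y) ≠ 0 := fun s q hq h => by
      have hq' : T ≤ q := (le_min ht ht').trans hq.1
      exact (hT q hq' s).2 (eq_of_ordered hP (hT q hq' s).1 (sub_eq_zero.1 h))
    have := rot_rect (f := fun s q => P (path Φ x q) - P (ψ s y)) (a := a) (b := p + a)
      (c := t) (d := t') (by fun_prop) (fun s _ q hq => h0 s q hq)
    rw [show ψ (p + a) y = ψ a y by rw [add_comm, ← F.add _ _ y hy, hper]] at this
    simp only [hR]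
    linarith
  have happ : ∀ v ∈ omegaSet Φ x, (∀ s, v ≠ ψ s y) → ∀ η > 0, η ≤ 1 / 2 →
      |R T - rot (fun s => P v - P (ψ s y)) a (p + a)| ≤ 3 * η := by
    intro v hv hne η hη hη2
    have h0 : ∀ s, P v - P (ψ s y) ≠ 0 := fun s h =>
      hne s (eq_of_ordered hP (S.ordered_of_parallel hpar hv (subset_closure ⟨s, rfl⟩))
        (sub_eq_zero.1 h))
    obtain ⟨m, hm, hmle⟩ := exists_lower_bound (S := uIcc a (p + a))
      (f := fun s => ‖P v - P (ψ s y)‖) isCompact_uIcc (by fun_prop)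
      fun s _ => norm_pos_iff.2 (h0 s)
    obtain ⟨t, ht, htv⟩ := mem_omegaSet.1 hv (η * m / (‖P‖ + 1)) (by positivity) T
    rw [hconst T le_rfl t ht]
    refine rot_near (by fun_prop) (by fun_prop) hη2 (fun s _ => h0 s) fun s hs => ?_
    rw [sub_sub_sub_cancel_right]
    have h1 := norm_map_sub_le P (path Φ x t) v
    rw [lt_div_iff₀ (by positivity)] at htv
    have h2 := mul_le_mul_of_nonneg_left (hmle s hs) hη.le
    linarith
  refine eq_of_abs_sub_le_all fun ε hε => ?_
  have h1 := happ v hv hne (min (ε / 6) (1 / 2)) (by positivity) (min_le_right _ _)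
  have h2 := happ v' hv' hne' (min (ε / 6) (1 / 2)) (by positivity) (min_le_right _ _)
  have h3 := min_le_left (ε / 6) (1 / 2)
  rw [abs_le] at h1 h2 ⊢
  constructor <;> linarith

/-- Of three nearby parallel periodic orbits none is between the others at the gate. -/
theorem no_middle_orbit (S : OrderedOmega Φ C x ψ) (hP : ∀ v ∈ C, P v = 0 → v = 0)
    {w : X} (hw : w ∈ omegaSet Φ x) {T : ℝ} (hT : 0 < T)
    (hmin : ∀ r, 0 < r → r < T → ψ r w ≠ w) {a b : ℝ} {c : ℂ}
    (g : IsGate (fun h => P (ψ h w)) a b c) (hab : b - a ≤ T / 8) :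
    ∃ ε > 0, ∀ y ∈ omegaSet Φ x, ∀ u ∈ omegaSet Φ x, ∀ v ∈ omegaSet Φ x,
      Parallel C (path Φ x) ψ y →
      Parallel C (path Φ x) ψ u → Parallel C (path Φ x) ψ v →
      (∃ p, T / 2 ≤ p ∧ p ≤ T + -a / 2 ∧ ψ p y = y) →
      (∀ h, |h| ≤ 2 * T → ‖ψ h y - ψ h w‖ < ε) → (∀ h, |h| ≤ 2 * T → ‖ψ h u - ψ h w‖ < ε) →
      (∀ h, |h| ≤ 2 * T → ‖ψ h v - ψ h w‖ < ε) →
      (∀ s, u ≠ ψ s y) → (∀ s, v ≠ ψ s y) →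
      height a b c (fun h => P (ψ h u)) ≤ height a b c (fun h => P (ψ h y)) →
      height a b c (fun h => P (ψ h y)) ≤ height a b c (fun h => P (ψ h v)) → False := by
  have F := S.flow
  have ha := g.neg
  have hb := g.pos
  have hcw := F.continuous_orbit hw
  obtain ⟨κ₀, κ₁, hκ, hκε⟩ := g.exists_consts
  obtain ⟨ε₁, hε₁, hk⟩ := hκε 1 one_pos
  have hq0 : ∀ s ∈ Icc b (T + a / 2), P w - P (ψ s w) ≠ 0 := fun s hs h => by
    refine hmin s (by linarith [hs.1]) (by linarith [hs.2]) ?_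
    have h1 : P (ψ s w) = P (ψ 0 w) := by rw [F.zero w hw]; exact (sub_eq_zero.1 h).symm
    have := S.orbit_inj hP hw h1
    rwa [sub_zero] at this
  obtain ⟨m, hm, hmle⟩ := exists_lower_bound (S := Icc b (T + a / 2))
    (f := fun s => ‖P w - P (ψ s w)‖) isCompact_Icc (by fun_prop)
    fun s hs => norm_pos_iff.2 (hq0 s hs)
  set M := ‖P‖ + 1 with hM
  have hMpos : 0 < M := by positivity
  refine ⟨min ε₁ (m / 20) / M, by positivity, fun y hy u hu v hv hpy hpu hpv ⟨p, hp1, hp2, hpp⟩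
    hyw huw hvw huy hvy hle₁ hle₂ => ?_⟩
  have hbound : ∀ y', (∀ h, |h| ≤ 2 * T → ‖ψ h y' - ψ h w‖ < min ε₁ (m / 20) / M) →
      ∀ h, |h| ≤ 2 * T → ‖P (ψ h y') - P (ψ h w)‖ ≤ min ε₁ (m / 20) := fun y' h' h hh => by
    have h1 := h' h hh
    rw [lt_div_iff₀ hMpos, mul_comm] at h1
    exact (norm_map_sub_le P _ _).trans h1.le
  have hcy := F.continuous_orbit hy
  -- the contribution of the gate to the rotation of `y` seen from a parallel orbit
  have hgate : ∀ u ∈ omegaSet Φ x, (∀ h, |h| ≤ 2 * T → ‖ψ h u - ψ h w‖ < min ε₁ (m / 20) / M) →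
      (∀ s, u ≠ ψ s y) →
      |rot (fun s => P u - P (ψ s y)) a (p + a) - rot (fun s => P u - P (ψ s y)) a b -
        rot (fun s => P w - P (ψ s w)) b (p + a)| ≤ 3 * (1 / 10) := by
    intro u hu huw huy
    have h0 : ∀ s, P u - P (ψ s y) ≠ 0 := fun s h =>
      huy s (eq_of_ordered hP (S.ordered_of_parallel hpy hu (subset_closure ⟨s, rfl⟩))
        (sub_eq_zero.1 h))
    have hbp : b ≤ p + a := by linarith
    rw [← rot_add (b := b) (by fun_prop) (fun s _ => h0 s)
      (by rw [uIcc_of_le (by linarith)]; exact ⟨by linarith, hbp⟩), add_sub_cancel_left]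
    have hsub : ∀ s ∈ uIcc b (p + a), s ∈ Icc b (T + a / 2) := fun s hs => by
      rw [uIcc_of_le hbp] at hs
      exact ⟨hs.1, by linarith [hs.2]⟩
    refine rot_near (by fun_prop) (by fun_prop) (by norm_num) (fun s hs => hq0 s (hsub s hs))
      fun s hs => ?_
    have hs' := hsub s hs
    have h1 := (hbound u huw 0 (by rw [abs_zero]; positivity)).trans (min_le_right _ _)
    rw [F.zero u hu, F.zero w hw] at h1
    have h2 := (hbound y hyw s (abs_le.2 ⟨by linarith [hs'.1], by linarith [hs'.2]⟩)).trans
      (min_le_right _ _)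
    have h3 := hmle s hs'
    have e : P u - P (ψ s y) - (P w - P (ψ s w)) = (P u - P w) - (P (ψ s y) - P (ψ s w)) := by
      ring
    rw [e]
    refine (norm_sub_le _ _).trans ?_
    linarith
  have hclose : ∀ y', (∀ h, |h| ≤ 2 * T → ‖ψ h y' - ψ h w‖ < min ε₁ (m / 20) / M) →
      CloseOn a b ε₁ (fun h => P (ψ h y')) (fun h => P (ψ h w)) := fun y' h' h hh =>
    (hbound y' h' h (abs_le.2 ⟨by linarith [hh.1], by linarith [hh.2]⟩)).trans (min_le_left _ _)
  have hdisj : ∀ u ∈ omegaSet Φ x, (∀ s, u ≠ ψ s y) →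
      ArcsDisjoint a b (fun h => P (ψ h y)) (fun h => P (ψ h u)) := by
    intro u hu huy s _ t _ h
    have h1 : ψ t u = ψ s y := eq_of_ordered hP (S.ordered_of_parallel hpy (F.maps t u hu)
      (subset_closure ⟨s, rfl⟩)) h.symm
    refine huy (-t + s) ?_
    rw [← F.add _ _ y hy, ← h1, F.add _ _ u hu, neg_add_cancel, F.zero u hu]
  have h1 := (hk _ _ (by fun_prop) (P.continuous.comp (F.continuous_orbit hu)) (hclose y hyw)
    (hclose u huw) (hdisj u hu huy)).1 hle₁
  have h2 := (hk _ _ (by fun_prop) (P.continuous.comp (F.continuous_orbit hv)) (hclose y hyw)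
    (hclose v hvw) (hdisj v hv hvy)).2 hle₂
  simp only [Function.comp_apply, F.zero u hu, F.zero v hv] at h1 h2
  have h3 := hgate u hu huw huy
  have h4 := hgate v hv hvw hvy
  rw [S.rot_periodic_eq hP hy hpy hpp hu hv huy hvy a] at h3
  rw [abs_le] at h1 h2 h3 h4
  rcases le_abs.1 hκ with h | h <;> linarith

theorem no_periodic (S : OrderedOmega Φ C x ψ) (hP : ∀ v ∈ C, P v = 0 → v = 0)
    (hpar : ∀ y ∈ omegaSet Φ x, (∃ r, ψ r y ≠ y) → Parallel C (path Φ x) ψ y)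
    {z u : X} (hz : z ∈ omegaSet Φ x) (hne : ∃ r, ψ r z ≠ z) {T : ℝ} (hT : 0 < T)
    (hper : ψ T z = z) (hu : u ∈ omegaSet Φ x) (hout : ∀ s, u ≠ ψ s z) : False := by
  have F := S.flow
  obtain ⟨T, hT, hper, hmin⟩ := F.exists_minimal_period hz hne hT hper
  have hinj : InjOn (fun t => P (ψ t z)) (Icc (-(T / 16)) (T / 16)) := fun s hs t ht h => by
    rcases lt_trichotomy s t with hst | hst | hst
    · exact absurd (S.orbit_inj hP hz h.symm)
        (hmin _ (by linarith) (by linarith [hs.1, ht.2]))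
    · exact hst
    · exact absurd (S.orbit_inj hP hz h) (hmin _ (by linarith) (by linarith [hs.2, ht.1]))
  obtain ⟨s, c, hs, g⟩ := F.exists_gate P hz (by positivity) hinj
  set w := ψ s z with hw_def
  set a := -(T / 16) - s
  set b := T / 16 - s
  have hab : b - a ≤ T / 8 := by simp only [a, b]; linarith
  have hw : w ∈ omegaSet Φ x := F.maps s z hz
  have hwz : ∀ r, ψ r w = w ↔ ψ r z = z := fun r => by
    rw [hw_def, F.add _ _ z hz, F.eq_iff hz, add_sub_cancel_right]
  have hperw := (hwz T).2 hper
  have hminw : ∀ r, 0 < r → r < T → ψ r w ≠ w := fun r h1 h2 h => hmin r h1 h2 ((hwz r).1 h)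
  have houtw : ∀ r, u ≠ ψ r w := fun r h => hout (r + s) (by rw [h, hw_def, F.add _ _ z hz])
  have hwpar := hpar w hw ⟨T / 2, hminw _ (by positivity) (by linarith)⟩
  have ha := g.neg
  obtain ⟨δ₁, hδ₁, hnear⟩ := S.exists_near_period hP hpar hw hT hperw hminw g hab
    (ρ := -a / 2) (by linarith)
  obtain ⟨ε, hε, hmid⟩ := S.no_middle_orbit hP hw hT hminw g hab
  obtain ⟨δ₂, hδ₂, huni⟩ := F.uniform (2 * T) hε
  obtain ⟨y₁, hy₁, hy₁w, hy₁d⟩ := S.exists_near_periodic hw hT hperw hu houtw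
    (lt_min hδ₁ hδ₂)
  obtain ⟨hpar₁, p, hp1, hp2, hpp⟩ := hnear y₁ hy₁ (hy₁d.trans_le (min_le_left _ _))
  have hsymm : ∀ {u v : X}, u ∈ omegaSet Φ x → v ∈ omegaSet Φ x → (∀ s, u ≠ ψ s v) →
      ∀ s, v ≠ ψ s u := fun {u v} hu hv h s he => h (-s) (by
    rw [he, F.add _ _ u hu, neg_add_cancel, F.zero u hu])
  have hwy₁ := hsymm hy₁ hw hy₁w
  obtain ⟨m, hm, hmle⟩ := exists_lower_bound (S := Icc 0 p) (f := fun r => ‖ψ r y₁ - w‖)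
    isCompact_Icc (((F.continuous_orbit hy₁).sub continuous_const).norm.continuousOn)
    fun r _ => norm_pos_iff.2 (sub_ne_zero.2 (hwy₁ r).symm)
  obtain ⟨y₂, hy₂, hy₂w, hy₂d⟩ := S.exists_near_periodic hw hT hperw hu houtw
    (lt_min (lt_min hδ₁ hδ₂) hm)
  have hy₂d' := hy₂d.trans_le (min_le_left _ _)
  obtain ⟨hpar₂, hper₂⟩ := hnear y₂ hy₂ (hy₂d'.trans_le (min_le_left _ _))
  have hy₂₁ : ∀ r, y₂ ≠ ψ r y₁ := fun r hr => by
    obtain ⟨q, hq, hqr⟩ := (F.map_periodic hy₁ hpp).exists_mem_Ico₀ (by linarith) r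
    have hqr' : ψ r y₁ = ψ q y₁ := hqr
    have := hmle q ⟨hq.1, hq.2.le⟩
    rw [← hqr', ← hr] at this
    exact absurd (hy₂d.trans_le (min_le_right _ _)) (not_lt.2 this)
  have hy₁₂ := hsymm hy₂ hy₁ hy₂₁
  have hwy₂ := hsymm hy₂ hw hy₂w
  have hper₁ : ∃ p, T / 2 ≤ p ∧ p ≤ T + -a / 2 ∧ ψ p y₁ = y₁ := ⟨p, hp1, hp2, hpp⟩
  have hper₃ : ∃ p, T / 2 ≤ p ∧ p ≤ T + -a / 2 ∧ ψ p w = w := ⟨T, by linarith, by linarith, hperw⟩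
  have hc₁ := huni y₁ hy₁ w hw (hy₁d.trans_le (min_le_right _ _))
  have hc₂ := huni y₂ hy₂ w hw (hy₂d'.trans_le (min_le_right _ _))
  have hc₃ : ∀ h, |h| ≤ 2 * T → ‖ψ h w - ψ h w‖ < ε := fun h _ => by simpa using hε
  have M₁ := fun u hu v hv pu pv => hmid y₁ hy₁ u hu v hv hpar₁ pu pv hper₁ hc₁
  have M₂ := fun u hu v hv pu pv => hmid y₂ hy₂ u hu v hv hpar₂ pu pv hper₂ hc₂
  have M₃ := fun u hu v hv pu pv => hmid w hw u hu v hv hwpar pu pv hper₃ hc₃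
  rcases le_total (height a b c fun h => P (ψ h y₁)) (height a b c fun h => P (ψ h y₂))
    with h12 | h12 <;>
  rcases le_total (height a b c fun h => P (ψ h y₂)) (height a b c fun h => P (ψ h w))
    with h23 | h23 <;>
  rcases le_total (height a b c fun h => P (ψ h y₁)) (height a b c fun h => P (ψ h w))
    with h13 | h13
  · exact M₂ y₁ hy₁ w hw hpar₁ hwpar hc₁ hc₃ hy₁₂ hwy₂ h12 h23
  · exact M₂ y₁ hy₁ w hw hpar₁ hwpar hc₁ hc₃ hy₁₂ hwy₂ h12 h23
  · exact M₃ y₁ hy₁ y₂ hy₂ hpar₁ hpar₂ hc₁ hc₂ hy₁w hy₂w h13 h23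
  · exact M₁ w hw y₂ hy₂ hwpar hpar₂ hc₃ hc₂ hwy₁ hy₂₁ h13 h12
  · exact M₁ y₂ hy₂ w hw hpar₂ hwpar hc₂ hc₃ hy₂₁ hwy₁ h12 h13
  · exact M₃ y₂ hy₂ y₁ hy₁ hpar₂ hpar₁ hc₂ hc₁ hy₂w hy₁w h23 h13
  · exact M₂ w hw y₁ hy₁ hwpar hpar₁ hc₃ hc₁ hwy₂ hy₁₂ h23 h12
  · exact M₂ w hw y₁ hy₁ hwpar hpar₁ hc₃ hc₁ hwy₂ hy₁₂ h23 h12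

theorem fixed_or_periodic_orbit (S : OrderedOmega Φ C x ψ) (hP : ∀ v ∈ C, P v = 0 → v = 0) :
    (∃ z ∈ omegaSet Φ x, ∃ T, 0 < T ∧ ψ T z = z ∧ (∃ r, ψ r z ≠ z) ∧
      ∀ u ∈ omegaSet Φ x, ∃ s, u = ψ s z) ∨
    ∀ z ∈ omegaSet Φ x, ∀ w,
      (∀ ε > 0, ∀ D, ∃ s₁ s₂, s₁ + D ≤ s₂ ∧ ‖ψ s₁ z - w‖ < ε ∧ ‖ψ s₂ z - w‖ < ε) →
      ∀ r, ψ r w = w := by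
  refine or_iff_not_imp_left.2 fun hno => ?_
  push Not at hno
  have F := S.flow
  have hpos : ∀ {z}, z ∈ omegaSet Φ x → ∀ {T}, T ≠ 0 → ψ T z = z → ∃ T, 0 < T ∧ ψ T z = z := by
    intro z hz T hT h
    rcases lt_or_gt_of_ne hT with h0 | h0
    · exact ⟨-T, by linarith, (F.periods hz).neg_mem h⟩
    · exact ⟨T, h0, h⟩
  have hns : ∀ {z}, z ∈ omegaSet Φ x → ∀ {T}, 0 < T → ψ T z = z → (∃ r, ψ r z ≠ z) →
      ¬ Shadows (path Φ x) ψ z := by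
    intro z hz T hT hper hne hsh
    obtain ⟨u, hu, hout⟩ := hno z hz T hT hper hne
    have hcl : IsClosed (range fun s => ψ s z) :=
      ((F.map_periodic hz hper).compact_of_continuous hT.ne' (F.continuous_orbit hz)).isClosed
    have : u ∈ range fun s => ψ s z := by
      rw [← hcl.closure_eq]
      refine Metric.mem_closure_iff.2 fun ε hε => ?_
      obtain ⟨d, -, hd⟩ := hsh.near hu ε hε 0
      exact ⟨_, ⟨d, rfl⟩, by rwa [dist_comm, dist_eq_norm]⟩
    obtain ⟨s, hs⟩ := this
    exact hout s hs.symm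
  have hpar : ∀ y ∈ omegaSet Φ x, (∃ r, ψ r y ≠ y) → Parallel C (path Φ x) ψ y := by
    intro y hy hne
    by_cases hnp : ∀ r, r ≠ 0 → ψ r y ≠ y
    · exact S.parallel_of_nonperiodic hP hy hnp
    · push Not at hnp
      obtain ⟨r, hr, h⟩ := hnp
      obtain ⟨T, hT, hper⟩ := hpos hy hr h
      exact S.parallel_of_periodic hy (hns hy hT hper hne) hne hT hper
  intro z hz w hvis
  by_cases hnp : ∀ r, r ≠ 0 → ψ r z ≠ z
  · exact S.fixed_of_visits hP hz hnp hvis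
  by_cases hne : ∃ r, ψ r z ≠ z
  · push Not at hnp
    obtain ⟨r, hr, h⟩ := hnp
    obtain ⟨T, hT, hper⟩ := hpos hz hr h
    obtain ⟨u, hu, hout⟩ := hno z hz T hT hper hne
    exact (S.no_periodic hP hpar hz hne hT hper hu hout).elim
  · push Not at hne
    have hzw : z = w := by
      refine eq_of_norm_sub_le_zero (le_of_forall_pos_le_add fun ε hε => ?_)
      obtain ⟨s₁, s₂, -, h, -⟩ := hvis ε hε 0
      rw [hne s₁] at h
      linarith
    rwa [← hzw]

end OrderedOmega

end NormedSpace

end SolidPB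

/-- **Solid Poincaré–Bendixson Theorem (Theorem C).** For a semiflow strongly focusing
monotone w.r.t. a cone of rank `k = 2` satisfying the standing assumptions, the ω-limit
set of a precompact pseudo-ordered semiorbit is either a nontrivial periodic orbit, or a
set consisting of equilibria together with their potential connecting orbits: for every
`z ∈ ω(x)`, `ω(z) ⊆ E` and `α(z) ⊆ E` (the latter along the flow extension on `ω(x)`). -/
theorem solid_poincare_bendixson
    {X : Type*} [NormedAddCommGroup X] [NormedSpace ℝ X] [CompleteSpace X]
    (Φ : Semiflow X) (DΦ : ℝ → X → X →L[ℝ] X) (C : Set X)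
    (hSA : StandingAssumptions Φ DΦ C 2)
    (hSFM : StronglyFocusingMonotone Φ DΦ C)
    (x : X) (hpre : IsCompact (closure (posOrbit Φ x)))
    (hpo : PseudoOrdered Φ C x)
    (ψ : ℝ → X → X) (hψ : IsFlowExtensionOn Φ ψ (omegaSet Φ x)) :
    (∃ z ∈ omegaSet Φ x, ∃ T : ℝ, 0 < T ∧ Φ.toFun T z = z ∧ posOrbit Φ z ≠ {z} ∧
      omegaSet Φ x = posOrbit Φ z) ∨
    (∀ z ∈ omegaSet Φ x, omegaSet Φ z ⊆ equilibria Φ ∧ alphaSet ψ z ⊆ equilibria Φ) := by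
  obtain ⟨P, hP⟩ := SolidPB.exists_projection hSA.2.2.1
  have S : SolidPB.OrderedOmega Φ C x ψ := ⟨hSA.1.1, hSA.1.2.1, hSFM.2.2.1, hpre, hpo, hψ⟩
  have F := S.flow
  refine (S.fixed_or_periodic_orbit hP).imp ?_ ?_
  · rintro ⟨z, hz, T, hT, hper, ⟨r, hr⟩, hall⟩
    have hpos : ∀ s, ψ s z ∈ posOrbit Φ z := fun s => by
      obtain ⟨t, ht, he⟩ := (F.map_periodic hz hper).exists_mem_Ico₀ hT s
      exact ⟨t, ht.1, by rw [← S.eq_toFun ht.1 hz]; exact he⟩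
    refine ⟨z, hz, T, hT, by rw [← S.eq_toFun hT.le hz, hper], fun h => ?_, ?_⟩
    · exact hr (by simpa [h] using hpos r)
    · refine Subset.antisymm (fun u hu => ?_) ?_
      · obtain ⟨s, rfl⟩ := hall u hu
        exact hpos s
      · rintro _ ⟨t, ht, rfl⟩
        rw [← S.eq_toFun ht hz]
        exact F.maps t z hz
  · intro h z hz
    have hω : omegaSet Φ z ⊆ omegaSet Φ x := fun w hw => by
      rw [← (SolidPB.isClosed_omegaSet Φ x).closure_eq]
      refine Metric.mem_closure_iff.2 fun ε hε => ?_
      obtain ⟨t, ht, hd⟩ := SolidPB.mem_omegaSet.1 hw ε hε 0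
      rw [SolidPB.path_of_nonneg Φ z ht, ← S.eq_toFun ht hz] at hd
      exact ⟨_, F.maps t z hz, by rwa [dist_comm, dist_eq_norm]⟩
    refine ⟨fun w hw t ht => ?_, fun w hw t ht => ?_⟩
    · rw [← S.eq_toFun ht (hω hw)]
      refine h z hz w (fun ε hε D => ?_) t
      obtain ⟨s₁, hs₁, h₁⟩ := SolidPB.mem_omegaSet.1 hw ε hε 0
      obtain ⟨s₂, hs₂, h₂⟩ := SolidPB.mem_omegaSet.1 hw ε hε (max (s₁ + D) 0)
      have hs₂' := (le_max_right _ _).trans hs₂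
      rw [SolidPB.path_of_nonneg Φ z hs₁, ← S.eq_toFun hs₁ hz] at h₁
      rw [SolidPB.path_of_nonneg Φ z hs₂', ← S.eq_toFun hs₂' hz] at h₂
      exact ⟨s₁, s₂, (le_max_left _ _).trans hs₂, h₁, h₂⟩
    · have hα : ∀ ε > 0, ∀ D, ∃ t ≥ D, ‖ψ (-t) z - w‖ < ε := fun ε hε D => by
        simp only [alphaSet, mem_iInter, Metric.mem_closure_iff] at hw
        obtain ⟨_, ⟨t, ht, rfl⟩, hd⟩ := hw (max D 0) (mem_Ici.2 (le_max_right D 0)) ε hε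
        exact ⟨t, (le_max_left _ _).trans ht, by rwa [dist_comm, dist_eq_norm] at hd⟩
      have hwK : w ∈ omegaSet Φ x := by
        rw [← (SolidPB.isClosed_omegaSet Φ x).closure_eq]
        refine Metric.mem_closure_iff.2 fun ε hε => ?_
        obtain ⟨t, -, hd⟩ := hα ε hε 0
        exact ⟨_, F.maps (-t) z hz, by rwa [dist_comm, dist_eq_norm]⟩
      rw [← S.eq_toFun ht hwK]
      refine h z hz w (fun ε hε D => ?_) t
      obtain ⟨s₂, -, h₂⟩ := hα ε hε 0
      obtain ⟨s₁, hs₁, h₁⟩ := hα ε hε (s₂ + D)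
      exact ⟨-s₁, -s₂, by linarith, h₁, h₂⟩
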